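/- arXiv:2312.01223 — 2 statements merged into one kernel-verified Lean document; each statement's English description precedes it below -/
import Mathlib

section
/- If P is a (k, ℓ)-cup-cap-saturated planar point set with k ≥ 4 and ℓ ≥ 4, then P contains two (k-1)-cups whose shadows are disjoint, and two (ℓ-1)-caps whose shadows are disjoint. -/
/-- The slope of the line through two planar points. -/
noncomputable def ptSlope (p q : ℝ × ℝ) : ℝ := (q.2 - p.2) / (q.1 - p.1)

/-- `f` lists the points of a cup: `x`-coordinates strictly increasing and slopes increasing. -/
def IsCupSeq {m : ℕ} (f : Fin m → ℝ × ℝ) : Prop :=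
  StrictMono (fun i => (f i).1) ∧
  ∀ i j k : Fin m, i < j → j < k → ptSlope (f i) (f j) < ptSlope (f j) (f k)

/-- `f` lists the points of a cap: `x`-coordinates strictly increasing and slopes decreasing. -/
def IsCapSeq {m : ℕ} (f : Fin m → ℝ × ℝ) : Prop :=
  StrictMono (fun i => (f i).1) ∧
  ∀ i j k : Fin m, i < j → j < k → ptSlope (f j) (f k) < ptSlope (f i) (f j)

/-- `P` contains a `k`-cup. -/
def HasCup (P : Finset (ℝ × ℝ)) (k : ℕ) : Prop :=
  ∃ f : Fin k → ℝ × ℝ, (∀ i, f i ∈ P) ∧ IsCupSeq f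

/-- `P` contains an `l`-cap. -/
def HasCap (P : Finset (ℝ × ℝ)) (l : ℕ) : Prop :=
  ∃ f : Fin l → ℝ × ℝ, (∀ i, f i ∈ P) ∧ IsCapSeq f

/-- `P` is in general position: no three distinct points are collinear. -/
def GenPos (P : Finset (ℝ × ℝ)) : Prop :=
  ∀ p ∈ P, ∀ q ∈ P, ∀ r ∈ P, p ≠ q → p ≠ r → q ≠ r →
    ¬ Collinear ℝ ({p, q, r} : Set (ℝ × ℝ))

/-- `P` is generic: in general position and all `x`-coordinates are distinct. -/
def Generic (P : Finset (ℝ × ℝ)) : Prop :=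
  GenPos P ∧ Set.InjOn (fun p : ℝ × ℝ => p.1) ↑P

/-- `P` contains no `k`-cup and no `l`-cap. -/
def CupCapFree (P : Finset (ℝ × ℝ)) (k l : ℕ) : Prop := ¬ HasCup P k ∧ ¬ HasCap P l

/-- `P` is `(k,l)`-cup-cap-saturated. -/
def CupCapSat (P : Finset (ℝ × ℝ)) (k l : ℕ) : Prop :=
  Generic P ∧ CupCapFree P k l ∧
  ∀ q : ℝ × ℝ, q ∉ P → Generic (insert q P) →
    HasCup (insert q P) k ∨ HasCap (insert q P) l

/-- `q` lies above every line through two points of `P`. -/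
def AboveLines (P : Finset (ℝ × ℝ)) (q : ℝ × ℝ) : Prop :=
  ∀ p ∈ P, ∀ r ∈ P, p.2 + ptSlope p r * (q.1 - p.1) < q.2

lemma exists_above (P : Finset (ℝ × ℝ)) (c : ℝ) : ∃ y : ℝ, AboveLines P (c, y) := by
  have h : ∀ᶠ y : ℝ in Filter.atTop, ∀ p ∈ P, ∀ r ∈ P, p.2 + ptSlope p r * (c - p.1) < y := by
    rw [Filter.eventually_all_finset]
    intro p _
    rw [Filter.eventually_all_finset]
    intro r _
    exact Filter.eventually_gt_atTop _
  obtain ⟨y, hy⟩ := h.exists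
  exact ⟨y, hy⟩

lemma above_not_collinear {p q r : ℝ × ℝ} (hpr : p.1 ≠ r.1)
    (h : p.2 + ptSlope p r * (q.1 - p.1) < q.2) :
    ¬ Collinear ℝ ({p, q, r} : Set (ℝ × ℝ)) := by
  intro hc
  rw [collinear_iff_of_mem (p₀ := p) (by simp)] at hc
  obtain ⟨v, hv⟩ := hc
  obtain ⟨t, ht⟩ := hv q (by simp)
  obtain ⟨u, hu⟩ := hv r (by simp)
  have h1 : q.1 = t * v.1 + p.1 := by rw [ht]; simp
  have h2 : q.2 = t * v.2 + p.2 := by rw [ht]; simp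
  have h3 : r.1 = u * v.1 + p.1 := by rw [hu]; simp
  have h4 : r.2 = u * v.2 + p.2 := by rw [hu]; simp
  unfold ptSlope at h
  have h5 : u * v.1 ≠ 0 := by
    intro h0
    apply hpr
    rw [h3, h0, zero_add]
  have h6 : u ≠ 0 := left_ne_zero_of_mul h5
  have h7 : v.1 ≠ 0 := right_ne_zero_of_mul h5
  have h8 : (r.2 - p.2) / (r.1 - p.1) * (q.1 - p.1) = t * v.2 := by
    rw [h1, h3, h4]
    have : u * v.1 + p.1 - p.1 = u * v.1 := by ring
    rw [this]
    field_simp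
    ring
  rw [h8, h2] at h
  linarith

lemma generic_insert {P : Finset (ℝ × ℝ)} (hP : Generic P) {q : ℝ × ℝ}
    (hq : ∀ p ∈ P, p.1 ≠ q.1) (ha : AboveLines P q) : Generic (insert q P) := by
  have key : ∀ p ∈ P, ∀ r ∈ P, p ≠ r → ¬ Collinear ℝ ({p, q, r} : Set (ℝ × ℝ)) := by
    intro p hp r hr hne
    exact above_not_collinear (fun h => hne (hP.2 hp hr h)) (ha p hp r hr)
  constructor
  · intro a ha' b hb c hc hab hac hbc
    rw [Finset.mem_insert] at ha' hb hc
    rcases ha' with rfl | ha'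
    · rcases hb with rfl | hb
      · exact absurd rfl hab
      rcases hc with rfl | hc
      · exact absurd rfl hac
      rw [Set.insert_comm]
      exact key b hb c hc hbc
    rcases hb with rfl | hb
    · rcases hc with rfl | hc
      · exact absurd rfl hbc
      exact key a ha' c hc hac
    rcases hc with rfl | hc
    · rw [Set.pair_comm b c]
      exact key a ha' b hb hab
    exact hP.1 a ha' b hb c hc hab hac hbc
  · intro a ha' b hb hab
    have hab' : a.1 = b.1 := hab
    rw [Finset.mem_coe, Finset.mem_insert] at ha' hb
    rcases ha' with rfl | ha'
    · rcases hb with rfl | hb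
      · rfl
      exact absurd hab'.symm (hq b hb)
    rcases hb with rfl | hb
    · exact absurd hab' (hq a ha')
    exact hP.2 ha' hb hab

lemma above_mid {p q r : ℝ × ℝ} (hpq : p.1 < q.1) (hqr : q.1 < r.1)
    (h : p.2 + ptSlope p r * (q.1 - p.1) < q.2) : ptSlope q r < ptSlope p q := by
  have e : ptSlope p r * (r.1 - p.1) = r.2 - p.2 := by
    unfold ptSlope; exact div_mul_cancel₀ _ (by linarith)
  have h1 : ptSlope p r < ptSlope p q := by
    conv_rhs => unfold ptSlope
    rw [lt_div_iff₀ (by linarith)]; linarith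
  have h2 : ptSlope q r < ptSlope p r := by
    conv_lhs => unfold ptSlope
    rw [div_lt_iff₀ (by linarith)]; linarith
  exact h2.trans h1

lemma above_right {p r q : ℝ × ℝ} (hpr : p.1 < r.1) (hrq : r.1 < q.1)
    (h : p.2 + ptSlope p r * (q.1 - p.1) < q.2) : ptSlope p r < ptSlope r q := by
  have e : ptSlope p r * (r.1 - p.1) = r.2 - p.2 := by
    unfold ptSlope; exact div_mul_cancel₀ _ (by linarith)
  conv_rhs => unfold ptSlope
  rw [lt_div_iff₀ (by linarith)]; linarith

lemma above_left {q p r : ℝ × ℝ} (hqp : q.1 < p.1) (hpr : p.1 < r.1)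
    (h : p.2 + ptSlope p r * (q.1 - p.1) < q.2) : ptSlope q p < ptSlope p r := by
  conv_lhs => unfold ptSlope
  rw [div_lt_iff₀ (by linarith)]; linarith

lemma cup_split {n l : ℕ} (hn : 3 ≤ n) (hl : 4 ≤ l) {P : Finset (ℝ × ℝ)}
    (hP : CupCapSat P (n + 1) l) (c : ℝ) (hc : ∀ p ∈ P, p.1 ≠ c) :
    ∃ g : Fin n → ℝ × ℝ, (∀ i, g i ∈ P) ∧ IsCupSeq g ∧
      ((∀ i, (g i).1 < c) ∨ (∀ i, c < (g i).1)) := by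
  obtain ⟨hgen, ⟨hcup, hcap⟩, hsat⟩ := hP
  obtain ⟨y, hy⟩ := exists_above P c
  obtain ⟨q, hqdef⟩ : ∃ q : ℝ × ℝ, q = (c, y) := ⟨_, rfl⟩
  have hq1 : q.1 = c := by rw [hqdef]
  rw [← hqdef] at hy
  have hqP : q ∉ P := fun h => hc q h hq1
  rcases hsat q hqP (generic_insert hgen (by rw [hq1]; exact hc) hy) with
    ⟨f, hf, hfc⟩ | ⟨f, hf, hfc⟩
  · by_cases hex : ∃ i, f i = q
    · obtain ⟨i, hi⟩ := hex
      have hmem : ∀ j, j ≠ i → f j ∈ P := by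
        intro j hj
        rcases Finset.mem_insert.1 (hf j) with h | h
        · exact absurd (hfc.1.injective (show (f j).1 = (f i).1 by rw [h, hi])) hj
        · exact h
      by_cases hi0 : i = 0
      · subst hi0
        refine ⟨fun j => f j.succ, fun j => hmem _ (Fin.succ_ne_zero j), ⟨?_, ?_⟩, Or.inr ?_⟩
        · intro a b hab
          exact hfc.1 (Fin.succ_lt_succ_iff.2 hab)
        · intro a b d hab hbd
          exact hfc.2 _ _ _ (Fin.succ_lt_succ_iff.2 hab) (Fin.succ_lt_succ_iff.2 hbd)
        · intro j
          rw [← hq1, ← hi]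
          exact hfc.1 (Fin.succ_pos j)
      · by_cases hil : i = Fin.last n
        · subst hil
          refine ⟨fun j => f j.castSucc, fun j => hmem _ (Fin.castSucc_lt_last j).ne,
            ⟨?_, ?_⟩, Or.inl ?_⟩
          · intro a b hab
            exact hfc.1 (Fin.castSucc_lt_castSucc_iff.2 hab)
          · intro a b d hab hbd
            exact hfc.2 _ _ _ (Fin.castSucc_lt_castSucc_iff.2 hab)
              (Fin.castSucc_lt_castSucc_iff.2 hbd)
          · intro j
            rw [← hq1, ← hi]
            exact hfc.1 (Fin.castSucc_lt_last j)
        · exfalso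
          have h0 : (0 : Fin (n + 1)) < i := Fin.pos_iff_ne_zero.2 hi0
          have hL : i < Fin.last n := Fin.lt_last_iff_ne_last.2 hil
          have h1 := hfc.2 _ _ _ h0 hL
          have h2 := hfc.1 h0
          have h3 := hfc.1 hL
          simp only [hi] at h1 h2 h3
          exact lt_asymm h1 (above_mid h2 h3 (hy _ (hmem _ h0.ne) _ (hmem _ hL.ne')))
    · push Not at hex
      exact absurd ⟨f, fun i => (Finset.mem_insert.1 (hf i)).resolve_left (hex i), hfc⟩ hcup
  · exfalso
    by_cases hex : ∃ i, f i = q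
    · obtain ⟨i, hi⟩ := hex
      have hmem : ∀ j, j ≠ i → f j ∈ P := by
        intro j hj
        rcases Finset.mem_insert.1 (hf j) with h | h
        · exact absurd (hfc.1.injective (show (f j).1 = (f i).1 by rw [h, hi])) hj
        · exact h
      by_cases h2 : 2 ≤ i.1
      · have ha : (⟨0, by omega⟩ : Fin l) < ⟨1, by omega⟩ := by simp
        have hb : (⟨1, by omega⟩ : Fin l) < i := by rw [Fin.lt_def]; exact h2
        have h1 := hfc.2 _ _ _ ha hb
        have h3 := hfc.1 ha
        have h4 := hfc.1 hb
        simp only [hi] at h1 h3 h4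
        exact lt_asymm h1 (above_right h3 h4 (hy _ (hmem _ (ha.trans hb).ne) _ (hmem _ hb.ne)))
      · have ha : i < (⟨2, by omega⟩ : Fin l) := by rw [Fin.lt_def]; simp; omega
        have hb : (⟨2, by omega⟩ : Fin l) < ⟨3, by omega⟩ := by simp
        have h1 := hfc.2 _ _ _ ha hb
        have h3 := hfc.1 ha
        have h4 := hfc.1 hb
        simp only [hi] at h1 h3 h4
        exact lt_asymm h1 (above_left h3 h4 (hy _ (hmem _ ha.ne') _ (hmem _ (ha.trans hb).ne')))
    · push Not at hex
      exact hcap ⟨f, fun i => (Finset.mem_insert.1 (hf i)).resolve_left (hex i), hfc⟩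

lemma cup_pair {n l : ℕ} (hn : 3 ≤ n) (hl : 4 ≤ l) {P : Finset (ℝ × ℝ)}
    (hP : CupCapSat P (n + 1) l) :
    ∃ f g : Fin n → ℝ × ℝ, (∀ i, f i ∈ P) ∧ (∀ i, g i ∈ P) ∧ IsCupSeq f ∧ IsCupSeq g ∧
      ∀ i j, (f i).1 ≤ (g j).1 := by
  classical
  obtain ⟨S, hS⟩ : ∃ S : Finset (ℝ × ℝ), S = P.filter (fun p => ∃ f : Fin n → ℝ × ℝ,
    (∀ i, f i ∈ P) ∧ IsCupSeq f ∧ ∀ i, (f i).1 ≤ p.1) := ⟨_, rfl⟩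
  have hlast : ∀ f : Fin n → ℝ × ℝ, (∀ i, f i ∈ P) → IsCupSeq f → f ⟨n - 1, by omega⟩ ∈ S := by
    intro f hf hc
    rw [hS, Finset.mem_filter]
    refine ⟨hf _, f, hf, hc, fun i => hc.1.monotone ?_⟩
    rw [Fin.le_def]
    have := i.2
    simp only
    omega
  have hne : S.Nonempty := by
    have h : ∀ᶠ c : ℝ in Filter.atTop, ∀ p ∈ P, p.1 < c := by
      rw [Filter.eventually_all_finset]
      intro p _
      exact Filter.eventually_gt_atTop _
    obtain ⟨c, hc⟩ := h.exists
    obtain ⟨g, hg, hgc, _⟩ := cup_split hn hl hP c (fun p hp => (hc p hp).ne)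
    exact ⟨_, hlast g hg hgc⟩
  obtain ⟨a, haS, hmin⟩ := S.exists_min_image (fun p => p.1) hne
  have haS' := haS
  rw [hS, Finset.mem_filter] at haS'
  obtain ⟨haP, f, hf, hfc, hfa⟩ := haS'
  have h : ∀ᶠ c : ℝ in nhdsWithin a.1 (Set.Iio a.1), c < a.1 ∧ ∀ p ∈ P, p.1 < a.1 → p.1 < c := by
    refine Filter.Eventually.and self_mem_nhdsWithin ?_
    rw [Filter.eventually_all_finset]
    intro p _
    by_cases hp : p.1 < a.1
    · filter_upwards [nhdsWithin_le_nhds (lt_mem_nhds hp)] with c hc _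
      exact hc
    · exact Filter.Eventually.of_forall (fun c h => absurd h hp)
  obtain ⟨c, hca, hc⟩ := h.exists
  have hcP : ∀ p ∈ P, p.1 ≠ c := by
    intro p hp h
    have := hc p hp (h ▸ hca)
    exact this.ne h
  obtain ⟨g, hg, hgc, h | h⟩ := cup_split hn hl hP c hcP
  · exfalso
    have h1 := hmin _ (hlast g hg hgc)
    have h2 := h ⟨n - 1, by omega⟩
    linarith
  · refine ⟨f, g, hf, hg, hfc, hgc, fun i j => (hfa i).trans ?_⟩
    by_contra hlt
    exact lt_asymm (hc _ (hg j) (not_le.1 hlt)) (h j)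

/-- Reflection in the horizontal axis. -/
def flipPt (p : ℝ × ℝ) : ℝ × ℝ := (p.1, -p.2)

lemma flipPt_flipPt (p : ℝ × ℝ) : flipPt (flipPt p) = p := by simp [flipPt]

lemma flip_slope (p q : ℝ × ℝ) : ptSlope (flipPt p) (flipPt q) = - ptSlope p q := by
  simp only [ptSlope, flipPt]
  ring

lemma flip_cup {m : ℕ} {f : Fin m → ℝ × ℝ} (h : IsCupSeq f) :
    IsCapSeq (fun i => flipPt (f i)) := by
  refine ⟨h.1, fun i j k hij hjk => ?_⟩
  rw [flip_slope, flip_slope]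
  exact neg_lt_neg (h.2 i j k hij hjk)

lemma flip_cap {m : ℕ} {f : Fin m → ℝ × ℝ} (h : IsCapSeq f) :
    IsCupSeq (fun i => flipPt (f i)) := by
  refine ⟨h.1, fun i j k hij hjk => ?_⟩
  rw [flip_slope, flip_slope]
  exact neg_lt_neg (h.2 i j k hij hjk)

lemma flip_collinear {p q r : ℝ × ℝ} (h : Collinear ℝ ({p, q, r} : Set (ℝ × ℝ))) :
    Collinear ℝ ({flipPt p, flipPt q, flipPt r} : Set (ℝ × ℝ)) := by
  rw [collinear_iff_exists_forall_eq_smul_vadd] at h ⊢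
  obtain ⟨p₀, v, hv⟩ := h
  refine ⟨flipPt p₀, flipPt v, ?_⟩
  have key : ∀ x ∈ ({p, q, r} : Set (ℝ × ℝ)), ∃ t : ℝ, flipPt x = t • flipPt v +ᵥ flipPt p₀ := by
    intro x hx
    obtain ⟨t, ht⟩ := hv x hx
    refine ⟨t, ?_⟩
    rw [ht]
    ext
    · simp [flipPt]
    · simp [flipPt]
      ring
  intro x hx
  rcases hx with rfl | rfl | rfl
  · exact key p (by simp)
  · exact key q (by simp)
  · exact key r (by simp)

lemma flip_generic {P Q : Finset (ℝ × ℝ)} (h : ∀ p ∈ Q, flipPt p ∈ P) (hP : Generic P) :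
    Generic Q := by
  have hinj : ∀ a b, a ≠ b → flipPt a ≠ flipPt b := by
    intro a b hab he
    apply hab
    rw [← flipPt_flipPt a, he, flipPt_flipPt]
  refine ⟨fun a ha b hb c hc hab hac hbc hcol => ?_, fun a ha b hb hab => ?_⟩
  · exact hP.1 _ (h a ha) _ (h b hb) _ (h c hc) (hinj _ _ hab) (hinj _ _ hac) (hinj _ _ hbc)
      (flip_collinear hcol)
  · by_contra hne
    exact hinj a b hne (hP.2 (h a ha) (h b hb) hab)

lemma flip_hasCup {P Q : Finset (ℝ × ℝ)} (h : ∀ p ∈ P, flipPt p ∈ Q) {k : ℕ} (hP : HasCup P k) :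
    HasCap Q k := by
  obtain ⟨f, hf, hc⟩ := hP
  exact ⟨_, fun i => h _ (hf i), flip_cup hc⟩

lemma flip_hasCap {P Q : Finset (ℝ × ℝ)} (h : ∀ p ∈ P, flipPt p ∈ Q) {k : ℕ} (hP : HasCap P k) :
    HasCup Q k := by
  obtain ⟨f, hf, hc⟩ := hP
  exact ⟨_, fun i => h _ (hf i), flip_cap hc⟩

lemma flip_sat {P : Finset (ℝ × ℝ)} {k l : ℕ} (hP : CupCapSat P k l) :
    CupCapSat (P.image flipPt) l k := by
  obtain ⟨hgen, ⟨hcup, hcap⟩, hsat⟩ := hP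
  have h1 : ∀ p ∈ P, flipPt p ∈ P.image flipPt := fun p hp => Finset.mem_image_of_mem _ hp
  have h2 : ∀ p ∈ P.image flipPt, flipPt p ∈ P := by
    intro p hp
    obtain ⟨r, hr, rfl⟩ := Finset.mem_image.1 hp
    rwa [flipPt_flipPt]
  refine ⟨flip_generic h2 hgen, ⟨fun h => hcap (flip_hasCup h2 h),
    fun h => hcup (flip_hasCap h2 h)⟩, fun q hq hg => ?_⟩
  have h3 : ∀ p ∈ insert (flipPt q) P, flipPt p ∈ insert q (P.image flipPt) := by
    intro p hp
    rcases Finset.mem_insert.1 hp with rfl | hp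
    · rw [flipPt_flipPt]; exact Finset.mem_insert_self _ _
    · exact Finset.mem_insert_of_mem (h1 p hp)
  have hq' : flipPt q ∉ P := by
    intro h
    apply hq
    have := h1 _ h
    rwa [flipPt_flipPt] at this
  rcases hsat (flipPt q) hq' (flip_generic h3 hg) with h | h
  · exact Or.inr (flip_hasCup h3 h)
  · exact Or.inl (flip_hasCap h3 h)

theorem sat_disjoint_shadows (k l : ℕ) (hk : 4 ≤ k) (hl : 4 ≤ l)
    (P : Finset (ℝ × ℝ)) (hP : CupCapSat P k l) :
    (∃ f g : Fin (k - 1) → ℝ × ℝ, (∀ i, f i ∈ P) ∧ (∀ i, g i ∈ P) ∧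
      IsCupSeq f ∧ IsCupSeq g ∧
      Disjoint (Set.Ioo (f ⟨0, by omega⟩).1 (f ⟨k - 2, by omega⟩).1)
        (Set.Ioo (g ⟨0, by omega⟩).1 (g ⟨k - 2, by omega⟩).1)) ∧
    (∃ f g : Fin (l - 1) → ℝ × ℝ, (∀ i, f i ∈ P) ∧ (∀ i, g i ∈ P) ∧
      IsCapSeq f ∧ IsCapSeq g ∧
      Disjoint (Set.Ioo (f ⟨0, by omega⟩).1 (f ⟨l - 2, by omega⟩).1)
        (Set.Ioo (g ⟨0, by omega⟩).1 (g ⟨l - 2, by omega⟩).1)) := by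
  have dis : ∀ a b c d : ℝ, b ≤ c → Disjoint (Set.Ioo a b) (Set.Ioo c d) := by
    intro a b c d h
    rw [Set.disjoint_left]
    intro x hx hx'
    exact absurd (hx.2.trans_le h) (lt_asymm hx'.1)
  constructor
  · obtain ⟨n, rfl⟩ : ∃ n, k = n + 1 := ⟨k - 1, by omega⟩
    obtain ⟨f, g, hf, hg, hfc, hgc, h⟩ := cup_pair (by omega) hl hP
    exact ⟨f, g, hf, hg, hfc, hgc, dis _ _ _ _ (h _ _)⟩
  · obtain ⟨n, rfl⟩ : ∃ n, l = n + 1 := ⟨l - 1, by omega⟩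
    obtain ⟨f, g, hf, hg, hfc, hgc, h⟩ := cup_pair (by omega) hk (flip_sat hP)
    have h2 : ∀ p ∈ P.image flipPt, flipPt p ∈ P := by
      intro p hp
      obtain ⟨r, hr, rfl⟩ := Finset.mem_image.1 hp
      rwa [flipPt_flipPt]
    exact ⟨fun i => flipPt (f i), fun i => flipPt (g i), fun i => h2 _ (hf i),
      fun i => h2 _ (hg i), flip_cup hfc, flip_cup hgc, dis _ _ _ _ (h _ _)⟩
end

section
/- Let P_1, ..., P_{n-1} be very generic planar point sets such that P_i is (i+1, n+1-i)-cup-cap-saturated for each 1 ≤ i ≤ n-1, where n ≥ 3. Then there exists a planar point set P in general position of size |P_1| + ... + |P_{n-1}| that is n-gon-saturated: P contains no n points in convex position, and for every point q ∉ P with P ∪ {q} in general position, P ∪ {q} contains n points in convex position including q. -/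
/-- A set of planar points is in convex position: every point is a vertex of the convex hull. -/
def ConvexPos (S : Set (ℝ × ℝ)) : Prop :=
  ∀ p ∈ S, p ∉ convexHull ℝ (S \ {p})

/-- `P` is very generic: in general position, and its members together with all
intersection points of distinct lines spanned by `P` have pairwise distinct
`x`-coordinates. -/
def VeryGeneric (P : Finset (ℝ × ℝ)) : Prop :=
  GenPos P ∧
  Set.InjOn (fun p : ℝ × ℝ => p.1)
    (↑P ∪ {z : ℝ × ℝ | ∃ a ∈ P, ∃ b ∈ P, ∃ c ∈ P, ∃ d ∈ P, a ≠ b ∧ c ≠ d ∧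
      affineSpan ℝ ({a, b} : Set (ℝ × ℝ)) ≠ affineSpan ℝ ({c, d} : Set (ℝ × ℝ)) ∧
      z ∈ affineSpan ℝ ({a, b} : Set (ℝ × ℝ)) ∧
      z ∈ affineSpan ℝ ({c, d} : Set (ℝ × ℝ))})



/-- Orientation determinant of three planar points. -/
def ori (a b c : ℝ × ℝ) : ℝ := (b.1 - a.1) * (c.2 - a.2) - (b.2 - a.2) * (c.1 - a.1)

lemma ori_rot (a b c : ℝ × ℝ) : ori b c a = ori a b c := by unfold ori; ring

lemma ori_swap (a b c : ℝ × ℝ) : ori a c b = - ori a b c := by unfold ori; ring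

lemma ori_swap' (a b c : ℝ × ℝ) : ori b a c = - ori a b c := by unfold ori; ring

/-- Grassmann-Pluecker relation. -/
lemma ori_gp (p a b c d : ℝ × ℝ) :
    ori p a b * ori p c d - ori p a c * ori p b d + ori p a d * ori p b c = 0 := by
  unfold ori; ring

lemma ori_eq_zero_of_collinear {a b c : ℝ × ℝ}
    (h : Collinear ℝ ({a, b, c} : Set (ℝ × ℝ))) : ori a b c = 0 := by
  rw [collinear_iff_of_mem (p₀ := a) (by simp)] at h
  obtain ⟨v, hv⟩ := h
  obtain ⟨r, hr⟩ := hv b (by simp)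
  obtain ⟨s, hs⟩ := hv c (by simp)
  subst hr hs
  simp [ori]
  ring

lemma collinear_of_ori_eq_zero {a b c : ℝ × ℝ} (hab : a ≠ b) (h : ori a b c = 0) :
    Collinear ℝ ({a, b, c} : Set (ℝ × ℝ)) := by
  rw [collinear_iff_of_mem (p₀ := a) (by simp)]
  refine ⟨b - a, ?_⟩
  unfold ori at h
  have key : ∃ t : ℝ, c = t • (b - a) +ᵥ a := by
    by_cases h1 : b.1 - a.1 = 0
    · have h2 : b.2 - a.2 ≠ 0 := by
        intro h2
        apply hab
        ext <;> linarith
      refine ⟨(c.2 - a.2) / (b.2 - a.2), ?_⟩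
      have h3 : c.1 - a.1 = 0 := by
        rw [h1] at h
        have : (b.2 - a.2) * (c.1 - a.1) = 0 := by linarith
        rcases mul_eq_zero.1 this with h | h
        · exact absurd h h2
        · exact h
      ext
      · simp [h1]; linarith
      · simp; field_simp; ring
    · refine ⟨(c.1 - a.1) / (b.1 - a.1), ?_⟩
      ext
      · simp; field_simp; ring
      · simp; field_simp; linarith
  intro p hp
  simp only [Set.mem_insert_iff, Set.mem_singleton_iff] at hp
  rcases hp with rfl | rfl | rfl
  · exact ⟨0, by simp⟩
  · exact ⟨1, by simp⟩
  · exact key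

lemma genPos_iff (P : Finset (ℝ × ℝ)) :
    GenPos P ↔ ∀ p ∈ P, ∀ q ∈ P, ∀ r ∈ P, p ≠ q → p ≠ r → q ≠ r → ori p q r ≠ 0 := by
  constructor
  · intro h p hp q hq r hr h1 h2 h3 h0
    exact h p hp q hq r hr h1 h2 h3 (collinear_of_ori_eq_zero h1 h0)
  · intro h p hp q hq r hr h1 h2 h3 h0
    exact h p hp q hq r hr h1 h2 h3 (ori_eq_zero_of_collinear h0)

/-- Three-point test for cups. -/
def CupSet (C : Finset (ℝ × ℝ)) : Prop :=
  ∀ a ∈ C, ∀ b ∈ C, ∀ c ∈ C, a.1 < b.1 → b.1 < c.1 → 0 < ori a b c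

/-- Three-point test for caps. -/
def CapSet (C : Finset (ℝ × ℝ)) : Prop :=
  ∀ a ∈ C, ∀ b ∈ C, ∀ c ∈ C, a.1 < b.1 → b.1 < c.1 → ori a b c < 0

lemma slope_lt_iff {a b c : ℝ × ℝ} (h1 : a.1 < b.1) (h2 : b.1 < c.1) :
    ptSlope a b < ptSlope b c ↔ 0 < ori a b c := by
  unfold ptSlope ori
  rw [div_lt_div_iff₀ (by linarith) (by linarith)]
  constructor <;> intro h <;> nlinarith

lemma slope_gt_iff {a b c : ℝ × ℝ} (h1 : a.1 < b.1) (h2 : b.1 < c.1) :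
    ptSlope b c < ptSlope a b ↔ ori a b c < 0 := by
  unfold ptSlope ori
  rw [div_lt_div_iff₀ (by linarith) (by linarith)]
  constructor <;> intro h <;> nlinarith

abbrev XInj (P : Finset (ℝ × ℝ)) : Prop := Set.InjOn (fun p : ℝ × ℝ => p.1) ↑P

/-- enumeration of a finset by x-coordinate -/
lemma exists_enum (C : Finset (ℝ × ℝ)) (hC : XInj C) (k : ℕ) (hk : C.card = k) :
    ∃ f : Fin k → ℝ × ℝ, (∀ i, f i ∈ C) ∧ StrictMono (fun i => (f i).1) := by
  have hcard : (C.image (fun p : ℝ × ℝ => p.1)).card = k := by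
    rw [Finset.card_image_of_injOn hC, hk]
  let e := (C.image (fun p : ℝ × ℝ => p.1)).orderEmbOfFin hcard
  have he : ∀ i, ∃ p ∈ C, p.1 = e i := by
    intro i
    have := (C.image (fun p : ℝ × ℝ => p.1)).orderEmbOfFin_mem hcard i
    exact Finset.mem_image.1 this
  choose f hf hfe using he
  refine ⟨f, hf, ?_⟩
  intro i j hij
  simp only [hfe]
  exact e.strictMono hij

lemma hasCup_iff (P : Finset (ℝ × ℝ)) (k : ℕ) :
    HasCup P k ↔ ∃ C ⊆ P, C.card = k ∧ XInj C ∧ CupSet C := by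
  constructor
  · rintro ⟨f, hf, hm, hs⟩
    have hinj : Function.Injective f := by
      intro i j hij
      exact hm.injective (by simp [hij])
    refine ⟨Finset.univ.image f, ?_, ?_, ?_, ?_⟩
    · intro p hp
      simp only [Finset.mem_image, Finset.mem_univ, true_and] at hp
      obtain ⟨i, rfl⟩ := hp
      exact hf i
    · rw [Finset.card_image_of_injective _ hinj]; simp
    · intro p hp q hq hpq
      simp only [Finset.coe_image, Finset.coe_univ, Set.image_univ, Set.mem_range] at hp hq
      obtain ⟨i, rfl⟩ := hp
      obtain ⟨j, rfl⟩ := hq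
      rw [hm.injective hpq]
    · intro a ha b hb c hc hab hbc
      simp only [Finset.mem_image, Finset.mem_univ, true_and] at ha hb hc
      obtain ⟨i, rfl⟩ := ha
      obtain ⟨j, rfl⟩ := hb
      obtain ⟨l, rfl⟩ := hc
      rw [← slope_lt_iff hab hbc]
      exact hs i j l (hm.lt_iff_lt.1 hab) (hm.lt_iff_lt.1 hbc)
  · rintro ⟨C, hCP, hk, hx, hC⟩
    obtain ⟨f, hf, hm⟩ := exists_enum C hx k hk
    refine ⟨f, fun i => hCP (hf i), hm, ?_⟩
    intro i j l hij hjl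
    rw [slope_lt_iff (hm hij) (hm hjl)]
    exact hC _ (hf i) _ (hf j) _ (hf l) (hm hij) (hm hjl)

lemma hasCap_iff (P : Finset (ℝ × ℝ)) (k : ℕ) :
    HasCap P k ↔ ∃ C ⊆ P, C.card = k ∧ XInj C ∧ CapSet C := by
  constructor
  · rintro ⟨f, hf, hm, hs⟩
    have hinj : Function.Injective f := by
      intro i j hij
      exact hm.injective (by simp [hij])
    refine ⟨Finset.univ.image f, ?_, ?_, ?_, ?_⟩
    · intro p hp
      simp only [Finset.mem_image, Finset.mem_univ, true_and] at hp
      obtain ⟨i, rfl⟩ := hp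
      exact hf i
    · rw [Finset.card_image_of_injective _ hinj]; simp
    · intro p hp q hq hpq
      simp only [Finset.coe_image, Finset.coe_univ, Set.image_univ, Set.mem_range] at hp hq
      obtain ⟨i, rfl⟩ := hp
      obtain ⟨j, rfl⟩ := hq
      rw [hm.injective hpq]
    · intro a ha b hb c hc hab hbc
      simp only [Finset.mem_image, Finset.mem_univ, true_and] at ha hb hc
      obtain ⟨i, rfl⟩ := ha
      obtain ⟨j, rfl⟩ := hb
      obtain ⟨l, rfl⟩ := hc
      rw [← slope_gt_iff hab hbc]
      exact hs i j l (hm.lt_iff_lt.1 hab) (hm.lt_iff_lt.1 hbc)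
  · rintro ⟨C, hCP, hk, hx, hC⟩
    obtain ⟨f, hf, hm⟩ := exists_enum C hx k hk
    refine ⟨f, fun i => hCP (hf i), hm, ?_⟩
    intro i j l hij hjl
    rw [slope_gt_iff (hm hij) (hm hjl)]
    exact hC _ (hf i) _ (hf j) _ (hf l) (hm hij) (hm hjl)

/-- The half plane to the left of `p → q` together with one boundary point is convex. -/
lemma convex_half (p q s : ℝ × ℝ) (hs : ori p q s = 0) :
    Convex ℝ {x : ℝ × ℝ | 0 < ori p q x ∨ x = s} := by
  intro x hx y hy a b ha hb hab
  have hlin : ori p q (a • x + b • y) = a * ori p q x + b * ori p q y := by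
    have : a = 1 - b := by linarith
    subst this
    simp [ori]
    ring
  simp only [Set.mem_ofPred_eq] at hx hy ⊢
  rcases ha.eq_or_lt with rfl | ha
  · have : b = 1 := by linarith
    subst this
    simpa using hy
  rcases hb.eq_or_lt with rfl | hb
  · have : a = 1 := by linarith
    subst this
    simpa using hx
  rcases hx with hx | rfl
  · left
    rw [hlin]
    rcases hy with hy | rfl
    · positivity
    · rw [hs]; simp; positivity
  · rcases hy with hy | rfl
    · left
      rw [hlin, hs]; simp; positivity
    · right
      rw [← add_smul, hab, one_smul]

/-- Orientation criterion for convex position. -/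
lemma convexPos_of_rank {α : Type*} [LinearOrder α] (S : Finset (ℝ × ℝ)) (r : ℝ × ℝ → α)
    (hr : Set.InjOn r ↑S)
    (h : ∀ a ∈ S, ∀ b ∈ S, ∀ c ∈ S, r a < r b → r b < r c → 0 < ori a b c) :
    ConvexPos (↑S : Set (ℝ × ℝ)) := by
  intro p hp hmem
  have hp' : p ∈ S := hp
  by_cases hG : (S.filter (fun x => r p < r x)).Nonempty
  · obtain ⟨s, hs, hmin⟩ := Finset.exists_min_image _ r hG
    simp only [Finset.mem_filter] at hs hmin
    have hsub : (↑S \ {p} : Set (ℝ × ℝ)) ⊆ {x | 0 < ori p s x ∨ x = s} := by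
      rintro x ⟨hx, hxp⟩
      have hx' : x ∈ S := hx
      have hne : r x ≠ r p := fun h' => hxp (hr hx hp h')
      rcases lt_or_gt_of_ne hne with h1 | h1
      · left
        have := h x hx' p hp' s hs.1 h1 hs.2
        rwa [ori_rot]
      · have := hmin x ⟨hx', h1⟩
        rcases this.eq_or_lt with h2 | h2
        · right; exact (hr hs.1 hx h2).symm
        · left; exact h p hp' s hs.1 x hx' hs.2 h2
    have := convexHull_min hsub (convex_half p s s (by unfold ori; ring)) hmem
    rcases this with h1 | h1
    · simp [ori] at h1
    · rw [← h1] at hs; exact lt_irrefl _ hs.2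
  · by_cases hL : (S.filter (fun x => r x < r p)).Nonempty
    · obtain ⟨s, hs, hmax⟩ := Finset.exists_max_image _ r hL
      simp only [Finset.mem_filter] at hs hmax
      have hsub : (↑S \ {p} : Set (ℝ × ℝ)) ⊆ {x | 0 < ori s p x ∨ x = s} := by
        rintro x ⟨hx, hxp⟩
        have hx' : x ∈ S := hx
        have hne : r x ≠ r p := fun h' => hxp (hr hx hp h')
        rcases lt_or_gt_of_ne hne with h1 | h1
        · have := hmax x ⟨hx', h1⟩
          rcases this.eq_or_lt with h2 | h2
          · right; exact (hr hx hs.1 h2)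
          · left
            have := h x hx' s hs.1 p hp' h2 hs.2
            rwa [ori_rot]
        · exact absurd ⟨x, by simp [hx', h1]⟩ hG
      have := convexHull_min hsub (convex_half s p s (by unfold ori; ring)) hmem
      rcases this with h1 | h1
      · unfold ori at h1; nlinarith
      · rw [← h1] at hs; exact lt_irrefl _ hs.2
    · have : (↑S \ {p} : Set (ℝ × ℝ)) = ∅ := by
        ext x
        simp only [Set.mem_sdiff, Set.mem_singleton_iff, Set.mem_empty_iff_false, iff_false]
        rintro ⟨hx, hxp⟩
        have hx' : x ∈ S := hx
        have hne : r x ≠ r p := fun h' => hxp (hr hx hp h')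
        rcases lt_or_gt_of_ne hne with h1 | h1
        · exact hL ⟨x, by simp [hx', h1]⟩
        · exact hG ⟨x, by simp [hx', h1]⟩
      rw [this] at hmem
      simp at hmem

/-- A cup below a cap is in convex position. -/
lemma conv_of_cup_cap (U V : Finset (ℝ × ℝ)) (r : ℝ × ℝ → ℝ) (hd : Disjoint U V)
    (rU : Set.InjOn r ↑U) (rV : Set.InjOn r ↑V)
    (hU : ∀ a ∈ U, ∀ b ∈ U, ∀ c ∈ U, r a < r b → r b < r c → 0 < ori a b c)
    (hV : ∀ a ∈ V, ∀ b ∈ V, ∀ c ∈ V, r a < r b → r b < r c → ori a b c < 0)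
    (hUV : ∀ a ∈ U, ∀ b ∈ U, r a < r b → ∀ v ∈ V, 0 < ori a b v)
    (hVU : ∀ a ∈ V, ∀ b ∈ V, r a < r b → ∀ u ∈ U, ori a b u < 0) :
    ConvexPos (↑(U ∪ V) : Set (ℝ × ℝ)) := by
  have hdV : ∀ x ∈ V, x ∉ U := fun x hx hx' => Finset.disjoint_left.1 hd hx' hx
  let R : ℝ × ℝ → Lex (ℝ ⊕ ℝᵒᵈ) := fun p =>
    if p ∈ U then toLex (Sum.inl (r p)) else toLex (Sum.inr (OrderDual.toDual (r p)))
  have RU : ∀ p ∈ U, R p = toLex (Sum.inl (r p)) := fun p hp => by simp [R, hp]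
  have RV : ∀ p ∈ V, R p = toLex (Sum.inr (OrderDual.toDual (r p))) :=
    fun p hp => by simp [R, hdV p hp]
  apply convexPos_of_rank _ R
  · intro a ha b hb hab
    simp only [Finset.coe_union, Set.mem_union, Finset.mem_coe] at ha hb
    rcases ha with ha | ha <;> rcases hb with hb | hb
    · rw [RU a ha, RU b hb] at hab
      simp at hab
      exact rU ha hb hab
    · rw [RU a ha, RV b hb] at hab
      simp at hab
    · rw [RV a ha, RU b hb] at hab
      simp at hab
    · rw [RV a ha, RV b hb] at hab
      simp at hab
      exact rV ha hb hab
  · intro a ha b hb c hc hab hbc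
    rw [Finset.mem_union] at ha hb hc
    rcases ha with ha | ha <;> rcases hb with hb | hb <;> rcases hc with hc | hc
    · rw [RU a ha, RU b hb] at hab
      rw [RU c hc, RU b hb] at hbc
      simp at hab hbc
      exact hU a ha b hb c hc hab hbc
    · rw [RU a ha, RU b hb] at hab
      simp at hab
      exact hUV a ha b hb hab c hc
    · rw [RU c hc, RV b hb] at hbc
      simp at hbc
    · rw [RV c hc, RV b hb] at hbc
      simp at hbc
      have := hVU c hc b hb hbc a ha
      rw [← ori_rot, ori_swap']
      linarith
    · rw [RV a ha, RU b hb] at hab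
      simp at hab
    · rw [RV a ha, RU b hb] at hab
      simp at hab
    · rw [RU c hc, RV b hb] at hbc
      simp at hbc
    · rw [RV a ha, RV b hb] at hab
      rw [RV c hc, RV b hb] at hbc
      simp at hab hbc
      have := hV c hc b hb a ha hbc hab
      rw [← ori_rot, ori_swap']
      linarith


/-- Combinatorial description of the clusters of the construction. -/
structure Clusters (n : ℕ) (G : ℕ → Finset (ℝ × ℝ)) : Prop where
  xinj : ∀ i, i < n - 1 → XInj (G i)
  disj : ∀ i j, i < j → j < n - 1 → Disjoint (G i) (G j)
  up : ∀ i j, i < j → j < n - 1 → ∀ a ∈ G i, ∀ b ∈ G i, a.1 < b.1 → ∀ c ∈ G j, 0 < ori a b c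
  down : ∀ i j, i < j → j < n - 1 → ∀ a ∈ G j, ∀ b ∈ G j, a.1 < b.1 → ∀ c ∈ G i, ori a b c < 0
  bulge : ∀ i j k, i < j → j < k → k < n - 1 → ∀ a ∈ G i, ∀ b ∈ G j, ∀ c ∈ G k, ori a b c < 0

/-- The union of all clusters. -/
noncomputable def allPts (n : ℕ) (G : ℕ → Finset (ℝ × ℝ)) : Finset (ℝ × ℝ) :=
  (Finset.range (n - 1)).biUnion G

lemma mem_allPts {n : ℕ} {G : ℕ → Finset (ℝ × ℝ)} {p : ℝ × ℝ} :
    p ∈ allPts n G ↔ ∃ i, i < n - 1 ∧ p ∈ G i := by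
  simp [allPts]

lemma mem_hull_triangle {a b c d : ℝ × ℝ} (h1 : 0 < ori a b d) (h2 : 0 < ori b c d)
    (h3 : 0 < ori c a d) : d ∈ convexHull ℝ ({a, b, c} : Set (ℝ × ℝ)) := by
  have hs : 0 < ori a b d + ori b c d + ori c a d := by linarith
  have ha : a ∈ convexHull ℝ ({a, b, c} : Set (ℝ × ℝ)) := subset_convexHull _ _ (by simp)
  have hb : b ∈ convexHull ℝ ({a, b, c} : Set (ℝ × ℝ)) := subset_convexHull _ _ (by simp)
  have hc : c ∈ convexHull ℝ ({a, b, c} : Set (ℝ × ℝ)) := subset_convexHull _ _ (by simp)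
  have hconv := convex_convexHull ℝ ({a, b, c} : Set (ℝ × ℝ))
  have key := hconv.sum_mem (t := Finset.univ) (w := ![ori b c d / (ori a b d + ori b c d + ori c a d),
      ori c a d / (ori a b d + ori b c d + ori c a d),
      ori a b d / (ori a b d + ori b c d + ori c a d)]) (z := ![a, b, c])
    (by intro i _; fin_cases i <;> simp <;> positivity)
    (by simp [Fin.sum_univ_three]; field_simp; ring)
    (by intro i _; fin_cases i <;> simp [ha, hb, hc])
  convert key using 1
  simp only [Fin.sum_univ_three, Matrix.cons_val_zero, Matrix.cons_val_one, Matrix.cons_val]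
  ext
  · simp
    field_simp
    unfold ori; ring
  · simp
    field_simp
    unfold ori; ring

/-- In a set in convex position no point is in the triangle of three others. -/
lemma ConvexPos.not_triangle {S : Set (ℝ × ℝ)} (hS : ConvexPos S) {a b c d : ℝ × ℝ}
    (ha : a ∈ S) (hb : b ∈ S) (hc : c ∈ S) (hd : d ∈ S)
    (h1 : 0 < ori a b d) (h2 : 0 < ori b c d) (h3 : 0 < ori c a d) : False := by
  apply hS d hd
  apply convexHull_mono _ (mem_hull_triangle h1 h2 h3)
  intro x hx
  simp only [Set.mem_insert_iff, Set.mem_singleton_iff] at hx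
  refine ⟨?_, ?_⟩
  · rcases hx with rfl | rfl | rfl <;> assumption
  · rintro rfl
    rcases hx with rfl | rfl | rfl
    · simp [ori] at h1
    · simp [ori] at h2
    · simp [ori] at h3

/-- the point of a segment at a given abscissa -/
lemma exists_on_segment {a c : ℝ × ℝ} (x : ℝ) (h1 : a.1 < x) (h2 : x < c.1) :
    ∃ y, (x, y) ∈ segment ℝ a c ∧ ori a c (x, y) = 0 := by
  have h : 0 < c.1 - a.1 := by linarith
  refine ⟨((c.1 - x) / (c.1 - a.1)) * a.2 + ((x - a.1) / (c.1 - a.1)) * c.2,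
    ⟨(c.1 - x) / (c.1 - a.1), (x - a.1) / (c.1 - a.1), ?_, ?_, ?_, ?_⟩, ?_⟩
  · apply div_nonneg <;> linarith
  · apply div_nonneg <;> linarith
  · field_simp; ring
  · ext
    · simp; field_simp; ring
    · simp
  · simp [ori]; field_simp; ring

lemma mem_hull_between {a c l r b : ℝ × ℝ} (h1 : a.1 < b.1) (h2 : b.1 < c.1)
    (h3 : l.1 < b.1) (h4 : b.1 < r.1) (h5 : ori a c b ≤ 0) (h6 : 0 ≤ ori l r b) :
    b ∈ convexHull ℝ ({a, c, l, r} : Set (ℝ × ℝ)) := by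
  obtain ⟨y, hy, hy0⟩ := exists_on_segment b.1 h1 h2
  obtain ⟨z, hz, hz0⟩ := exists_on_segment b.1 h3 h4
  have hconv := convex_convexHull ℝ ({a, c, l, r} : Set (ℝ × ℝ))
  have Y : (b.1, y) ∈ convexHull ℝ ({a, c, l, r} : Set (ℝ × ℝ)) :=
    hconv.segment_subset (subset_convexHull _ _ (by simp)) (subset_convexHull _ _ (by simp)) hy
  have Z : (b.1, z) ∈ convexHull ℝ ({a, c, l, r} : Set (ℝ × ℝ)) :=
    hconv.segment_subset (subset_convexHull _ _ (by simp)) (subset_convexHull _ _ (by simp)) hz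
  have hby : b.2 ≤ y := by
    unfold ori at h5 hy0
    simp only at hy0
    have : (c.1 - a.1) * (b.2 - y) ≤ 0 := by nlinarith
    by_contra hcon
    push Not at hcon
    have := mul_pos (show 0 < c.1 - a.1 by linarith) (show 0 < b.2 - y by linarith)
    linarith
  have hbz : z ≤ b.2 := by
    unfold ori at h6 hz0
    simp only at hz0
    have : (r.1 - l.1) * (z - b.2) ≤ 0 := by nlinarith
    by_contra hcon
    push Not at hcon
    have := mul_pos (show 0 < r.1 - l.1 by linarith) (show 0 < z - b.2 by linarith)
    linarith
  apply hconv.segment_subset Z Y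
  rcases eq_or_lt_of_le (hbz.trans hby) with h | h
  · have : b = (b.1, z) := by ext <;> simp; linarith
    rw [← h, ← this]
    simp
  · refine ⟨(y - b.2) / (y - z), (b.2 - z) / (y - z), ?_, ?_, ?_, ?_⟩
    · apply div_nonneg <;> linarith
    · apply div_nonneg <;> linarith
    · have : y - z ≠ 0 := by linarith
      field_simp; ring
    · have : y - z ≠ 0 := by linarith
      ext
      · simp; field_simp; ring
      · simp; field_simp; ring

lemma ConvexPos.not_between {S : Set (ℝ × ℝ)} (hS : ConvexPos S) {a c l r b : ℝ × ℝ}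
    (ha : a ∈ S) (hc : c ∈ S) (hl : l ∈ S) (hr : r ∈ S) (hb : b ∈ S)
    (h1 : a.1 < b.1) (h2 : b.1 < c.1)
    (h3 : l.1 < b.1) (h4 : b.1 < r.1) (h5 : ori a c b ≤ 0) (h6 : 0 ≤ ori l r b) : False := by
  apply hS b hb
  apply convexHull_mono _ (mem_hull_between h1 h2 h3 h4 h5 h6)
  intro x hx
  simp only [Set.mem_insert_iff, Set.mem_singleton_iff] at hx
  refine ⟨?_, ?_⟩
  · rcases hx with rfl | rfl | rfl | rfl <;> assumption
  · rintro rfl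
    rcases hx with rfl | rfl | rfl | rfl <;> linarith

/-- A set in convex position splits into a cup and a cap. -/
lemma convexPos_split (S : Finset (ℝ × ℝ)) (hx : XInj S) (h2 : 2 ≤ S.card)
    (hS : ConvexPos (↑S : Set (ℝ × ℝ))) :
    ∃ U ⊆ S, ∃ V ⊆ S, CupSet U ∧ CapSet V ∧ S.card + 2 ≤ U.card + V.card := by
  have hne : S.Nonempty := Finset.card_pos.1 (by omega)
  obtain ⟨l, hl, hlmin⟩ := Finset.exists_min_image S (fun p => p.1) hne
  obtain ⟨r, hr, hrmax⟩ := Finset.exists_max_image S (fun p => p.1) hne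
  have hlr : l ≠ r := by
    rintro rfl
    have : S ⊆ {l} := by
      intro x hxS
      rw [Finset.mem_singleton]
      exact hx hxS hl (le_antisymm (hrmax x hxS) (hlmin x hxS))
    have := Finset.card_le_card this
    simp at this; omega
  classical
  refine ⟨S.filter (fun p => ori l r p ≤ 0), Finset.filter_subset _ _,
    S.filter (fun p => 0 ≤ ori l r p), Finset.filter_subset _ _, ?_, ?_, ?_⟩
  · intro a ha b hb c hc hab hbc
    simp only [Finset.mem_filter] at ha hb hc
    by_contra hcon
    push Not at hcon
    refine hS.not_between (a := l) (c := r) (l := a) (r := c) (b := b) hl hr ha.1 hc.1 hb.1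
      (lt_of_le_of_lt (hlmin a ha.1) hab) (lt_of_lt_of_le hbc (hrmax c hc.1)) hab hbc hb.2 ?_
    rw [ori_swap]; linarith
  · intro a ha b hb c hc hab hbc
    simp only [Finset.mem_filter] at ha hb hc
    by_contra hcon
    push Not at hcon
    refine hS.not_between (a := a) (c := c) (l := l) (r := r) (b := b) ha.1 hc.1 hl hr hb.1
      hab hbc (lt_of_le_of_lt (hlmin a ha.1) hab) (lt_of_lt_of_le hbc (hrmax c hc.1)) ?_ hb.2
    rw [ori_swap]; linarith
  · rw [← Finset.card_union_add_card_inter]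
    have e1 : S ⊆ S.filter (fun p => ori l r p ≤ 0) ∪ S.filter (fun p => 0 ≤ ori l r p) := by
      intro x hxS
      simp only [Finset.mem_union, Finset.mem_filter, hxS, true_and]
      exact le_total _ _
    have e2 : ({l, r} : Finset (ℝ × ℝ)) ⊆
        S.filter (fun p => ori l r p ≤ 0) ∩ S.filter (fun p => 0 ≤ ori l r p) := by
      intro x hxS
      simp only [Finset.mem_insert, Finset.mem_singleton] at hxS
      rcases hxS with rfl | rfl
      · simp [hl, ori]
      · simp only [Finset.mem_inter, Finset.mem_filter, hr, true_and]
        have : ori l x x = 0 := by unfold ori; ring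
        rw [this]; simp
    have := Finset.card_le_card e1
    have h3 := Finset.card_le_card e2
    rw [Finset.card_pair hlr] at h3
    omega

/-- The construction has no `n` points in convex position. -/
lemma no_gon {n : ℕ} (hn : 3 ≤ n) {G : ℕ → Finset (ℝ × ℝ)} (hG : Clusters n G)
    (hcup : ∀ i, i < n - 1 → ∀ C ⊆ G i, CupSet C → C.card ≤ i + 1)
    (hcap : ∀ i, i < n - 1 → ∀ C ⊆ G i, CapSet C → C.card ≤ n - i - 1)
    (S : Finset (ℝ × ℝ)) (hSQ : S ⊆ allPts n G) (hcard : S.card = n)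
    (hS : ConvexPos (↑S : Set (ℝ × ℝ))) : False := by
  classical
  let I := (Finset.range (n - 1)).filter (fun i => (S ∩ G i).Nonempty)
  have memI : ∀ i, i ∈ I ↔ i < n - 1 ∧ (S ∩ G i).Nonempty := by intro i; simp [I]
  have hI : I.Nonempty := by
    have : S.Nonempty := Finset.card_pos.1 (by omega)
    obtain ⟨p, hp⟩ := this
    obtain ⟨i, hi, hpi⟩ := mem_allPts.1 (hSQ hp)
    exact ⟨i, (memI i).2 ⟨hi, p, by simp [hp, hpi]⟩⟩
  obtain ⟨i, hi, hmin⟩ := Finset.exists_min_image I id hI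
  obtain ⟨j, hj, hmax⟩ := Finset.exists_max_image I id hI
  simp only [id] at hmin hmax
  have hij : i ≤ j := hmin j hj
  have hi' := (memI i).1 hi
  have hj' := (memI j).1 hj
  have hSub : S ⊆ (Finset.Icc i j).biUnion (fun m => S ∩ G m) := by
    intro p hp
    obtain ⟨m, hm, hpm⟩ := mem_allPts.1 (hSQ hp)
    have hmI : m ∈ I := (memI m).2 ⟨hm, p, by simp [hp, hpm]⟩
    simp only [Finset.mem_biUnion, Finset.mem_Icc, Finset.mem_inter]
    exact ⟨m, ⟨hmin m hmI, hmax m hmI⟩, hp, hpm⟩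
  rcases hij.eq_or_lt with rfl | hlt
  · have hSi : S ⊆ G i := by
      intro p hp
      have := hSub hp
      simp at this
      exact this.2
    have hxS : XInj S := (hG.xinj i hi'.1).mono (by exact_mod_cast hSi)
    obtain ⟨U, hU, V, hV, hcU, hcV, hle⟩ := convexPos_split S hxS (by omega) hS
    have h1 := hcup i hi'.1 U (hU.trans hSi) hcU
    have h2 := hcap i hi'.1 V (hV.trans hSi) hcV
    omega
  · obtain ⟨a, ha⟩ := hi'.2
    obtain ⟨b, hb⟩ := hj'.2
    rw [Finset.mem_inter] at ha hb
    have c1 : (S ∩ G i).card ≤ i + 1 := by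
      apply hcup i hi'.1 _ Finset.inter_subset_right
      intro x hx y hy z hz hxy hyz
      rw [Finset.mem_inter] at hx hy hz
      by_contra hcon
      rcases (not_lt.1 hcon).eq_or_lt with h0 | h0
      · refine hS.not_between (a := x) (c := z) (l := x) (r := z) (b := y) hx.1 hz.1 hx.1 hz.1 hy.1
          hxy hyz hxy hyz ?_ ?_ <;> rw [ori_swap] <;> linarith
      · refine hS.not_triangle (a := x) (b := z) (c := b) (d := y) hx.1 hz.1 hb.1 hy.1 ?_ ?_ ?_
        · rw [ori_swap]; linarith
        · have := hG.up i j hlt hj'.1 y hy.2 z hz.2 hyz b hb.2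
          rwa [ori_rot]
        · have := hG.up i j hlt hj'.1 x hx.2 y hy.2 hxy b hb.2
          rwa [← ori_rot]
    have c2 : (S ∩ G j).card ≤ n - j - 1 := by
      apply hcap j hj'.1 _ Finset.inter_subset_right
      intro x hx y hy z hz hxy hyz
      rw [Finset.mem_inter] at hx hy hz
      by_contra hcon
      rcases (not_lt.1 hcon).eq_or_lt with h0 | h0
      · refine hS.not_between (a := x) (c := z) (l := x) (r := z) (b := y) hx.1 hz.1 hx.1 hz.1 hy.1
          hxy hyz hxy hyz ?_ ?_ <;> rw [ori_swap] <;> linarith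
      · refine hS.not_triangle (a := x) (b := a) (c := z) (d := y) hx.1 ha.1 hz.1 hy.1 ?_ ?_ ?_
        · have := hG.down i j hlt hj'.1 x hx.2 y hy.2 hxy a ha.2
          rw [ori_swap]; linarith
        · have := hG.down i j hlt hj'.1 y hy.2 z hz.2 hyz a ha.2
          unfold ori at *; linarith
        · unfold ori at *; linarith
    have c3 : ∀ m ∈ Finset.Ioo i j, (S ∩ G m).card ≤ 1 := by
      intro m hm
      rw [Finset.mem_Ioo] at hm
      rw [Finset.card_le_one]
      have key : ∀ p ∈ S ∩ G m, ∀ q ∈ S ∩ G m, p.1 < q.1 → False := by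
        intro p hp q hq hpq
        rw [Finset.mem_inter] at hp hq
        have h1 := hG.down i m hm.1 (by omega) p hp.2 q hq.2 hpq a ha.2
        have h2 := hG.up m j hm.2 hj'.1 p hp.2 q hq.2 hpq b hb.2
        have h3 := hG.bulge i m j hm.1 hm.2 hj'.1 a ha.2 q hq.2 b hb.2
        refine hS.not_triangle (a := a) (b := b) (c := p) (d := q) ha.1 hb.1 hp.1 hq.1 ?_ ?_ ?_
        · rw [ori_swap]; linarith
        · unfold ori at *; linarith
        · rw [ori_swap]; linarith
      intro p hp q hq
      by_contra hne
      have hpG := (Finset.mem_inter.1 hp).2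
      have hqG := (Finset.mem_inter.1 hq).2
      have : p.1 ≠ q.1 := fun h => hne (hG.xinj m (by omega) hpG hqG h)
      rcases lt_or_gt_of_ne this with h | h
      · exact key p hp q hq h
      · exact key q hq p hp h
    have t1 : S.card ≤ ∑ m ∈ Finset.Icc i j, (S ∩ G m).card :=
      (Finset.card_le_card hSub).trans Finset.card_biUnion_le
    have t2 : ∑ m ∈ Finset.Icc i j, (S ∩ G m).card
        = (S ∩ G i).card + (S ∩ G j).card + ∑ m ∈ Finset.Ioo i j, (S ∩ G m).card := by
      rw [← Finset.Ioc_insert_left hij, Finset.sum_insert (by simp),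
        ← Finset.Ioo_insert_right hlt, Finset.sum_insert (by simp)]
      ring
    have t3 : ∑ m ∈ Finset.Ioo i j, (S ∩ G m).card ≤ j - i - 1 := by
      refine (Finset.sum_le_sum c3).trans ?_
      simp
    have := hj'.1
    omega


/-- The new point `q` completes an `n`-gon. -/
def Win (n : ℕ) (G : ℕ → Finset (ℝ × ℝ)) (q : ℝ × ℝ) : Prop :=
  ∃ S : Finset (ℝ × ℝ), S ⊆ insert q (allPts n G) ∧ q ∈ S ∧ S.card = n ∧
    ConvexPos (↑S : Set (ℝ × ℝ))

lemma Clusters.not_mem {n : ℕ} {G : ℕ → Finset (ℝ × ℝ)} (hG : Clusters n G) {i j : ℕ}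
    (hij : i < j) (hj : j < n - 1) {p : ℝ × ℝ} (hp : p ∈ G i) : p ∉ G j :=
  fun h => Finset.disjoint_left.1 (hG.disj i j hij hj) hp h

lemma sub_allPts {n : ℕ} {G : ℕ → Finset (ℝ × ℝ)} {i : ℕ} (hi : i < n - 1) :
    G i ⊆ allPts n G := fun _ hp => mem_allPts.2 ⟨i, hi, hp⟩

lemma win_cup {n : ℕ} {G : ℕ → Finset (ℝ × ℝ)} (hG : Clusters n G) {i : ℕ}
    (hi : i + 1 < n - 1) {q : ℝ × ℝ} (hq : q ∉ allPts n G) {U V : Finset (ℝ × ℝ)}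
    (hUG : U ⊆ G i) (hVG : V ⊆ G (i + 1)) (hU : CupSet U) (hV : CapSet V)
    (cU : U.card = i + 1) (cV : V.card = n - i - 2) (t : ℝ) (ht : ∀ u ∈ U, u.1 ≠ t)
    (h1 : ∀ a ∈ U, ∀ b ∈ U, a.1 < b.1 → (t < a.1 → 0 < ori q a b) ∧
      (a.1 < t → t < b.1 → 0 < ori a q b) ∧ (b.1 < t → 0 < ori a b q))
    (h2 : ∀ u ∈ U, ∀ v ∈ V, (u.1 < t → 0 < ori u q v) ∧ (t < u.1 → 0 < ori q u v))
    (h3 : ∀ a ∈ V, ∀ b ∈ V, a.1 < b.1 → ori a b q < 0) : Win n G q := by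
  classical
  have hiG : G i ⊆ allPts n G := sub_allPts (by omega)
  have hiG' : G (i + 1) ⊆ allPts n G := sub_allPts hi
  have hqU : q ∉ U := fun h => hq (hiG (hUG h))
  have hqV : q ∉ V := fun h => hq (hiG' (hVG h))
  have hneU : ∀ u ∈ U, u ≠ q := fun u hu h => hqU (h ▸ hu)
  have hneV : ∀ u ∈ V, u ≠ q := fun u hu h => hqV (h ▸ hu)
  have hd : Disjoint (insert q U) V := by
    rw [Finset.disjoint_left]
    intro x hx hxV
    rw [Finset.mem_insert] at hx
    rcases hx with rfl | hx
    · exact hqV hxV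
    · exact hG.not_mem (Nat.lt_succ_self i) hi (hUG hx) (hVG hxV)
  let r : ℝ × ℝ → ℝ := fun p => if p = q then t else p.1
  have rq : r q = t := by simp [r]
  have rU : ∀ u ∈ U, r u = u.1 := fun u hu => by simp [r, hneU u hu]
  have rV : ∀ u ∈ V, r u = u.1 := fun u hu => by simp [r, hneV u hu]
  refine ⟨insert q U ∪ V, ?_, by simp, ?_, ?_⟩
  · intro x hx
    simp only [Finset.mem_union, Finset.mem_insert] at hx ⊢
    rcases hx with (rfl | hx) | hx
    · left; rfl
    · right; exact hiG (hUG hx)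
    · right; exact hiG' (hVG hx)
  · rw [Finset.card_union_of_disjoint hd, Finset.card_insert_of_notMem hqU, cU, cV]
    omega
  · apply conv_of_cup_cap _ _ r hd
    · intro a ha b hb hab
      simp only [Finset.coe_insert, Set.mem_insert_iff, Finset.mem_coe] at ha hb
      rcases ha with rfl | ha <;> rcases hb with rfl | hb
      · rfl
      · rw [rq, rU b hb] at hab; exact absurd hab.symm (ht b hb)
      · rw [rq, rU a ha] at hab; exact absurd hab (ht a ha)
      · rw [rU a ha, rU b hb] at hab
        exact hG.xinj i (by omega) (hUG ha) (hUG hb) hab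
    · intro a ha b hb hab
      rw [rV a ha, rV b hb] at hab
      exact hG.xinj (i + 1) hi (hVG ha) (hVG hb) hab
    · intro a ha b hb c hc hab hbc
      rw [Finset.mem_insert] at ha hb hc
      rcases ha with rfl | ha <;> rcases hb with rfl | hb <;> rcases hc with rfl | hc
      · exact absurd hab (lt_irrefl _)
      · exact absurd hab (lt_irrefl _)
      · exact absurd (hab.trans hbc) (lt_irrefl _)
      · rw [rq, rU b hb] at hab; rw [rU b hb, rU c hc] at hbc
        exact (h1 b hb c hc hbc).1 hab
      · exact absurd hbc (lt_irrefl _)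
      · rw [rq, rU a ha] at hab; rw [rq, rU c hc] at hbc
        exact (h1 a ha c hc (hab.trans hbc)).2.1 hab hbc
      · rw [rU a ha, rU b hb] at hab; rw [rU b hb, rq] at hbc
        exact (h1 a ha b hb hab).2.2 hbc
      · rw [rU a ha, rU b hb] at hab; rw [rU b hb, rU c hc] at hbc
        exact hU a ha b hb c hc hab hbc
    · intro a ha b hb c hc hab hbc
      rw [rV a ha, rV b hb] at hab; rw [rV b hb, rV c hc] at hbc
      exact hV a ha b hb c hc hab hbc
    · intro a ha b hb hab v hv
      rw [Finset.mem_insert] at ha hb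
      rcases ha with rfl | ha <;> rcases hb with rfl | hb
      · exact absurd hab (lt_irrefl _)
      · rw [rq, rU b hb] at hab
        exact (h2 b hb v hv).2 hab
      · rw [rq, rU a ha] at hab
        exact (h2 a ha v hv).1 hab
      · rw [rU a ha, rU b hb] at hab
        exact hG.up i (i + 1) (Nat.lt_succ_self i) hi a (hUG ha) b (hUG hb) hab v (hVG hv)
    · intro a ha b hb hab u hu
      rw [rV a ha, rV b hb] at hab
      rw [Finset.mem_insert] at hu
      rcases hu with rfl | hu
      · exact h3 a ha b hb hab
      · exact hG.down i (i + 1) (Nat.lt_succ_self i) hi a (hVG ha) b (hVG hb) hab u (hUG hu)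

/-- Reflection in the horizontal axis. -/
def rfx (p : ℝ × ℝ) : ℝ × ℝ := (p.1, -p.2)

@[simp] lemma refl_fst (p : ℝ × ℝ) : (rfx p).1 = p.1 := rfl

@[simp] lemma refl_refl (p : ℝ × ℝ) : rfx (rfx p) = p := by simp [rfx]

lemma refl_inj : Function.Injective rfx := fun a b h => by
  rw [← refl_refl a, h, refl_refl]

lemma ori_refl (a b c : ℝ × ℝ) : ori (rfx a) (rfx b) (rfx c) = - ori a b c := by
  simp [ori, rfx]; ring

/-- Reflection of a finset. -/
noncomputable def reflS (P : Finset (ℝ × ℝ)) : Finset (ℝ × ℝ) := P.image rfx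

lemma mem_reflS {P : Finset (ℝ × ℝ)} {p : ℝ × ℝ} : p ∈ reflS P ↔ rfx p ∈ P := by
  unfold reflS
  rw [Finset.mem_image]
  constructor
  · rintro ⟨a, ha, rfl⟩; simpa using ha
  · intro h; exact ⟨_, h, refl_refl p⟩

@[simp] lemma reflS_reflS (P : Finset (ℝ × ℝ)) : reflS (reflS P) = P := by
  ext p; simp [mem_reflS]

lemma card_reflS (P : Finset (ℝ × ℝ)) : (reflS P).card = P.card :=
  Finset.card_image_of_injective _ refl_inj

lemma reflS_subset {P Q : Finset (ℝ × ℝ)} (h : P ⊆ Q) : reflS P ⊆ reflS Q :=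
  Finset.image_subset_image h

lemma reflS_insert (q : ℝ × ℝ) (P : Finset (ℝ × ℝ)) :
    reflS (insert q P) = insert (rfx q) (reflS P) := by
  simp [reflS, Finset.image_insert]

lemma cupSet_reflS {C : Finset (ℝ × ℝ)} : CupSet (reflS C) ↔ CapSet C := by
  constructor
  · intro h a ha b hb c hc hab hbc
    have := h (rfx a) (by simpa [mem_reflS]) (rfx b) (by simpa [mem_reflS])
      (rfx c) (by simpa [mem_reflS]) hab hbc
    rw [ori_refl] at this; linarith
  · intro h a ha b hb c hc hab hbc
    rw [mem_reflS] at ha hb hc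
    have := h _ ha _ hb _ hc hab hbc
    rw [ori_refl] at this; linarith

lemma capSet_reflS {C : Finset (ℝ × ℝ)} : CapSet (reflS C) ↔ CupSet C := by
  rw [← cupSet_reflS, reflS_reflS]

lemma xInj_reflS {C : Finset (ℝ × ℝ)} (h : XInj C) : XInj (reflS C) := by
  intro a ha b hb hab
  rw [Finset.mem_coe, mem_reflS] at ha hb
  exact refl_inj (h ha hb hab)

lemma hasCup_reflS {P : Finset (ℝ × ℝ)} {k : ℕ} : HasCup (reflS P) k ↔ HasCap P k := by
  rw [hasCup_iff, hasCap_iff]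
  constructor
  · rintro ⟨C, h1, h2, h3, h4⟩
    exact ⟨reflS C, by simpa using reflS_subset h1, by rw [card_reflS, h2], xInj_reflS h3,
      capSet_reflS.2 h4⟩
  · rintro ⟨C, h1, h2, h3, h4⟩
    exact ⟨reflS C, reflS_subset h1, by rw [card_reflS, h2], xInj_reflS h3,
      cupSet_reflS.2 h4⟩

lemma hasCap_reflS {P : Finset (ℝ × ℝ)} {k : ℕ} : HasCap (reflS P) k ↔ HasCup P k := by
  rw [← hasCup_reflS, reflS_reflS]

lemma genPos_reflS {P : Finset (ℝ × ℝ)} (h : GenPos P) : GenPos (reflS P) := by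
  rw [genPos_iff] at h ⊢
  intro p hp q hq r hr h1 h2 h3 h0
  rw [mem_reflS] at hp hq hr
  refine h _ hp _ hq _ hr (refl_inj.ne h1) (refl_inj.ne h2) (refl_inj.ne h3) ?_
  rw [ori_refl, h0, neg_zero]

lemma generic_reflS {P : Finset (ℝ × ℝ)} (h : Generic P) : Generic (reflS P) :=
  ⟨genPos_reflS h.1, xInj_reflS h.2⟩

lemma sat_reflS {P : Finset (ℝ × ℝ)} {k l : ℕ} (h : CupCapSat P k l) :
    CupCapSat (reflS P) l k := by
  refine ⟨generic_reflS h.1, ⟨?_, ?_⟩, ?_⟩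
  · rw [hasCup_reflS]; exact h.2.1.2
  · rw [hasCap_reflS]; exact h.2.1.1
  · intro q hq hgen
    have e : insert q (reflS P) = reflS (insert (rfx q) P) := by simp [reflS_insert]
    rw [e, hasCup_reflS, hasCap_reflS]
    refine (h.2.2 (rfx q) ?_ ?_).symm
    · rwa [mem_reflS] at hq
    · rw [e] at hgen
      simpa using generic_reflS hgen

lemma convexPos_reflS {S : Finset (ℝ × ℝ)} (h : ConvexPos (↑S : Set (ℝ × ℝ))) :
    ConvexPos (↑(reflS S) : Set (ℝ × ℝ)) := by
  intro p hp hmem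
  rw [Finset.mem_coe, mem_reflS] at hp
  apply h (rfx p) hp
  let f : (ℝ × ℝ) →ₗ[ℝ] (ℝ × ℝ) :=
    { toFun := rfx
      map_add' := by intro a b; ext <;> simp [rfx]; ring
      map_smul' := by intro a b; ext <;> simp [rfx] }
  have h1 : f p ∈ f '' convexHull ℝ (↑(reflS S) \ {p}) := ⟨p, hmem, rfl⟩
  rw [f.image_convexHull] at h1
  refine convexHull_mono ?_ h1
  rintro x ⟨y, ⟨hy, hyp⟩, rfl⟩
  rw [Finset.mem_coe, mem_reflS] at hy
  refine ⟨hy, ?_⟩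
  intro hxy
  exact hyp (refl_inj hxy)

/-- The reflected family of clusters. -/
noncomputable def reflG (n : ℕ) (G : ℕ → Finset (ℝ × ℝ)) : ℕ → Finset (ℝ × ℝ) :=
  fun i => reflS (G (n - 2 - i))

lemma clusters_refl {n : ℕ} {G : ℕ → Finset (ℝ × ℝ)} (hG : Clusters n G) :
    Clusters n (reflG n G) where
  xinj i hi := xInj_reflS (hG.xinj _ (by omega))
  disj i j hij hj := by
    rw [Finset.disjoint_left]
    intro a ha hb
    rw [reflG, mem_reflS] at ha hb
    exact hG.not_mem (i := n - 2 - j) (j := n - 2 - i) (by omega) (by omega) hb ha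
  up i j hij hj a ha b hb hab c hc := by
    rw [reflG, mem_reflS] at ha hb hc
    have := hG.down (n - 2 - j) (n - 2 - i) (by omega) (by omega) _ ha _ hb hab _ hc
    rw [ori_refl] at this; linarith
  down i j hij hj a ha b hb hab c hc := by
    rw [reflG, mem_reflS] at ha hb hc
    have := hG.up (n - 2 - j) (n - 2 - i) (by omega) (by omega) _ ha _ hb hab _ hc
    rw [ori_refl] at this; linarith
  bulge i j k hij hjk hk a ha b hb c hc := by
    rw [reflG, mem_reflS] at ha hb hc
    have := hG.bulge (n - 2 - k) (n - 2 - j) (n - 2 - i) (by omega) (by omega) (by omega)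
      _ hc _ hb _ ha
    rw [ori_refl] at this
    unfold ori at *; linarith

lemma allPts_refl {n : ℕ} (hn : 3 ≤ n) {G : ℕ → Finset (ℝ × ℝ)} {p : ℝ × ℝ} :
    p ∈ allPts n (reflG n G) ↔ rfx p ∈ allPts n G := by
  rw [mem_allPts, mem_allPts]
  constructor
  · rintro ⟨i, hi, hp⟩
    exact ⟨n - 2 - i, by omega, by rwa [reflG, mem_reflS] at hp⟩
  · rintro ⟨i, hi, hp⟩
    refine ⟨n - 2 - i, by omega, ?_⟩
    rw [reflG, mem_reflS]
    have : n - 2 - (n - 2 - i) = i := by omega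
    rwa [this]

lemma win_of_refl {n : ℕ} (hn : 3 ≤ n) {G : ℕ → Finset (ℝ × ℝ)} {q : ℝ × ℝ}
    (h : Win n (reflG n G) (rfx q)) : Win n G q := by
  obtain ⟨S, h1, h2, h3, h4⟩ := h
  refine ⟨reflS S, ?_, by rwa [mem_reflS], by rw [card_reflS, h3], convexPos_reflS h4⟩
  intro x hx
  rw [mem_reflS] at hx
  have := h1 hx
  rw [Finset.mem_insert] at this ⊢
  rcases this with h | h
  · left; exact refl_inj h
  · right; rw [allPts_refl hn, refl_refl] at h; exact h

lemma win_cap {n : ℕ} (hn : 3 ≤ n) {G : ℕ → Finset (ℝ × ℝ)} (hG : Clusters n G) {i : ℕ}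
    (hi : i + 1 < n - 1) {q : ℝ × ℝ} (hq : q ∉ allPts n G) {U V : Finset (ℝ × ℝ)}
    (hUG : U ⊆ G i) (hVG : V ⊆ G (i + 1)) (hU : CupSet U) (hV : CapSet V)
    (cU : U.card = i + 1) (cV : V.card = n - i - 2) (t : ℝ) (ht : ∀ u ∈ V, u.1 ≠ t)
    (h1 : ∀ a ∈ V, ∀ b ∈ V, a.1 < b.1 → (t < a.1 → ori q a b < 0) ∧
      (a.1 < t → t < b.1 → ori a q b < 0) ∧ (b.1 < t → ori a b q < 0))
    (h2 : ∀ v ∈ V, ∀ u ∈ U, (v.1 < t → ori v q u < 0) ∧ (t < v.1 → ori q v u < 0))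
    (h3 : ∀ a ∈ U, ∀ b ∈ U, a.1 < b.1 → 0 < ori a b q) : Win n G q := by
  apply win_of_refl hn
  have e1 : n - 2 - (n - 3 - i) = i + 1 := by omega
  have e2 : n - 2 - (n - 3 - i + 1) = i := by omega
  refine win_cup (clusters_refl hG) (i := n - 3 - i) (by omega) (U := reflS V) (V := reflS U)
    (by rwa [allPts_refl hn, refl_refl]) ?_ ?_ (cupSet_reflS.2 hV) (capSet_reflS.2 hU) ?_ ?_ t
    ?_ ?_ ?_ ?_
  · unfold reflG; rw [e1]; exact reflS_subset hVG
  · unfold reflG; rw [e2]; exact reflS_subset hUG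
  · rw [card_reflS]; omega
  · rw [card_reflS]; omega
  · intro u hu; rw [mem_reflS] at hu; exact ht (rfx u) hu
  · intro a ha b hb hab
    rw [mem_reflS] at ha hb
    have := h1 _ ha _ hb hab
    have f1 := ori_refl q (rfx a) (rfx b)
    have f2 := ori_refl (rfx a) q (rfx b)
    have f3 := ori_refl (rfx a) (rfx b) q
    simp only [refl_refl, refl_fst] at f1 f2 f3 this
    refine ⟨fun h => ?_, fun h h' => ?_, fun h => ?_⟩
    · have := this.1 h; linarith
    · have := this.2.1 h h'; linarith
    · have := this.2.2 h; linarith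
  · intro a ha b hb
    rw [mem_reflS] at ha hb
    have := h2 _ ha _ hb
    have f1 := ori_refl q (rfx a) (rfx b)
    have f2 := ori_refl (rfx a) q (rfx b)
    simp only [refl_refl, refl_fst] at f1 f2 this
    refine ⟨fun h => ?_, fun h => ?_⟩
    · have := this.1 h; linarith
    · have := this.2 h; linarith
  · intro a ha b hb hab
    rw [mem_reflS] at ha hb
    have := h3 _ ha _ hb hab
    have f3 := ori_refl (rfx a) (rfx b) q
    simp only [refl_refl] at f3
    linarith

/-- One point from every cluster, with `q` inserted at position `m`. -/
lemma win_chain {n : ℕ} (hn : 3 ≤ n) {G : ℕ → Finset (ℝ × ℝ)} (hG : Clusters n G)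
    {q : ℝ × ℝ} (hq : q ∉ allPts n G) (s : ℕ → ℝ × ℝ) (hs : ∀ j, j < n - 1 → s j ∈ G j)
    (m : ℕ)
    (h1 : ∀ j k, j < k → k < n - 1 → k < m → ori (s j) (s k) q < 0)
    (h2 : ∀ j k, j < m → m ≤ k → k < n - 1 → ori (s j) q (s k) < 0)
    (h3 : ∀ j k, m ≤ j → j < k → k < n - 1 → ori q (s j) (s k) < 0) : Win n G q := by
  classical
  have sinj : Set.InjOn s ↑(Finset.range (n - 1)) := by
    intro a ha b hb hab
    simp only [Finset.coe_range, Set.mem_Iio] at ha hb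
    rcases lt_trichotomy a b with h | h | h
    · exact absurd (hs b hb) (hab ▸ hG.not_mem h hb (hs a ha))
    · exact h
    · exact absurd (hs a ha) (hab ▸ hG.not_mem h ha (hs b hb))
  have hsub : (Finset.range (n - 1)).image s ⊆ allPts n G := by
    intro x hx
    rw [Finset.mem_image] at hx
    obtain ⟨j, hj, rfl⟩ := hx
    rw [Finset.mem_range] at hj
    exact sub_allPts hj (hs j hj)
  have hqn : q ∉ (Finset.range (n - 1)).image s := fun h => hq (hsub h)
  have hsq : ∀ j, j < n - 1 → s j ≠ q := fun j hj h => hq (h ▸ sub_allPts hj (hs j hj))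
  have hinv := sinj.leftInvOn_invFunOn
  let R : ℝ × ℝ → ℤ := fun p => if p = q then -(2 * (m : ℤ) - 1) else
    -(2 * ((Function.invFunOn s (↑(Finset.range (n - 1)) : Set ℕ) p : ℕ) : ℤ))
  have Rq : R q = -(2 * (m : ℤ) - 1) := by simp [R]
  have Rs : ∀ j, j < n - 1 → R (s j) = -(2 * (j : ℤ)) := by
    intro j hj
    have := hinv (show j ∈ (↑(Finset.range (n - 1)) : Set ℕ) by simpa using hj)
    simp only [R, hsq j hj, if_false, this]
  refine ⟨insert q ((Finset.range (n - 1)).image s), Finset.insert_subset_insert _ hsub,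
    by simp, ?_, ?_⟩
  · rw [Finset.card_insert_of_notMem hqn, Finset.card_image_of_injOn sinj]; simp; omega
  · have hmem : ∀ x, x ∈ insert q ((Finset.range (n - 1)).image s) ↔
        x = q ∨ ∃ j, j < n - 1 ∧ s j = x := by
      intro x; simp
    apply convexPos_of_rank _ R
    · intro a ha b hb hab
      rw [Finset.mem_coe, hmem] at ha hb
      rcases ha with rfl | ⟨j, hj, rfl⟩ <;> rcases hb with rfl | ⟨k, hk, rfl⟩
      · rfl
      · rw [Rq, Rs k hk] at hab; omega
      · rw [Rq, Rs j hj] at hab; omega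
      · rw [Rs j hj, Rs k hk] at hab
        have : j = k := by omega
        rw [this]
    · intro a ha b hb c hc hab hbc
      rw [hmem] at ha hb hc
      have flip : ∀ x y z, ori z y x < 0 → 0 < ori x y z := by
        intro x y z h; unfold ori at *; linarith
      apply flip
      rcases ha with rfl | ⟨j, hj, rfl⟩ <;> rcases hb with rfl | ⟨k, hk, rfl⟩ <;>
        rcases hc with rfl | ⟨l, hl, rfl⟩
      · exact absurd hab (lt_irrefl _)
      · exact absurd hab (lt_irrefl _)
      · exact absurd (hab.trans hbc) (lt_irrefl _)
      · rw [Rq, Rs k hk] at hab; rw [Rs k hk, Rs l hl] at hbc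
        exact h1 l k (by omega) (by omega) (by omega)
      · exact absurd hbc (lt_irrefl _)
      · rw [Rq, Rs j hj] at hab; rw [Rq, Rs l hl] at hbc
        exact h2 l j (by omega) (by omega) hj
      · rw [Rs k hk, Rs j hj] at hab; rw [Rq, Rs k hk] at hbc
        exact h3 k j (by omega) (by omega) hj
      · rw [Rs k hk, Rs j hj] at hab; rw [Rs k hk, Rs l hl] at hbc
        exact hG.bulge l k j (by omega) (by omega) hj _ (hs l hl) _ (hs k hk) _ (hs j hj)


open Filter Topology in
lemma exists_just_left (P : Finset (ℝ × ℝ)) (x : ℝ) :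
    ∃ x0, x0 < x ∧ ∀ p ∈ P, p.1 < x → p.1 < x0 := by
  have h : ∀ᶠ y in 𝓝[<] x, ∀ p ∈ P, p.1 < x → p.1 < y := by
    rw [Filter.eventually_all_finset]
    intro p _
    by_cases h : p.1 < x
    · filter_upwards [Ioo_mem_nhdsLT h] with y hy _ using hy.1
    · exact Filter.Eventually.of_forall fun y h' => absurd h' h
  obtain ⟨y, h1, h2⟩ := (h.and self_mem_nhdsWithin).exists
  exact ⟨y, h2, h1⟩

lemma generic_insert_s19 {P : Finset (ℝ × ℝ)} (hP : Generic P) {q : ℝ × ℝ}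
    (hx : ∀ p ∈ P, p.1 ≠ q.1) (h : ∀ a ∈ P, ∀ b ∈ P, a.1 < b.1 → ori a b q ≠ 0) :
    Generic (insert q P) := by
  have h' : ∀ a ∈ P, ∀ b ∈ P, a ≠ b → ori a b q ≠ 0 := by
    intro a ha b hb hab
    rcases lt_trichotomy a.1 b.1 with h1 | h1 | h1
    · exact h a ha b hb h1
    · exact absurd (hP.2 ha hb h1) hab
    · intro h0
      apply h b hb a ha h1
      rw [ori_swap', h0, neg_zero]
  constructor
  · have hg := (genPos_iff _).1 hP.1
    rw [genPos_iff]
    intro a ha b hb c hc hab hac hbc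
    rw [Finset.mem_insert] at ha hb hc
    rcases ha with rfl | ha <;> rcases hb with rfl | hb <;> rcases hc with rfl | hc
    · exact absurd rfl hab
    · exact absurd rfl hab
    · exact absurd rfl hac
    · intro h0; apply h' b hb c hc hbc; rw [ori_rot]; exact h0
    · exact absurd rfl hbc
    · intro h0; apply h' a ha c hc hac; rw [ori_swap, h0, neg_zero]
    · exact h' a ha b hb hab
    · exact hg a ha b hb c hc hab hac hbc
  · intro a ha b hb hab
    simp only [Finset.coe_insert, Set.mem_insert_iff, Finset.mem_coe] at ha hb
    rcases ha with rfl | ha <;> rcases hb with rfl | hb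
    · rfl
    · exact absurd hab.symm (hx b hb)
    · exact absurd hab (hx a ha)
    · exact hP.2 ha hb hab

lemma highPt {P : Finset (ℝ × ℝ)} (hP : Generic P) (x0 : ℝ) (hx : ∀ p ∈ P, p.1 ≠ x0) :
    ∃ q : ℝ × ℝ, q.1 = x0 ∧ q ∉ P ∧ Generic (insert q P) ∧
      ∀ a ∈ P, ∀ b ∈ P, a.1 < b.1 → 0 < ori a b q := by
  have h : ∀ᶠ y : ℝ in Filter.atTop, ∀ a ∈ P, ∀ b ∈ P, a.1 < b.1 → 0 < ori a b (x0, y) := by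
    rw [Filter.eventually_all_finset]
    intro a _
    rw [Filter.eventually_all_finset]
    intro b _
    by_cases hab : a.1 < b.1
    · have hpos : 0 < b.1 - a.1 := by linarith
      filter_upwards [Filter.eventually_gt_atTop
        (a.2 + (b.2 - a.2) * (x0 - a.1) / (b.1 - a.1))] with y hy _
      have : (b.2 - a.2) * (x0 - a.1) / (b.1 - a.1) < y - a.2 := by linarith
      rw [div_lt_iff₀ hpos] at this
      unfold ori; simp only; linarith
    · exact Filter.Eventually.of_forall fun y h' => absurd h' hab
  obtain ⟨y, hy⟩ := h.exists
  refine ⟨(x0, y), rfl, fun h => hx _ h rfl, ?_, hy⟩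
  exact generic_insert_s19 hP hx fun a ha b hb hab => (hy a ha b hb hab).ne'

lemma sat_cases {P : Finset (ℝ × ℝ)} {k l : ℕ} (h : CupCapSat P k l) {q : ℝ × ℝ}
    (hq : q ∉ P) (hg : Generic (insert q P)) :
    (∃ C ⊆ P, C.card = k - 1 ∧ CupSet (insert q C)) ∨
    (∃ C ⊆ P, C.card = l - 1 ∧ CapSet (insert q C)) := by
  classical
  rcases h.2.2 q hq hg with hc | hc
  · left
    rw [hasCup_iff] at hc
    obtain ⟨C, h1, h2, h3, h4⟩ := hc
    have hqC : q ∈ C := by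
      by_contra hqC
      apply h.2.1.1
      rw [hasCup_iff]
      refine ⟨C, fun x hx => ?_, h2, h3, h4⟩
      have := h1 hx
      rw [Finset.mem_insert] at this
      rcases this with rfl | h
      · exact absurd hx hqC
      · exact h
    refine ⟨C.erase q, ?_, by rw [Finset.card_erase_of_mem hqC, h2], ?_⟩
    · intro x hx
      rw [Finset.mem_erase] at hx
      exact (Finset.mem_insert.1 (h1 hx.2)).resolve_left hx.1
    · rwa [Finset.insert_erase hqC]
  · right
    rw [hasCap_iff] at hc
    obtain ⟨C, h1, h2, h3, h4⟩ := hc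
    have hqC : q ∈ C := by
      by_contra hqC
      apply h.2.1.2
      rw [hasCap_iff]
      refine ⟨C, fun x hx => ?_, h2, h3, h4⟩
      have := h1 hx
      rw [Finset.mem_insert] at this
      rcases this with rfl | h
      · exact absurd hx hqC
      · exact h
    refine ⟨C.erase q, ?_, by rw [Finset.card_erase_of_mem hqC, h2], ?_⟩
    · intro x hx
      rw [Finset.mem_erase] at hx
      exact (Finset.mem_insert.1 (h1 hx.2)).resolve_left hx.1
    · rwa [Finset.insert_erase hqC]

lemma CupSet.mono {C D : Finset (ℝ × ℝ)} (h : CupSet D) (hs : C ⊆ D) : CupSet C :=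
  fun a ha b hb c hc => h a (hs ha) b (hs hb) c (hs hc)

lemma CapSet.mono {C D : Finset (ℝ × ℝ)} (h : CapSet D) (hs : C ⊆ D) : CapSet C :=
  fun a ha b hb c hc => h a (hs ha) b (hs hb) c (hs hc)

lemma XInj.mono {C D : Finset (ℝ × ℝ)} (h : XInj D) (hs : C ⊆ D) : XInj C :=
  Set.InjOn.mono (by exact_mod_cast hs) h

lemma two_of_card {C : Finset (ℝ × ℝ)} (hx : XInj C) (hc : 2 ≤ C.card) :
    ∃ a ∈ C, ∃ b ∈ C, a.1 < b.1 := by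
  obtain ⟨a, ha, b, hb, hab⟩ := Finset.one_lt_card.1 (by omega : 1 < C.card)
  rcases lt_trichotomy a.1 b.1 with h | h | h
  · exact ⟨a, ha, b, hb, h⟩
  · exact absurd (hx ha hb h) hab
  · exact ⟨b, hb, a, ha, h⟩

/-- no cap through a high point with three further points -/
lemma high_cap {C : Finset (ℝ × ℝ)} (hx : XInj C) {q : ℝ × ℝ}
    (hq : ∀ p ∈ C, p.1 ≠ q.1)
    (hh : ∀ a ∈ C, ∀ b ∈ C, a.1 < b.1 → 0 < ori a b q) (hcap : CapSet (insert q C)) :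
    C.card ≤ 2 := by
  classical
  by_contra hlt
  have hs : C = C.filter (fun p => p.1 < q.1) ∪ C.filter (fun p => q.1 < p.1) := by
    ext p
    simp only [Finset.mem_union, Finset.mem_filter]
    constructor
    · intro hp
      rcases lt_or_gt_of_ne (hq p hp) with h | h
      · exact Or.inl ⟨hp, h⟩
      · exact Or.inr ⟨hp, h⟩
    · rintro (h | h) <;> exact h.1
  have hcard := Finset.card_union_le (C.filter (fun p => p.1 < q.1)) (C.filter (fun p => q.1 < p.1))
  rw [← hs] at hcard
  have : 2 ≤ (C.filter (fun p => p.1 < q.1)).card ∨ 2 ≤ (C.filter (fun p => q.1 < p.1)).card := by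
    omega
  rcases this with h | h
  · obtain ⟨a, ha, b, hb, hab⟩ := two_of_card (hx.mono (Finset.filter_subset _ _)) h
    rw [Finset.mem_filter] at ha hb
    have h1 := hh a ha.1 b hb.1 hab
    have h2 := hcap a (by simp [ha.1]) b (by simp [hb.1]) q (by simp) hab hb.2
    linarith
  · obtain ⟨a, ha, b, hb, hab⟩ := two_of_card (hx.mono (Finset.filter_subset _ _)) h
    rw [Finset.mem_filter] at ha hb
    have h1 := hh a ha.1 b hb.1 hab
    have h2 := hcap q (by simp) a (by simp [ha.1]) b (by simp [hb.1]) ha.2 hab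
    rw [← ori_rot] at h2
    linarith

lemma exists_right (P : Finset (ℝ × ℝ)) : ∃ x0 : ℝ, ∀ p ∈ P, p.1 < x0 := by
  have : ∀ᶠ x : ℝ in Filter.atTop, ∀ p ∈ P, p.1 < x := by
    rw [Filter.eventually_all_finset]
    intro p _
    exact Filter.eventually_gt_atTop _
  exact this.exists

lemma exists_left (P : Finset (ℝ × ℝ)) : ∃ x0 : ℝ, ∀ p ∈ P, x0 < p.1 := by
  have : ∀ᶠ x : ℝ in Filter.atBot, ∀ p ∈ P, x < p.1 := by
    rw [Filter.eventually_all_finset]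
    intro p _
    exact Filter.eventually_lt_atBot _
  exact this.exists

lemma sat_cup_pred {P : Finset (ℝ × ℝ)} {k l : ℕ} (h : CupCapSat P k l) (hl : 3 ≤ l) :
    ∃ C ⊆ P, C.card = k - 1 ∧ CupSet C := by
  obtain ⟨x0, hx0⟩ := exists_right P
  obtain ⟨q, rfl, hqP, hg, hh⟩ := highPt h.1 x0 (fun p hp => (hx0 p hp).ne)
  rcases sat_cases h hqP hg with ⟨C, h1, h2, h3⟩ | ⟨C, h1, h2, h3⟩
  · exact ⟨C, h1, h2, h3.mono (Finset.subset_insert _ _)⟩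
  · exfalso
    obtain ⟨a, ha, b, hb, hab⟩ := two_of_card (h.1.2.mono h1 : XInj C) (by omega)
    have := hh a (h1 ha) b (h1 hb) hab
    have := h3 a (by simp [ha]) b (by simp [hb]) q (by simp) hab (hx0 b (h1 hb))
    linarith

lemma sat_cap_pred {P : Finset (ℝ × ℝ)} {k l : ℕ} (h : CupCapSat P k l) (hk : 3 ≤ k) :
    ∃ C ⊆ P, C.card = l - 1 ∧ CapSet C := by
  obtain ⟨C, h1, h2, h3⟩ := sat_cup_pred (sat_reflS h) hk
  exact ⟨reflS C, by simpa using reflS_subset h1, by rw [card_reflS, h2], capSet_reflS.2 h3⟩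

lemma sat_nonempty {P : Finset (ℝ × ℝ)} {k l : ℕ} (h : CupCapSat P k l) (hk : 2 ≤ k)
    (hl : 2 ≤ l) : P.Nonempty := by
  by_contra hne
  rw [Finset.not_nonempty_iff_eq_empty] at hne
  subst hne
  have hg : Generic (insert ((0 : ℝ), (0 : ℝ)) ∅) := generic_insert_s19 h.1 (by simp) (by simp)
  rcases sat_cases h (by simp) hg with ⟨C, h1, h2, h3⟩ | ⟨C, h1, h2, h3⟩ <;>
  · rw [Finset.subset_empty] at h1
    subst h1
    simp at h2
    omega

lemma split_cup {P : Finset (ℝ × ℝ)} {k l : ℕ} (h : CupCapSat P k l) (hk : 2 ≤ k) (hl : 4 ≤ l) :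
    ∃ a ∈ P, (∃ C ⊆ P, C.card = k - 1 ∧ CupSet C ∧ ∀ c ∈ C, c.1 ≤ a.1) ∧
      (∃ C ⊆ P, C.card = k - 1 ∧ CupSet C ∧ ∀ c ∈ C, a.1 ≤ c.1) := by
  classical
  let S := P.filter (fun a => ∃ C ⊆ P, C.card = k - 1 ∧ CupSet C ∧ ∀ c ∈ C, c.1 ≤ a.1)
  have hS : S.Nonempty := by
    obtain ⟨a, ha, hmax⟩ := P.exists_max_image (fun p => p.1) (sat_nonempty h hk (by omega))
    obtain ⟨C, h1, h2, h3⟩ := sat_cup_pred h (by omega)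
    exact ⟨a, Finset.mem_filter.2 ⟨ha, C, h1, h2, h3, fun c hc => hmax c (h1 hc)⟩⟩
  obtain ⟨a, haS, hmin⟩ := S.exists_min_image (fun p => p.1) hS
  obtain ⟨haP, hleft⟩ := Finset.mem_filter.1 haS
  refine ⟨a, haP, hleft, ?_⟩
  obtain ⟨x0, hx0, hx0'⟩ := exists_just_left P a.1
  have hne : ∀ p ∈ P, p.1 ≠ x0 := by
    intro p hp he
    rw [← he] at hx0
    exact absurd (hx0' p hp hx0) (by rw [he]; exact lt_irrefl _)
  obtain ⟨q, rfl, hqP, hg, hh⟩ := highPt h.1 x0 hne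
  have hge : ∀ p ∈ P, ¬ p.1 < q.1 → a.1 ≤ p.1 := by
    intro p hp hn
    by_contra hlt
    exact hn (hx0' p hp (not_le.1 hlt))
  rcases sat_cases h hqP hg with ⟨C, h1, h2, h3⟩ | ⟨C, h1, h2, h3⟩
  · refine ⟨C, h1, h2, h3.mono (Finset.subset_insert _ _), ?_⟩
    intro c hc
    apply hge c (h1 hc)
    intro hcq
    have hall : ∀ c' ∈ C, c'.1 < q.1 := by
      intro c' hc'
      by_contra hn
      have hlt : q.1 < c'.1 := lt_of_le_of_ne (not_lt.1 hn) (hne c' (h1 hc')).symm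
      have e1 := h3 c (by simp [hc]) q (by simp) c' (by simp [hc']) hcq hlt
      have e2 := hh c (h1 hc) c' (h1 hc') (hcq.trans hlt)
      rw [ori_swap] at e1
      linarith
    obtain ⟨a', ha', hmax⟩ := C.exists_max_image (fun p => p.1) ⟨c, hc⟩
    have : a' ∈ S := Finset.mem_filter.2 ⟨h1 ha', C, h1, h2, h3.mono (Finset.subset_insert _ _),
      hmax⟩
    have e := hmin a' this
    have := hall a' ha'
    linarith
  · exfalso
    have := high_cap (h.1.2.mono h1 : XInj C) (fun p hp => hne p (h1 hp))
      (fun a ha b hb => hh a (h1 ha) b (h1 hb)) h3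
    omega

lemma split_cap {P : Finset (ℝ × ℝ)} {k l : ℕ} (h : CupCapSat P k l) (hk : 4 ≤ k) (hl : 2 ≤ l) :
    ∃ a ∈ P, (∃ C ⊆ P, C.card = l - 1 ∧ CapSet C ∧ ∀ c ∈ C, c.1 ≤ a.1) ∧
      (∃ C ⊆ P, C.card = l - 1 ∧ CapSet C ∧ ∀ c ∈ C, a.1 ≤ c.1) := by
  obtain ⟨a, ha, ⟨C, h1, h2, h3, h4⟩, ⟨D, g1, g2, g3, g4⟩⟩ := split_cup (sat_reflS h) hl hk
  rw [mem_reflS] at ha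
  refine ⟨rfx a, ha, ⟨reflS C, by simpa using reflS_subset h1, by rw [card_reflS, h2],
    capSet_reflS.2 h3, ?_⟩, ⟨reflS D, by simpa using reflS_subset g1, by rw [card_reflS, g2],
    capSet_reflS.2 g3, ?_⟩⟩
  · intro c hc; rw [mem_reflS] at hc; exact h4 (rfx c) hc
  · intro c hc; rw [mem_reflS] at hc; exact g4 (rfx c) hc

lemma sat_cup_le {P : Finset (ℝ × ℝ)} {k l : ℕ} (h : CupCapSat P (k + 1) l) {C : Finset (ℝ × ℝ)}
    (hC : C ⊆ P) (hcup : CupSet C) : C.card ≤ k := by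
  by_contra hlt
  obtain ⟨D, hD, hcard⟩ := Finset.exists_subset_card_eq (by omega : k + 1 ≤ C.card)
  exact h.2.1.1 ((hasCup_iff _ _).2 ⟨D, hD.trans hC, hcard, h.1.2.mono (hD.trans hC), hcup.mono hD⟩)

lemma sat_cap_le {P : Finset (ℝ × ℝ)} {k l : ℕ} (h : CupCapSat P k (l + 1)) {C : Finset (ℝ × ℝ)}
    (hC : C ⊆ P) (hcap : CapSet C) : C.card ≤ l := by
  by_contra hlt
  obtain ⟨D, hD, hcard⟩ := Finset.exists_subset_card_eq (by omega : l + 1 ≤ C.card)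
  exact h.2.1.2 ((hasCap_iff _ _).2 ⟨D, hD.trans hC, hcard, h.1.2.mono (hD.trans hC), hcap.mono hD⟩)


/-- `q` is above all lines of `G`. -/
def AboveAll (G : Finset (ℝ × ℝ)) (q : ℝ × ℝ) : Prop :=
  ∀ a ∈ G, ∀ b ∈ G, a.1 < b.1 → 0 < ori a b q

/-- `q` is below all lines of `G`. -/
def BelowAll (G : Finset (ℝ × ℝ)) (q : ℝ × ℝ) : Prop :=
  ∀ a ∈ G, ∀ b ∈ G, a.1 < b.1 → ori a b q < 0

/-- a large cup seen from above -/
def CupT (G : ℕ → Finset (ℝ × ℝ)) (q : ℝ × ℝ) (i : ℕ) : Prop :=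
  ∃ C ⊆ G i, C.card = i + 1 ∧ CupSet C ∧ AboveAll C q

/-- a large cap seen from below -/
def CapT (n : ℕ) (G : ℕ → Finset (ℝ × ℝ)) (q : ℝ × ℝ) (i : ℕ) : Prop :=
  ∃ C ⊆ G i, C.card = n - i - 1 ∧ CapSet C ∧ BelowAll C q

/-- `q` is on one side of all lines from `G i` to `G (i+1)`. -/
def SideUp (G : ℕ → Finset (ℝ × ℝ)) (q : ℝ × ℝ) (i : ℕ) : Prop :=
  (∀ c ∈ G i, ∀ d ∈ G (i + 1), 0 < ori c d q) ∨ (∀ c ∈ G i, ∀ d ∈ G (i + 1), ori c d q < 0)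

/-- some linear functional increases along the clusters -/
def MonoG (n : ℕ) (G : ℕ → Finset (ℝ × ℝ)) : Prop :=
  ∃ f1 f2 : ℝ, ∀ i k, i < k → k < n - 1 → ∀ a ∈ G i, ∀ b ∈ G k,
    f1 * a.1 + f2 * a.2 < f1 * b.1 + f2 * b.2

lemma win_pos {n : ℕ} {G : ℕ → Finset (ℝ × ℝ)} (hG : Clusters n G) {j : ℕ}
    (hj : j + 1 < n - 1) {q : ℝ × ℝ} (hq : q ∉ allPts n G) {C D : Finset (ℝ × ℝ)}
    (hC : C ⊆ G j) (hD : D ⊆ G (j + 1)) (cC : C.card = j + 1) (cD : D.card = n - j - 2)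
    (hcup : CupSet C) (hcap : CapSet D) (hA : AboveAll C q) (hB : BelowAll D q)
    (h : ∀ c ∈ C, ∀ d ∈ D, 0 < ori c d q) : Win n G q := by
  obtain ⟨t, ht⟩ := exists_left C
  refine win_cup hG hj hq hC hD hcup hcap cC cD t (fun u hu => (ht u hu).ne') ?_ ?_ hB
  · intro a ha b hb hab
    refine ⟨fun _ => ?_, fun h' => ?_, fun h' => ?_⟩
    · have := hA a ha b hb hab
      unfold ori at *; linarith
    · exact absurd (ht a ha) (not_lt.2 h'.le)
    · exact absurd (ht b hb) (not_lt.2 h'.le)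
  · intro u hu v hv
    refine ⟨fun h' => absurd (ht u hu) (not_lt.2 h'.le), fun _ => ?_⟩
    have := h u hu v hv
    unfold ori at *; linarith

lemma win_neg {n : ℕ} {G : ℕ → Finset (ℝ × ℝ)} (hG : Clusters n G) {j : ℕ}
    (hj : j + 1 < n - 1) {q : ℝ × ℝ} (hq : q ∉ allPts n G) {C D : Finset (ℝ × ℝ)}
    (hC : C ⊆ G j) (hD : D ⊆ G (j + 1)) (cC : C.card = j + 1) (cD : D.card = n - j - 2)
    (hcup : CupSet C) (hcap : CapSet D) (hA : AboveAll C q) (hB : BelowAll D q)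
    (h : ∀ c ∈ C, ∀ d ∈ D, ori c d q < 0) : Win n G q := by
  obtain ⟨t, ht⟩ := exists_right C
  refine win_cup hG hj hq hC hD hcup hcap cC cD t (fun u hu => (ht u hu).ne) ?_ ?_ hB
  · intro a ha b hb hab
    refine ⟨fun h' => ?_, fun _ h' => ?_, fun _ => hA a ha b hb hab⟩
    · exact absurd (ht a ha) (not_lt.2 h'.le)
    · exact absurd (ht b hb) (not_lt.2 h'.le)
  · intro u hu v hv
    refine ⟨fun _ => ?_, fun h' => absurd (ht u hu) (not_lt.2 h'.le)⟩
    have := h u hu v hv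
    unfold ori at *; linarith

lemma wedge (b d0 a c q : ℝ × ℝ) (σ : ℝ) (h1 : 0 < ori b d0 a * ori b d0 q)
    (h2 : 0 < ori b d0 c * ori b d0 q) (h3 : 0 < σ * ori a c b) (h4 : 0 < σ * ori a b q) :
    0 < σ * ori c b q := by
  by_contra hn
  push Not at hn
  have key : ori b d0 q * ori b d0 q * (σ * ori a c b) =
      (ori b d0 a * ori b d0 q) * (σ * ori c b q) - (ori b d0 c * ori b d0 q) * (σ * ori a b q) := by
    unfold ori; ring
  have e1 : 0 ≤ ori b d0 q * ori b d0 q * (σ * ori a c b) :=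
    mul_nonneg (mul_self_nonneg _) h3.le
  have e2 : (ori b d0 a * ori b d0 q) * (σ * ori c b q) ≤ 0 :=
    mul_nonpos_of_nonneg_of_nonpos h1.le hn
  have e3 := mul_pos h2 h4
  linarith

lemma tri_neg {a b z q : ℝ × ℝ} (h1 : 0 < ori a b q) (h2 : 0 < ori b z q) (h3 : 0 < ori z a q)
    (u w : ℝ × ℝ) (ha : ori u w a ≤ 0) (hb : ori u w b < 0) (hz : ori u w z ≤ 0) :
    ori u w q < 0 := by
  have key : ori u w q * (ori a b q + ori b z q + ori z a q) =
      ori b z q * ori u w a + ori z a q * ori u w b + ori a b q * ori u w z := by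
    unfold ori; ring
  have e1 := mul_nonpos_of_nonneg_of_nonpos h2.le ha
  have e2 := mul_neg_of_pos_of_neg h3 hb
  have e3 := mul_nonpos_of_nonneg_of_nonpos h1.le hz
  by_contra hn
  push Not at hn
  have := mul_nonneg hn (by linarith : 0 ≤ ori a b q + ori b z q + ori z a q)
  linarith

lemma gp_pos {b c w z q : ℝ × ℝ} (h1 : 0 < ori b c w) (h2 : 0 < ori b z q) (h3 : 0 < ori b c z)
    (h4 : 0 < ori b c q) (h5 : 0 < ori b w z) : 0 < ori b w q := by
  have := ori_gp b c w z q
  have e1 := mul_pos h1 h2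
  have e2 := mul_pos h4 h5
  by_contra hn
  push Not at hn
  have := mul_nonpos_of_nonneg_of_nonpos h3.le hn
  linarith

lemma mono_cap {f1 f2 : ℝ} {a b c d : ℝ × ℝ}
    (hab : f1 * a.1 + f2 * a.2 < f1 * b.1 + f2 * b.2)
    (hbc : f1 * b.1 + f2 * b.2 < f1 * c.1 + f2 * c.2)
    (hcd : f1 * c.1 + f2 * c.2 < f1 * d.1 + f2 * d.2)
    (h1 : ori a b c < 0) (h2 : ori b c d < 0) : ori a b d < 0 ∧ ori a c d < 0 := by
  set fa := f1 * a.1 + f2 * a.2 with hfa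
  set fb := f1 * b.1 + f2 * b.2 with hfb
  set fc := f1 * c.1 + f2 * c.2 with hfc
  set fd := f1 * d.1 + f2 * d.2 with hfd
  have k1 : (fc - fb) * ori a b d = (fb - fa) * ori b c d + (fd - fb) * ori a b c := by
    rw [hfa, hfb, hfc, hfd]; unfold ori; ring
  have k2 : (fc - fb) * ori a c d = (fc - fa) * ori b c d + (fd - fc) * ori a b c := by
    rw [hfa, hfb, hfc, hfd]; unfold ori; ring
  have hpos : 0 < fc - fb := by linarith
  constructor
  · have e1 := mul_neg_of_pos_of_neg (by linarith : 0 < fb - fa) h2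
    have e2 := mul_neg_of_pos_of_neg (by linarith : 0 < fd - fb) h1
    by_contra hn
    push Not at hn
    have := mul_nonneg hpos.le hn
    linarith
  · have e1 := mul_neg_of_pos_of_neg (by linarith : 0 < fc - fa) h2
    have e2 := mul_neg_of_pos_of_neg (by linarith : 0 < fd - fc) h1
    by_contra hn
    push Not at hn
    have := mul_nonneg hpos.le hn
    linarith

lemma cupSet_pair (a b : ℝ × ℝ) : CupSet {a, b} := by
  intro x hx y hy z hz h1 h2
  simp only [Finset.mem_insert, Finset.mem_singleton] at hx hy hz
  rcases hx with rfl | rfl <;> rcases hy with rfl | rfl <;> rcases hz with rfl | rfl <;>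
    first
    | exact absurd h1 (lt_irrefl _)
    | exact absurd h2 (lt_irrefl _)
    | exact absurd (h1.trans h2) (lt_irrefl _)

lemma capSet_pair (a b : ℝ × ℝ) : CapSet {a, b} := by
  intro x hx y hy z hz h1 h2
  simp only [Finset.mem_insert, Finset.mem_singleton] at hx hy hz
  rcases hx with rfl | rfl <;> rcases hy with rfl | rfl <;> rcases hz with rfl | rfl <;>
    first
    | exact absurd h1 (lt_irrefl _)
    | exact absurd h2 (lt_irrefl _)
    | exact absurd (h1.trans h2) (lt_irrefl _)

/-- The exceptional case at the top. -/
lemma top_case {n : ℕ} {G : ℕ → Finset (ℝ × ℝ)} (hG : Clusters n G) (hM : MonoG n G)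
    (hsat : ∀ i, i < n - 1 → CupCapSat (G i) (i + 2) (n - i))
    {q : ℝ × ℝ} (hq : q ∉ allPts n G)
    (hgen : ∀ a ∈ allPts n G, ∀ b ∈ allPts n G, a ≠ b → ori a b q ≠ 0)
    (j : ℕ) (hj : j + 3 = n) (hA : AboveAll (G j) q) : Win n G q := by
  classical
  obtain ⟨C, hC, cC, hcup⟩ := sat_cup_pred (hsat j (by omega)) (by omega)
  obtain ⟨z, hz⟩ := sat_nonempty (hsat (j + 1) (by omega)) (by omega) (by omega)
  have hne : ∀ i, i < n - 1 → (G i).Nonempty := fun i hi =>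
    sat_nonempty (hsat i hi) (by omega) (by omega)
  have hAC : AboveAll C q := fun a ha b hb => hA a (hC ha) b (hC hb)
  have hB : BelowAll {z} q := by
    intro a ha b hb hab
    rw [Finset.mem_singleton] at ha hb
    rw [ha, hb] at hab; exact absurd hab (lt_irrefl _)
  have hcap : CapSet {z} := by
    intro a ha b hb c hc hab
    rw [Finset.mem_singleton] at ha hb
    rw [ha, hb] at hab; exact absurd hab (lt_irrefl _)
  have hzG : ({z} : Finset (ℝ × ℝ)) ⊆ G (j + 1) := by simpa using hz
  by_cases hp : ∀ c ∈ C, 0 < ori c z q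
  · exact win_pos hG (by omega) hq hC hzG (by omega) (by simp; omega) hcup hcap hAC hB
      (by simpa using hp)
  by_cases hp' : ∀ c ∈ C, ori c z q < 0
  · exact win_neg hG (by omega) hq hC hzG (by omega) (by simp; omega) hcup hcap hAC hB
      (by simpa using hp')
  push Not at hp hp'
  obtain ⟨a, ha, ha0⟩ := hp
  obtain ⟨b, hb, hb0⟩ := hp'
  have hjn : j < n - 1 := by omega
  have hnez : ∀ c ∈ G j, c ≠ z := fun c hc h =>
    hG.not_mem (Nat.lt_succ_self j) (by omega) hc (h ▸ hz)
  have ha1 : ori a z q < 0 := lt_of_le_of_ne ha0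
    (hgen a (sub_allPts hjn (hC ha)) z (sub_allPts (by omega) hz) (hnez a (hC ha)))
  have hb1 : 0 < ori b z q := lt_of_le_of_ne hb0
    (hgen b (sub_allPts hjn (hC hb)) z (sub_allPts (by omega) hz) (hnez b (hC hb))).symm
  have hab : a ≠ b := by rintro rfl; linarith
  have hj1 : 1 ≤ j := by
    have := Finset.one_lt_card.2 ⟨a, ha, b, hb, hab⟩
    omega
  obtain ⟨s0, hs0⟩ : ∃ s : ℕ → ℝ × ℝ, ∀ i, i < n - 1 → s i ∈ G i := by
    refine ⟨fun i => if h : i < n - 1 then (hne i h).choose else 0, fun i hi => ?_⟩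
    simp only [hi, dif_pos]
    exact (hne i hi).choose_spec
  rcases lt_or_gt_of_ne (fun h => hab (hG.xinj j hjn (hC ha) (hC hb) h)) with hlt | hlt
  · -- type I
    have t1 := hA a (hC ha) b (hC hb) hlt
    have t3 : 0 < ori z a q := by unfold ori at *; linarith
    have tri := fun u w => tri_neg t1 hb1 t3 u w
    obtain ⟨C0, hC0, cC0, hcup0⟩ := sat_cup_pred (hsat (j - 1) (by omega)) (by omega)
    have hlow : ∀ i k, i < k → k < j → ∀ u ∈ G i, ∀ w ∈ G k, ori u w q < 0 := by
      intro i k hik hkj u hu w hw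
      exact tri u w (hG.bulge i k j hik hkj hjn u hu w hw a (hC ha)).le
        (hG.bulge i k j hik hkj hjn u hu w hw b (hC hb))
        (hG.bulge i k (j + 1) hik (by omega) (by omega) u hu w hw z hz).le
    by_cases hc : ∃ c ∈ C0, ori c b q < 0
    · obtain ⟨c, hc, hcb⟩ := hc
      have hcG := hC0 hc
      let s : ℕ → ℝ × ℝ := fun i => if i = j - 1 then c else if i = j then b else
        if i = j + 1 then z else s0 i
      have sj1 : s (j - 1) = c := by simp [s]
      have sj : s j = b := by
        have : j ≠ j - 1 := by omega
        simp [s, this]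
      have sj2 : s (j + 1) = z := by
        have : j + 1 ≠ j - 1 := by omega
        simp [s, this]
      have hs : ∀ i, i < n - 1 → s i ∈ G i := by
        intro i hi
        by_cases e1 : i = j - 1
        · rw [e1, sj1]; exact hcG
        by_cases e2 : i = j
        · rw [e2, sj]; exact hC hb
        by_cases e3 : i = j + 1
        · rw [e3, sj2]; exact hz
        · simp only [s, e1, e2, e3, if_false]; exact hs0 i hi
      refine win_chain (by omega) hG hq s hs (j + 1) ?_ ?_ ?_
      · intro i k hik hk hkm
        by_cases e : k < j
        · exact hlow i k hik e _ (hs i (by omega)) _ (hs k hk)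
        have ek : k = j := by omega
        subst ek
        rw [sj]
        by_cases e1 : i = k - 1
        · rw [e1, sj1]; exact hcb
        have hw := hs i (by omega)
        have b1 := hG.bulge i (k - 1) k (by omega) (by omega) hk _ hw _ hcG _ (hC hb)
        have b2 := hG.bulge (k - 1) k (k + 1) (by omega) (by omega) (by omega) _ hcG _ (hC hb) _ hz
        have b3 := hG.bulge i k (k + 1) (by omega) (by omega) (by omega) _ hw _ (hC hb) _ hz
        have := gp_pos (b := b) (c := c) (w := s i) (z := z) (q := q)
          (by unfold ori at *; linarith) hb1 (by unfold ori at *; linarith)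
          (by unfold ori at *; linarith) (by unfold ori at *; linarith)
        unfold ori at *; linarith
      · intro i k him hmk hk
        have ek : k = j + 1 := by omega
        rw [ek, sj2]
        by_cases e : i = j
        · rw [e, sj]; unfold ori at *; linarith
        have hw := hs i (by omega)
        have b1 := hG.bulge i j (j + 1) (by omega) (by omega) (by omega) _ hw _ (hC hb) _ hz
        have b2 := hG.bulge i j (j + 1) (by omega) (by omega) (by omega) _ hw _ (hC ha) _ hz
        have := tri z (s i) (by unfold ori at *; linarith) (by unfold ori at *; linarith)
          (by unfold ori; linarith)
        unfold ori at *; linarith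
      · intro i k h1 h2 h3
        omega
    · push Not at hc
      have hj' : j - 1 + 1 = j := by omega
      have hbig : ∀ u ∈ C0, 0 < ori u b q := fun u hu => lt_of_le_of_ne (hc u hu)
        (hgen u (sub_allPts (by omega) (hC0 hu)) b (sub_allPts hjn (hC hb)) (fun h =>
          hG.not_mem (by omega : j - 1 < j) hjn (hC0 hu) (h ▸ hC hb))).symm
      refine win_cap (by omega) hG (i := j - 1) (by omega) hq (U := C0) (V := {a, b}) hC0 ?_ hcup0
        (capSet_pair a b) (by omega) ?_ ((a.1 + b.1) / 2) ?_ ?_ ?_ ?_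
      · rw [hj']
        intro x hx
        simp only [Finset.mem_insert, Finset.mem_singleton] at hx
        rcases hx with rfl | rfl
        · exact hC ha
        · exact hC hb
      · rw [Finset.card_pair hab]; omega
      · intro u hu
        simp only [Finset.mem_insert, Finset.mem_singleton] at hu
        rcases hu with rfl | rfl
        · intro h; linarith
        · intro h; linarith
      · intro x hx y hy hxy
        simp only [Finset.mem_insert, Finset.mem_singleton] at hx hy
        rcases hx with rfl | rfl <;> rcases hy with rfl | rfl
        · exact absurd hxy (lt_irrefl _)
        · refine ⟨fun h => ?_, fun _ _ => ?_, fun h => ?_⟩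
          · linarith
          · unfold ori at *; linarith
          · linarith
        · linarith
        · exact absurd hxy (lt_irrefl _)
      · intro v hv u hu
        simp only [Finset.mem_insert, Finset.mem_singleton] at hv
        rcases hv with rfl | rfl
        · refine ⟨fun _ => ?_, fun h => by linarith⟩
          have b1 := hG.down (j - 1) j (by omega) hjn _ (hC ha) _ (hC hb) hlt u (hC0 hu)
          have b2 := hG.bulge (j - 1) j (j + 1) (by omega) (by omega) (by omega) _ (hC0 hu) _
            (hC ha) _ hz
          have := tri u v (by unfold ori; linarith) (by unfold ori at *; linarith) b2.le
          unfold ori at *; linarith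
        · refine ⟨fun h => by linarith, fun _ => ?_⟩
          have := hbig u hu
          unfold ori at *; linarith
      · intro x hx y hy hxy
        have b1 := hG.up (j - 1) j (by omega) hjn _ (hC0 hx) _ (hC0 hy) hxy _ (hC ha)
        have b2 := hG.up (j - 1) j (by omega) hjn _ (hC0 hx) _ (hC0 hy) hxy _ (hC hb)
        have b3 := hG.up (j - 1) (j + 1) (by omega) (by omega) _ (hC0 hx) _ (hC0 hy) hxy _ hz
        have := tri y x (by unfold ori at *; linarith) (by unfold ori at *; linarith)
          (by unfold ori at *; linarith)
        unfold ori at *; linarith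
  · -- type II
    obtain ⟨f1, f2, hf⟩ := hM
    have hza : f1 * a.1 + f2 * a.2 < f1 * z.1 + f2 * z.2 :=
      hf j (j + 1) (by omega) (by omega) _ (hC ha) _ hz
    have hzb : f1 * b.1 + f2 * b.2 < f1 * z.1 + f2 * z.2 :=
      hf j (j + 1) (by omega) (by omega) _ (hC hb) _ hz
    have hzq : f1 * z.1 + f2 * z.2 < f1 * q.1 + f2 * q.2 := by
      have key : ((f1 * q.1 + f2 * q.2) - (f1 * z.1 + f2 * z.2)) * ori b a z =
          ((f1 * z.1 + f2 * z.2) - (f1 * b.1 + f2 * b.2)) * (- ori a z q) +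
          ((f1 * z.1 + f2 * z.2) - (f1 * a.1 + f2 * a.2)) * ori b z q := by
        unfold ori; ring
      have hpos := hG.up j (j + 1) (by omega) (by omega) _ (hC hb) _ (hC ha) hlt _ hz
      have e1 := mul_pos (sub_pos.2 hzb) (neg_pos.2 ha1)
      have e2 := mul_pos (sub_pos.2 hza) hb1
      by_contra hn
      push Not at hn
      have := mul_nonpos_of_nonpos_of_nonneg (sub_nonpos.2 hn) hpos.le
      linarith
    let s : ℕ → ℝ × ℝ := fun i => if i = j then a else if i = j + 1 then z else s0 i
    have sj : s j = a := by simp [s]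
    have sj2 : s (j + 1) = z := by simp [s]
    have hs : ∀ i, i < n - 1 → s i ∈ G i := by
      intro i hi
      by_cases e2 : i = j
      · rw [e2, sj]; exact hC ha
      by_cases e3 : i = j + 1
      · rw [e3, sj2]; exact hz
      · simp only [s, e2, e3, if_false]; exact hs0 i hi
    have hfar : ∀ i, i < j → ori (s i) a q < 0 ∧ ori (s i) z q < 0 := by
      intro i hi
      exact mono_cap (hf i j hi hjn _ (hs i (by omega)) _ (hC ha)) hza hzq
        (hG.bulge i j (j + 1) hi (by omega) (by omega) _ (hs i (by omega)) _ (hC ha) _ hz) ha1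
    refine win_chain (by omega) hG hq s hs (j + 2) ?_ ?_ ?_
    · intro i k hik hk hkm
      by_cases e1 : k = j + 1
      · rw [e1, sj2]
        by_cases e2 : i = j
        · rw [e2, sj]; exact ha1
        · exact (hfar i (by omega)).2
      by_cases e2 : k = j
      · rw [e2, sj]; exact (hfar i (by omega)).1
      refine (mono_cap (hf i k hik hk _ (hs i (by omega)) _ (hs k hk))
        (hf k (j + 1) (by omega) (by omega) _ (hs k hk) _ hz) hzq
        (hG.bulge i k (j + 1) hik (by omega) (by omega) _ (hs i (by omega)) _ (hs k hk) _ hz)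
        (hfar k (by omega)).2).1
    · intro i k h1 h2 h3; omega
    · intro i k h1 h2 h3; omega

lemma bottom_case {n : ℕ} (hn : 3 ≤ n) {G : ℕ → Finset (ℝ × ℝ)} (hG : Clusters n G)
    (hM : MonoG n G) (hsat : ∀ i, i < n - 1 → CupCapSat (G i) (i + 2) (n - i))
    {q : ℝ × ℝ} (hq : q ∉ allPts n G)
    (hgen : ∀ a ∈ allPts n G, ∀ b ∈ allPts n G, a ≠ b → ori a b q ≠ 0)
    (hB : BelowAll (G 1) q) : Win n G q := by
  apply win_of_refl hn
  refine top_case (clusters_refl hG) ?_ ?_ (by rwa [allPts_refl hn, refl_refl]) ?_ (n - 3)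
    (by omega) ?_
  · obtain ⟨f1, f2, hf⟩ := hM
    refine ⟨-f1, f2, ?_⟩
    intro i k hik hk a ha b hb
    rw [reflG, mem_reflS] at ha hb
    have := hf (n - 2 - k) (n - 2 - i) (by omega) (by omega) _ hb _ ha
    simp only [rfx] at this
    linarith
  · intro i hi
    have := sat_reflS (hsat (n - 2 - i) (by omega))
    have e1 : n - (n - 2 - i) = i + 2 := by omega
    have e2 : n - 2 - i + 2 = n - i := by omega
    rw [e1, e2] at this
    exact this
  · intro a ha b hb hab h0
    rw [allPts_refl hn] at ha hb
    apply hgen _ ha _ hb (refl_inj.ne hab)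
    have := ori_refl a b (rfx q)
    rw [refl_refl, h0] at this
    linarith
  · intro a ha b hb hab
    have e : n - 2 - (n - 3) = 1 := by omega
    rw [reflG, mem_reflS, e] at ha hb
    have h1 := hB _ ha _ hb hab
    have := ori_refl a b (rfx q)
    rw [refl_refl] at this
    linarith

lemma same_sign {n : ℕ} {G : ℕ → Finset (ℝ × ℝ)} (hG : Clusters n G) {j : ℕ}
    (hj : j + 1 < n - 1) {q : ℝ × ℝ} (hB : BelowAll (G (j + 1)) q) {b d a : ℝ × ℝ}
    (hb : b ∈ G (j + 1)) (hd : d ∈ G (j + 1)) (hbd : b ≠ d) (ha : a ∈ G j) :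
    0 < ori b d a * ori b d q := by
  rcases lt_trichotomy b.1 d.1 with h | h | h
  · exact mul_pos_of_neg_of_neg (hG.down j (j + 1) (by omega) hj _ hb _ hd h _ ha)
      (hB _ hb _ hd h)
  · exact absurd (hG.xinj _ hj hb hd h) hbd
  · have e1 := hG.down j (j + 1) (by omega) hj _ hd _ hb h _ ha
    have e2 := hB _ hd _ hb h
    rw [ori_swap'] at e1 e2
    exact mul_pos (by linarith) (by linarith)

lemma same_sign' {n : ℕ} {G : ℕ → Finset (ℝ × ℝ)} (hG : Clusters n G) {j : ℕ}
    (hj : j + 1 < n - 1) {q : ℝ × ℝ} (hA : AboveAll (G j) q) {b d a : ℝ × ℝ}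
    (hb : b ∈ G j) (hd : d ∈ G j) (hbd : b ≠ d) (ha : a ∈ G (j + 1)) :
    0 < ori b d a * ori b d q := by
  rcases lt_trichotomy b.1 d.1 with h | h | h
  · exact mul_pos (hG.up j (j + 1) (by omega) hj _ hb _ hd h _ ha)
      (hA _ hb _ hd h)
  · exact absurd (hG.xinj _ (by omega) hb hd h) hbd
  · have e1 := hG.up j (j + 1) (by omega) hj _ hd _ hb h _ ha
    have e2 := hA _ hd _ hb h
    rw [ori_swap'] at e1 e2
    exact mul_pos_of_neg_of_neg (by linarith) (by linarith)

/-- the middle case -/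
lemma mid_case {n : ℕ} {G : ℕ → Finset (ℝ × ℝ)} (hG : Clusters n G)
    (hsat : ∀ i, i < n - 1 → CupCapSat (G i) (i + 2) (n - i))
    {q : ℝ × ℝ} (hq : q ∉ allPts n G)
    (hgen : ∀ a ∈ allPts n G, ∀ b ∈ allPts n G, a ≠ b → ori a b q ≠ 0)
    (j : ℕ) (hj1 : 1 ≤ j) (hj : j + 4 ≤ n) (hA : AboveAll (G j) q)
    (hB : BelowAll (G (j + 1)) q) : Win n G q := by
  have hj' : j + 1 < n - 1 := by omega
  obtain ⟨a, ha, ⟨C, hC, cC, hC1, hC2⟩, ⟨C', hC', cC', hC1', hC2'⟩⟩ :=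
    split_cup (hsat j (by omega)) (by omega) (by omega)
  obtain ⟨b, hb, ⟨D, hD, cD, hD1, hD2⟩, ⟨D', hD', cD', hD1', hD2'⟩⟩ :=
    split_cap (hsat (j + 1) (by omega)) (by omega) (by omega)
  have hab : a ≠ b := fun h => hG.not_mem (Nat.lt_succ_self j) hj' ha (h ▸ hb)
  have h0 := hgen a (sub_allPts (by omega) ha) b (sub_allPts hj' hb) hab
  have exC : ∀ x, ∃ y ∈ G j, x ≠ y := by
    intro x
    obtain ⟨y, hy, hyx⟩ := Finset.exists_mem_ne (by omega : 1 < C.card) x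
    exact ⟨y, hC hy, hyx.symm⟩
  have exD : ∀ x, ∃ y ∈ G (j + 1), x ≠ y := by
    intro x
    obtain ⟨y, hy, hyx⟩ := Finset.exists_mem_ne (by omega : 1 < D.card) x
    exact ⟨y, hD hy, hyx.symm⟩
  have key : ∀ σ : ℝ, 0 < σ * ori a b q → ∀ c ∈ G j, ∀ d ∈ G (j + 1),
      (c ≠ a → 0 < σ * ori a c b) → (d ≠ b → σ * ori b d c < 0) → 0 < σ * ori c d q := by
    intro σ hσ c hc d hd h1 h2
    have s1 : 0 < σ * ori c b q := by
      by_cases e : c = a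
      · rw [e]; exact hσ
      obtain ⟨d0, hd0, hne⟩ := exD b
      exact wedge b d0 a c q σ (same_sign hG hj' hB hb hd0 hne ha)
        (same_sign hG hj' hB hb hd0 hne hc) (h1 e) hσ
    by_cases e : d = b
    · rw [e]; exact s1
    obtain ⟨a0, ha0, hne⟩ := exC c
    have := wedge c a0 b d q (-σ) (same_sign' hG hj' hA hc ha0 hne hb)
        (same_sign' hG hj' hA hc ha0 hne hd) (by have := h2 e; linarith)
        (by rw [ori_swap']; linarith)
    rw [ori_swap'] at this
    linarith
  rcases lt_or_gt_of_ne h0 with h | h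
  · refine win_neg hG hj' hq hC hD (by omega) (by omega) hC1 hD1
      (fun x hx y hy => hA x (hC hx) y (hC hy)) (fun x hx y hy => hB x (hD hx) y (hD hy)) ?_
    intro c hc d hd
    have := key (-1) (by linarith) c (hC hc) d (hD hd) ?_ ?_
    · linarith
    · intro hne
      have hlt : c.1 < a.1 := lt_of_le_of_ne (hC2 c hc) (fun h =>
        hne (hG.xinj j (by omega) (hC hc) ha h))
      have := hG.up j (j + 1) (by omega) hj' _ (hC hc) _ ha hlt _ hb
      rw [ori_swap'] at this; linarith
    · intro hne
      have hlt : d.1 < b.1 := lt_of_le_of_ne (hD2 d hd) (fun h =>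
        hne (hG.xinj (j + 1) (by omega) (hD hd) hb h))
      have := hG.down j (j + 1) (by omega) hj' _ (hD hd) _ hb hlt _ (hC hc)
      rw [ori_swap'] at this; linarith
  · refine win_pos hG hj' hq hC' hD' (by omega) (by omega) hC1' hD1'
      (fun x hx y hy => hA x (hC' hx) y (hC' hy)) (fun x hx y hy => hB x (hD' hx) y (hD' hy)) ?_
    intro c hc d hd
    have := key 1 (by linarith) c (hC' hc) d (hD' hd) ?_ ?_
    · linarith
    · intro hne
      have hlt : a.1 < c.1 := lt_of_le_of_ne (hC2' c hc) (fun h =>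
        hne (hG.xinj j (by omega) (hC' hc) ha h.symm))
      have := hG.up j (j + 1) (by omega) hj' _ ha _ (hC' hc) hlt _ hb
      linarith
    · intro hne
      have hlt : b.1 < d.1 := lt_of_le_of_ne (hD2' d hd) (fun h =>
        hne (hG.xinj (j + 1) (by omega) (hD' hd) hb h.symm))
      have := hG.down j (j + 1) (by omega) hj' _ hb _ (hD' hd) hlt _ (hC' hc)
      linarith

/-- The combination argument. -/
lemma combine {n : ℕ} (hn : 3 ≤ n) {G : ℕ → Finset (ℝ × ℝ)} (hG : Clusters n G)
    (hM : MonoG n G) (hsat : ∀ i, i < n - 1 → CupCapSat (G i) (i + 2) (n - i))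
    {q : ℝ × ℝ} (hq : q ∉ allPts n G)
    (hgen : ∀ a ∈ allPts n G, ∀ b ∈ allPts n G, a ≠ b → ori a b q ≠ 0)
    (hI : ∀ i, 1 ≤ i → i + 3 ≤ n → AboveAll (G i) q ∨ BelowAll (G i) q ∨
      ((CupT G q i ∨ CapT n G q i) ∧ SideUp G q i ∧ SideUp G q (i - 1)) ∨ Win n G q) :
    Win n G q := by
  classical
  by_contra hW
  have hA0 : AboveAll (G 0) q := by
    intro a ha b hb hab
    exfalso
    have := sat_cup_le (k := 1) (hsat 0 (by omega)) (C := {a, b}) (by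
      intro x hx
      simp only [Finset.mem_insert, Finset.mem_singleton] at hx
      rcases hx with rfl | rfl <;> assumption) (cupSet_pair a b)
    rw [Finset.card_pair (by rintro rfl; exact lt_irrefl _ hab)] at this
    omega
  have hBn : BelowAll (G (n - 2)) q := by
    intro a ha b hb hab
    exfalso
    have h2 : n - (n - 2) = 1 + 1 := by omega
    have h3 := hsat (n - 2) (by omega)
    rw [h2] at h3
    have := sat_cap_le (l := 1) h3 (C := {a, b}) (by
      intro x hx
      simp only [Finset.mem_insert, Finset.mem_singleton] at hx
      rcases hx with rfl | rfl <;> assumption) (capSet_pair a b)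
    rw [Finset.card_pair (by rintro rfl; exact lt_irrefl _ hab)] at this
    omega
  have cupA : ∀ i, i + 3 ≤ n → AboveAll (G i) q → CupT G q i := by
    intro i hi hA
    obtain ⟨C, hC, cC, hcup⟩ := sat_cup_pred (hsat i (by omega)) (by omega)
    exact ⟨C, hC, by omega, hcup, fun a ha b hb => hA a (hC ha) b (hC hb)⟩
  have capB : ∀ i, 1 ≤ i → i + 2 ≤ n → BelowAll (G i) q → CapT n G q i := by
    intro i hi hi' hA
    obtain ⟨C, hC, cC, hcup⟩ := sat_cap_pred (hsat i (by omega)) (by omega)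
    exact ⟨C, hC, by omega, hcup, fun a ha b hb => hA a (hC ha) b (hC hb)⟩
  have hex : ∃ i, 1 ≤ i ∧ i + 2 ≤ n ∧ CapT n G q i :=
    ⟨n - 2, by omega, by omega, capB (n - 2) (by omega) (by omega) hBn⟩
  obtain ⟨hi1, hi2, hcap⟩ := Nat.find_spec hex
  have hmin := fun m => Nat.find_min hex (m := m)
  set i := Nat.find hex
  obtain ⟨j, hj⟩ : ∃ j, i = j + 1 := ⟨i - 1, by omega⟩
  rw [hj] at hcap hi2 hmin
  have hnoCap : 1 ≤ j → ¬ CapT n G q j := fun h1 h2 => hmin j (by omega) ⟨h1, by omega, h2⟩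
  have hj3 : j + 3 ≤ n := by omega
  have h1 : (AboveAll (G j) q ∨ SideUp G q j) ∧ CupT G q j := by
    by_cases e : j = 0
    · rw [e]; exact ⟨Or.inl hA0, cupA 0 hn hA0⟩
    · rcases hI j (by omega) hj3 with h | h | ⟨h, h', -⟩ | h
      · exact ⟨Or.inl h, cupA j hj3 h⟩
      · exact absurd (capB j (by omega) (by omega) h) (hnoCap (by omega))
      · exact ⟨Or.inr h', h.resolve_right (hnoCap (by omega))⟩
      · exact absurd h hW
  have h2 : BelowAll (G (j + 1)) q ∨ SideUp G q j := by
    by_cases e : j + 1 = n - 2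
    · rw [e]; exact Or.inl hBn
    · rcases hI (j + 1) (by omega) (by omega) with h | h | ⟨-, -, h⟩ | h
      · obtain ⟨D, hD, cD, -, hB⟩ := hcap
        obtain ⟨x, hx, y, hy, hxy⟩ := two_of_card ((hG.xinj (j + 1) (by omega)).mono hD : XInj D)
          (by omega)
        have := hB x hx y hy hxy
        have := h x (hD hx) y (hD hy) hxy
        linarith
      · exact Or.inl h
      · exact Or.inr h
      · exact absurd h hW
  obtain ⟨h1, C, hC, cC, hcup, hCA⟩ := h1
  obtain ⟨D, hD, cD, hcapD, hDB⟩ := hcap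
  have hside : ¬ SideUp G q j := by
    rintro (h | h)
    · exact hW (win_pos hG (by omega) hq hC hD cC (by omega) hcup hcapD hCA hDB
        fun c hc d hd => h c (hC hc) d (hD hd))
    · exact hW (win_neg hG (by omega) hq hC hD cC (by omega) hcup hcapD hCA hDB
        fun c hc d hd => h c (hC hc) d (hD hd))
  have hA := h1.resolve_right hside
  have hB := h2.resolve_right hside
  apply hW
  by_cases e : j + 3 = n
  · exact top_case hG hM hsat hq hgen j e hA
  by_cases e0 : j = 0
  · rw [e0] at hB
    exact bottom_case hn hG hM hsat hq hgen hB
  exact mid_case hG hsat hq hgen j (by omega) (by omega) hA hB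


open Filter Topology

lemma ev_small (c b : ℝ) (hb : 0 < b) : ∀ᶠ η in 𝓝[>] (0 : ℝ), c * η < b := by
  have h : Tendsto (fun η : ℝ => c * η) (𝓝[>] 0) (𝓝 (c * 0)) :=
    ((continuous_const.mul continuous_id).tendsto 0).mono_left nhdsWithin_le_nhds
  rw [mul_zero] at h
  exact h.eventually_lt_const hb

lemma ev_lt (b : ℝ) (hb : 0 < b) : ∀ᶠ η in 𝓝[>] (0 : ℝ), η < b := by
  simpa using ev_small 1 b hb

lemma mem_span_of_ori {a b z : ℝ × ℝ} (hab : a ≠ b) (h : ori a b z = 0) :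
    z ∈ affineSpan ℝ ({a, b} : Set (ℝ × ℝ)) :=
  (collinear_of_ori_eq_zero hab h).mem_affineSpan_of_mem_of_ne (by simp) (by simp) (by simp) hab

lemma ori_of_mem_span {a b z : ℝ × ℝ} (h : z ∈ affineSpan ℝ ({a, b} : Set (ℝ × ℝ))) :
    ori a b z = 0 := by
  apply ori_eq_zero_of_collinear
  have := collinear_insert_of_mem_affineSpan_pair h
  convert this using 1
  ext x; simp; tauto

/-- consequence of very genericity -/
lemma vg_const {P : Finset (ℝ × ℝ)} (hP : VeryGeneric P) {p a b c d : ℝ × ℝ}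
    (hp : p ∈ P) (ha : a ∈ P) (hb : b ∈ P) (hc : c ∈ P) (hd : d ∈ P) (hab : a.1 < b.1)
    (hcd : c.1 < d.1) (hpa : p ≠ a) (hpb : p ≠ b) (hne : ¬ (a = c ∧ b = d)) :
    (d.1 - c.1) * ori a b p ≠ (b.1 - a.1) * ori c d p := by
  intro hk
  have hab' : a ≠ b := by rintro rfl; exact lt_irrefl _ hab
  have hcd' : c ≠ d := by rintro rfl; exact lt_irrefl _ hcd
  have hg := (genPos_iff P).1 hP.1
  let y := a.2 + (b.2 - a.2) * (p.1 - a.1) / (b.1 - a.1)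
  have hα : b.1 - a.1 ≠ 0 := by linarith
  have e1 : ori a b (p.1, y) = 0 := by
    simp only [ori, y]; field_simp; ring
  have e2 : ori c d (p.1, y) = 0 := by
    have : (b.1 - a.1) * ori c d (p.1, y) = (d.1 - c.1) * ori a b (p.1, y) := by
      unfold ori at *; simp only at *; linarith
    rw [e1, mul_zero] at this
    exact (mul_eq_zero.1 this).resolve_left hα
  have hspan : affineSpan ℝ ({a, b} : Set (ℝ × ℝ)) ≠ affineSpan ℝ ({c, d} : Set (ℝ × ℝ)) := by
    intro h
    have hc' : ori a b c = 0 := ori_of_mem_span (h ▸ left_mem_affineSpan_pair ℝ c d)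
    have hd' : ori a b d = 0 := ori_of_mem_span (h ▸ right_mem_affineSpan_pair ℝ c d)
    have hc2 : c = a ∨ c = b := by
      by_contra hn
      push Not at hn
      exact hg a ha b hb c hc hab' (Ne.symm hn.1) (Ne.symm hn.2) hc'
    have hd2 : d = a ∨ d = b := by
      by_contra hn
      push Not at hn
      exact hg a ha b hb d hd hab' (Ne.symm hn.1) (Ne.symm hn.2) hd'
    rcases hc2 with rfl | rfl <;> rcases hd2 with rfl | rfl
    · exact hcd' rfl
    · exact hne ⟨rfl, rfl⟩
    · linarith
    · exact hcd' rfl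
  have hz : ((p.1, y) : ℝ × ℝ) = p := hP.2 (Or.inr ⟨a, ha, b, hb, c, hc, d, hd, hab', hcd', hspan,
    mem_span_of_ori hab' e1, mem_span_of_ori hcd' e2⟩) (Or.inl hp) rfl
  rw [hz] at e1
  exact hg a ha b hb p hp hab' hpa.symm hpb.symm e1

/-- local separation constant -/
lemma exists_sep {P : Finset (ℝ × ℝ)} (hP : VeryGeneric P) :
    ∃ g > 0, ∀ p ∈ P, ∀ a ∈ P, ∀ b ∈ P, ∀ c ∈ P, ∀ d ∈ P, a.1 < b.1 → c.1 < d.1 → p ≠ a →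
      p ≠ b → p ≠ c → p ≠ d → ∀ y : ℝ, |ori a b (p.1, y)| < g → |ori c d (p.1, y)| < g →
        a = c ∧ b = d := by
  have h : ∀ᶠ g in 𝓝[>] (0 : ℝ), ∀ p ∈ P, ∀ a ∈ P, ∀ b ∈ P, ∀ c ∈ P, ∀ d ∈ P, a.1 < b.1 →
      c.1 < d.1 → p ≠ a → p ≠ b → p ≠ c → p ≠ d → ∀ y : ℝ, |ori a b (p.1, y)| < g →
      |ori c d (p.1, y)| < g → a = c ∧ b = d := by
    rw [eventually_all_finset]; intro p hp
    rw [eventually_all_finset]; intro a ha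
    rw [eventually_all_finset]; intro b hb
    rw [eventually_all_finset]; intro c hc
    rw [eventually_all_finset]; intro d hd
    by_cases hab : a.1 < b.1
    swap
    · exact Eventually.of_forall fun _ h => absurd h hab
    by_cases hcd : c.1 < d.1
    swap
    · exact Eventually.of_forall fun _ _ h => absurd h hcd
    by_cases hpa : p ≠ a
    swap
    · exact Eventually.of_forall fun _ _ _ h => absurd h hpa
    by_cases hpb : p ≠ b
    swap
    · exact Eventually.of_forall fun _ _ _ _ h => absurd h hpb
    by_cases hne : a = c ∧ b = d
    · exact Eventually.of_forall fun _ _ _ _ _ _ _ _ _ _ => hne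
    have hk := vg_const hP hp ha hb hc hd hab hcd hpa hpb hne
    have hk' : 0 < |(d.1 - c.1) * ori a b p - (b.1 - a.1) * ori c d p| :=
      abs_pos.2 (sub_ne_zero.2 hk)
    filter_upwards [ev_small ((d.1 - c.1) + (b.1 - a.1)) _ hk'] with g hg _ _ _ _ _ _ y h1 h2
    exfalso
    have e : (d.1 - c.1) * ori a b p - (b.1 - a.1) * ori c d p =
        (d.1 - c.1) * ori a b (p.1, y) - (b.1 - a.1) * ori c d (p.1, y) := by
      unfold ori; simp only; ring
    rw [e] at hg
    have e1 : |(d.1 - c.1) * ori a b (p.1, y) - (b.1 - a.1) * ori c d (p.1, y)| ≤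
        (d.1 - c.1) * |ori a b (p.1, y)| + (b.1 - a.1) * |ori c d (p.1, y)| := by
      refine (abs_sub _ _).trans ?_
      rw [abs_mul, abs_mul, abs_of_pos (sub_pos.2 hab), abs_of_pos (sub_pos.2 hcd)]
    have e2 := mul_le_mul_of_nonneg_left h1.le (sub_pos.2 hcd).le
    have e3 := mul_le_mul_of_nonneg_left h2.le (sub_pos.2 hab).le
    linarith
  obtain ⟨g, h1, h2⟩ := (h.and self_mem_nhdsWithin).exists
  exact ⟨g, h2, h1⟩

lemma exists_gap {P : Finset (ℝ × ℝ)} (hP : XInj P) :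
    ∃ γ > 0, ∀ p ∈ P, ∀ a ∈ P, p ≠ a → γ < |p.1 - a.1| := by
  have h : ∀ᶠ γ in 𝓝[>] (0 : ℝ), ∀ p ∈ P, ∀ a ∈ P, p ≠ a → γ < |p.1 - a.1| := by
    rw [eventually_all_finset]; intro p hp
    rw [eventually_all_finset]; intro a ha
    by_cases hne : p ≠ a
    swap
    · exact Eventually.of_forall fun _ h => absurd h hne
    have : 0 < |p.1 - a.1| := abs_pos.2 (sub_ne_zero.2 fun h => hne (hP hp ha h))
    filter_upwards [ev_lt _ this] with γ h _ using h
  obtain ⟨g, h1, h2⟩ := (h.and self_mem_nhdsWithin).exists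
  exact ⟨g, h2, h1⟩

/-- `x + e` and `x + e'` have the same sign if the errors are small -/
lemma same_sign_err {x e e' γ : ℝ} (hx : γ ≤ |x|) (he : |e| < γ) (he' : |e'| < γ) :
    0 < (x + e) * (x + e') := by
  rw [abs_lt] at he he'
  rcases abs_cases x with ⟨h, _⟩ | ⟨h, _⟩ <;> rw [h] at hx
  · exact mul_pos (by linarith) (by linarith)
  · exact mul_pos_of_neg_of_neg (by linarith) (by linarith)

lemma abs_mul_le' {x y X Y : ℝ} (hx : |x| ≤ X) (hy : |y| ≤ Y) : |x * y| ≤ X * Y := by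
  rw [abs_mul]
  exact mul_le_mul hx hy (abs_nonneg _) ((abs_nonneg _).trans hx)

/-- Perturbation of a point that is almost vertically above or below a point of `P`. -/
lemma lemV {P : Finset (ℝ × ℝ)} (hP : VeryGeneric P) (K : ℝ) (hK0 : 0 < K)
    (hK : ∀ p ∈ P, |p.1| ≤ K ∧ |p.2| ≤ K) :
    ∃ η > 0, ∀ q : ℝ × ℝ, |q.1| ≤ K → |q.2| ≤ K → q ∉ P →
      (∀ a ∈ P, ∀ b ∈ P, a.1 < b.1 → ori a b q ≠ 0) → ∀ p0 ∈ P,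
      |q.1 - p0.1| ≤ η * |q.2 - p0.2| →
      (∀ p ∈ P, p ≠ p0 → ¬ |q.1 - p.1| ≤ η * |q.2 - p.2|) ∧
      ∀ s : ℝ, |s| = 1 → ∃ q' : ℝ × ℝ, 0 < s * (q'.1 - p0.1) ∧
        (∀ p ∈ P, p ≠ p0 → 0 < (q.1 - p.1) * (q'.1 - p.1)) ∧
        ∀ a ∈ P, ∀ b ∈ P, a.1 < b.1 → 0 < ori a b q * ori a b q' := by
  have hxi : XInj P := hP.2.mono Set.subset_union_left
  obtain ⟨g, hg0, hg⟩ := exists_sep hP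
  obtain ⟨γ, hγ0, hγ⟩ := exists_gap hxi
  obtain ⟨L, hL⟩ : ∃ L, L = 2 * K := ⟨_, rfl⟩
  have hL0 : 0 < L := by linarith
  obtain ⟨S, hS⟩ : ∃ S, S = L / γ := ⟨_, rfl⟩
  have hS0 : 0 ≤ S := by rw [hS]; positivity
  have hdiff : ∀ x y : ℝ, |x| ≤ K → |y| ≤ K → |x - y| ≤ L := by
    intro x y hx hy
    refine (abs_sub _ _).trans ?_
    linarith
  obtain ⟨W, hW⟩ : ∃ W, W = 2 * L * S + 3 * L := ⟨_, rfl⟩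
  have hWL : 3 * L ≤ W := by rw [hW]; nlinarith [mul_nonneg hL0.le hS0]
  obtain ⟨η, ⟨hη1, hη2⟩, hη0⟩ :=
    (((ev_small W γ hγ0).and (ev_small (W * L) g hg0)).and self_mem_nhdsWithin).exists
  have hη0 : 0 < η := hη0
  have hη3 : 3 * L * η < γ := lt_of_le_of_lt (mul_le_mul_of_nonneg_right hWL hη0.le) hη1
  refine ⟨η, hη0, ?_⟩
  intro q hq1 hq2 hqP hgen p0 hp0 hst
  obtain ⟨X, hX⟩ : ∃ X, X = q.1 - p0.1 := ⟨_, rfl⟩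
  obtain ⟨d, hd⟩ : ∃ d, d = q.2 - p0.2 := ⟨_, rfl⟩
  rw [← hX, ← hd] at hst
  have hdL : |d| ≤ L := by rw [hd]; exact hdiff _ _ hq2 (hK p0 hp0).2
  have hd0 : 0 < |d| := by
    rw [abs_pos]
    intro h0
    rw [h0, abs_zero, mul_zero] at hst
    have hx0 : X = 0 := abs_eq_zero.1 (le_antisymm hst (abs_nonneg _))
    apply hqP
    have : q = p0 := Prod.ext (by linarith) (by linarith)
    rwa [this]
  have hXL : |X| ≤ η * L := hst.trans (mul_le_mul_of_nonneg_left hdL hη0.le)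
  constructor
  · intro p hp hne hst'
    have h1 : |q.2 - p.2| ≤ L := hdiff _ _ hq2 (hK p hp).2
    have h2 := hγ p hp p0 hp0 hne
    have h3 : |p.1 - p0.1| ≤ |X| + |q.1 - p.1| := by
      have : p.1 - p0.1 = X - (q.1 - p.1) := by rw [hX]; ring
      rw [this]; exact abs_sub _ _
    have h4 := mul_le_mul_of_nonneg_left h1 hη0.le
    have h5 : 0 < η * L := mul_pos hη0 hL0
    linarith
  intro s hs
  obtain ⟨m, hm, hmab⟩ : ∃ m : ℝ, |m| ≤ S ∧ ∀ a ∈ P, ∀ b ∈ P, a.1 < b.1 → p0 ≠ a → p0 ≠ b →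
      (b.1 - a.1) * m = b.2 - a.2 ∨ g ≤ |ori a b (p0.1, q.2)| := by
    by_cases hex : ∃ a ∈ P, ∃ b ∈ P, a.1 < b.1 ∧ p0 ≠ a ∧ p0 ≠ b ∧ |ori a b (p0.1, q.2)| < g
    · obtain ⟨a, ha, b, hb, hab, h1, h2, h3⟩ := hex
      have hpos : 0 < b.1 - a.1 := by linarith
      refine ⟨(b.2 - a.2) / (b.1 - a.1), ?_, ?_⟩
      · rw [abs_div, hS]
        have e1 := hγ b hb a ha (by rintro rfl; exact lt_irrefl _ hab)
        exact div_le_div₀ hL0.le (hdiff _ _ (hK b hb).2 (hK a ha).2) hγ0 e1.le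
      · intro a' ha' b' hb' hab' h1' h2'
        by_cases hlt : |ori a' b' (p0.1, q.2)| < g
        · left
          obtain ⟨rfl, rfl⟩ := hg p0 hp0 a ha b hb a' ha' b' hb' hab hab' h1 h2 h1' h2' q.2 h3 hlt
          field_simp
        · right; exact not_lt.1 hlt
    · push Not at hex
      exact ⟨0, by simpa using hS0, fun a ha b hb hab h1 h2 => Or.inr (hex a ha b hb hab h1 h2)⟩
  obtain ⟨T, hT⟩ : ∃ T, T = 2 * η * |d| * s := ⟨_, rfl⟩
  have hTabs : |T| = 2 * η * |d| := by
    rw [hT, abs_mul, hs, mul_one, abs_of_pos (by positivity)]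
  have hXT : |X + T| ≤ 3 * η * |d| := by
    refine (abs_add_le _ _).trans ?_
    rw [hTabs]; linarith
  have hmono : ∀ c, 0 ≤ c → c * |d| ≤ c * L := fun c hc => mul_le_mul_of_nonneg_left hdL hc
  have hXTL : |X + T| < γ := by
    have := hmono (3 * η) (by positivity)
    linarith
  have hXγ : |X| < γ := by
    have : 0 < η * L := mul_pos hη0 hL0
    linarith
  refine ⟨(q.1 + T, q.2 + m * T), ?_, ?_, ?_⟩
  · have hsX : - |X| ≤ s * X := by
      have := neg_abs_le (s * X)
      rwa [abs_mul, hs, one_mul] at this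
    have hss : s * s = 1 := by
      rw [← abs_mul_abs_self s, hs, one_mul]
    have e : s * (q.1 + T - p0.1) = s * X + 2 * η * |d| * (s * s) := by rw [hX, hT]; ring
    show 0 < s * (q.1 + T - p0.1)
    rw [e, hss]
    have : 0 < η * |d| := mul_pos hη0 hd0
    linarith
  · intro p hp hne
    have := same_sign_err (x := p0.1 - p.1) (hγ p0 hp0 p hp hne.symm).le hXγ hXTL
    have e1 : q.1 - p.1 = p0.1 - p.1 + X := by rw [hX]; ring
    have e2 : q.1 + T - p.1 = p0.1 - p.1 + (X + T) := by rw [hX]; ring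
    show 0 < (q.1 - p.1) * (q.1 + T - p.1)
    rw [e1, e2]; exact this
  · -- pairs through `p0`
    have hthru : ∀ b ∈ P, b ≠ p0 → 0 < ori p0 b q * ori p0 b (q.1 + T, q.2 + m * T) := by
      intro b hb hne
      have hb1 : |b.1 - p0.1| ≤ L := hdiff _ _ (hK b hb).1 (hK p0 hp0).1
      have hb2 : |b.2 - p0.2| ≤ L := hdiff _ _ (hK b hb).2 (hK p0 hp0).2
      have e1 : ori p0 b q = (b.1 - p0.1) * d + (-((b.2 - p0.2) * X)) := by
        rw [hX, hd]; unfold ori; ring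
      have e2 : ori p0 b (q.1 + T, q.2 + m * T) = (b.1 - p0.1) * d +
          ((b.1 - p0.1) * (m * T) - (b.2 - p0.2) * (X + T)) := by
        rw [hX, hd]; unfold ori; ring
      rw [e1, e2]
      apply same_sign_err (γ := γ * |d|)
      · rw [abs_mul]
        exact mul_le_mul_of_nonneg_right (hγ b hb p0 hp0 hne).le (abs_nonneg _)
      · rw [abs_neg]
        have := abs_mul_le' hb2 hst
        have h3 := mul_lt_mul_of_pos_right hη3 hd0
        have : 0 < L * η * |d| := by positivity
        linarith
      · have h1 := abs_mul_le' hb1 (abs_mul_le' hm hTabs.le)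
        have h2 := abs_mul_le' hb2 hXT
        have h3 := mul_lt_mul_of_pos_right hη1 hd0
        rw [hW] at h3
        have h4 := abs_sub ((b.1 - p0.1) * (m * T)) ((b.2 - p0.2) * (X + T))
        linarith
    intro a ha b hb hab
    by_cases hpa : p0 = a
    · rw [← hpa]
      exact hthru b hb (by rintro rfl; rw [hpa] at hab; exact lt_irrefl _ hab)
    by_cases hpb : p0 = b
    · rw [← hpb, ori_swap', ori_swap' (c := (q.1 + T, q.2 + m * T)), neg_mul_neg]
      exact hthru a ha (Ne.symm hpa)
    rcases hmab a ha b hb hab hpa hpb with h | h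
    · have e : ori a b (q.1 + T, q.2 + m * T) = ori a b q := by
        have : ori a b (q.1 + T, q.2 + m * T) - ori a b q = T * ((b.1 - a.1) * m - (b.2 - a.2)) := by
          unfold ori; ring
        rw [h, sub_self, mul_zero] at this
        linarith
      rw [e]
      exact mul_self_pos.2 (hgen a ha b hb hab)
    · have hb1 : |b.1 - a.1| ≤ L := hdiff _ _ (hK b hb).1 (hK a ha).1
      have hb2 : |b.2 - a.2| ≤ L := hdiff _ _ (hK b hb).2 (hK a ha).2
      have e1 : ori a b q = ori a b (p0.1, q.2) + (-((b.2 - a.2) * X)) := by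
        rw [hX]; unfold ori; ring
      have e2 : ori a b (q.1 + T, q.2 + m * T) = ori a b (p0.1, q.2) +
          ((b.1 - a.1) * (m * T) - (b.2 - a.2) * (X + T)) := by
        rw [hX]; unfold ori; ring
      rw [e1, e2]
      have hwl : 3 * L * L * η ≤ W * L * η := by
        have := mul_le_mul_of_nonneg_right hWL (mul_pos hL0 hη0).le
        linarith
      have hp : 0 < L * L * η := by positivity
      apply same_sign_err h
      · rw [abs_neg]
        have := abs_mul_le' hb2 hXL
        linarith
      · have h1 := abs_mul_le' hb1 (abs_mul_le' hm (hTabs.le.trans (hmono (2 * η) (by positivity))))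
        have h2 := abs_mul_le' hb2 (hXT.trans (hmono (3 * η) (by positivity)))
        rw [hW] at hη2
        have h4 := abs_sub ((b.1 - a.1) * (m * T)) ((b.2 - a.2) * (X + T))
        linarith


open Filter Topology

/-- The affine map placing the `i`-th cluster. -/
noncomputable def phi (ε : ℝ) (i : ℕ) (p : ℝ × ℝ) : ℝ × ℝ :=
  ((i : ℝ) ^ 2 + ε * p.1, (i : ℝ) + ε ^ 2 * p.2)

/-- Inverse of `phi`. -/
noncomputable def psi (ε : ℝ) (i : ℕ) (p : ℝ × ℝ) : ℝ × ℝ :=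
  ((p.1 - (i : ℝ) ^ 2) / ε, (p.2 - (i : ℝ)) / ε ^ 2)

lemma phi_psi {ε : ℝ} (hε : 0 < ε) (i : ℕ) (p : ℝ × ℝ) : phi ε i (psi ε i p) = p := by
  ext <;> simp only [phi, psi] <;> field_simp <;> ring

lemma phi_inj {ε : ℝ} (hε : 0 < ε) (i : ℕ) : Function.Injective (phi ε i) := by
  intro p q h
  simp only [phi, Prod.mk.injEq, add_right_inj] at h
  exact Prod.ext (mul_left_cancel₀ hε.ne' h.1) (mul_left_cancel₀ (pow_pos hε 2).ne' h.2)

lemma phi_lt {ε : ℝ} (hε : 0 < ε) (i : ℕ) {p q : ℝ × ℝ} :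
    (phi ε i p).1 < (phi ε i q).1 ↔ p.1 < q.1 := by
  simp only [phi, add_lt_add_iff_left]
  exact mul_lt_mul_iff_right₀ hε

lemma phi_eq {ε : ℝ} (hε : 0 < ε) (i : ℕ) {p q : ℝ × ℝ} :
    (phi ε i p).1 = (phi ε i q).1 ↔ p.1 = q.1 := by
  simp only [phi, add_right_inj]
  exact ⟨fun h => mul_left_cancel₀ hε.ne' h, fun h => by rw [h]⟩

lemma ori_phi (ε : ℝ) (i : ℕ) (a b c : ℝ × ℝ) :
    ori (phi ε i a) (phi ε i b) (phi ε i c) = ε ^ 3 * ori a b c := by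
  simp only [ori, phi]; ring

lemma ori_phi_pos {ε : ℝ} (hε : 0 < ε) (i : ℕ) {a b c : ℝ × ℝ} :
    0 < ori (phi ε i a) (phi ε i b) (phi ε i c) ↔ 0 < ori a b c := by
  rw [ori_phi]; exact mul_pos_iff_of_pos_left (pow_pos hε 3)

lemma ori_phi_neg {ε : ℝ} (hε : 0 < ε) (i : ℕ) {a b c : ℝ × ℝ} :
    ori (phi ε i a) (phi ε i b) (phi ε i c) < 0 ↔ ori a b c < 0 := by
  rw [ori_phi]
  constructor
  · intro h
    by_contra hn
    have := mul_nonneg (pow_pos hε 3).le (not_lt.1 hn)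
    linarith
  · exact mul_neg_of_pos_of_neg (pow_pos hε 3)

lemma cupSet_phi {ε : ℝ} (hε : 0 < ε) (i : ℕ) {C : Finset (ℝ × ℝ)} :
    CupSet (C.image (phi ε i)) ↔ CupSet C := by
  simp only [CupSet, Finset.forall_mem_image, phi_lt hε, ori_phi_pos hε]

lemma capSet_phi {ε : ℝ} (hε : 0 < ε) (i : ℕ) {C : Finset (ℝ × ℝ)} :
    CapSet (C.image (phi ε i)) ↔ CapSet C := by
  simp only [CapSet, Finset.forall_mem_image, phi_lt hε, ori_phi_neg hε]

lemma xInj_phi {ε : ℝ} (hε : 0 < ε) (i : ℕ) {C : Finset (ℝ × ℝ)} :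
    XInj (C.image (phi ε i)) ↔ XInj C := by
  simp only [XInj, Set.InjOn, Finset.mem_coe, Finset.forall_mem_image, phi_eq hε,
    (phi_inj hε i).eq_iff]

lemma genPos_phi {ε : ℝ} (hε : 0 < ε) (i : ℕ) {C : Finset (ℝ × ℝ)} :
    GenPos (C.image (phi ε i)) ↔ GenPos C := by
  have : ∀ a b c, ori (phi ε i a) (phi ε i b) (phi ε i c) = 0 ↔ ori a b c = 0 := by
    intro a b c
    rw [ori_phi, mul_eq_zero]
    exact ⟨fun h => h.resolve_left (pow_pos hε 3).ne', Or.inr⟩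
  simp only [genPos_iff, Finset.forall_mem_image, (phi_inj hε i).ne_iff, ne_eq, this,
    (phi_inj hε i).eq_iff]

lemma generic_phi {ε : ℝ} (hε : 0 < ε) (i : ℕ) {C : Finset (ℝ × ℝ)} :
    Generic (C.image (phi ε i)) ↔ Generic C :=
  and_congr (genPos_phi hε i) (xInj_phi hε i)

lemma hasCup_phi {ε : ℝ} (hε : 0 < ε) (i : ℕ) {P : Finset (ℝ × ℝ)} {k : ℕ} :
    HasCup (P.image (phi ε i)) k ↔ HasCup P k := by
  rw [hasCup_iff, hasCup_iff]
  constructor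
  · rintro ⟨C, h1, h2, h3, h4⟩
    obtain ⟨D, hD, rfl⟩ := Finset.subset_image_iff.1 h1
    rw [Finset.card_image_of_injective _ (phi_inj hε i)] at h2
    exact ⟨D, by exact_mod_cast hD, h2, (xInj_phi hε i).1 h3, (cupSet_phi hε i).1 h4⟩
  · rintro ⟨C, h1, h2, h3, h4⟩
    exact ⟨C.image (phi ε i), Finset.image_subset_image h1,
      by rw [Finset.card_image_of_injective _ (phi_inj hε i), h2], (xInj_phi hε i).2 h3,
      (cupSet_phi hε i).2 h4⟩

lemma hasCap_phi {ε : ℝ} (hε : 0 < ε) (i : ℕ) {P : Finset (ℝ × ℝ)} {k : ℕ} :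
    HasCap (P.image (phi ε i)) k ↔ HasCap P k := by
  rw [hasCap_iff, hasCap_iff]
  constructor
  · rintro ⟨C, h1, h2, h3, h4⟩
    obtain ⟨D, hD, rfl⟩ := Finset.subset_image_iff.1 h1
    rw [Finset.card_image_of_injective _ (phi_inj hε i)] at h2
    exact ⟨D, by exact_mod_cast hD, h2, (xInj_phi hε i).1 h3, (capSet_phi hε i).1 h4⟩
  · rintro ⟨C, h1, h2, h3, h4⟩
    exact ⟨C.image (phi ε i), Finset.image_subset_image h1,
      by rw [Finset.card_image_of_injective _ (phi_inj hε i), h2], (xInj_phi hε i).2 h3,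
      (capSet_phi hε i).2 h4⟩

lemma sat_phi {ε : ℝ} (hε : 0 < ε) (i : ℕ) {P : Finset (ℝ × ℝ)} {k l : ℕ}
    (h : CupCapSat P k l) : CupCapSat (P.image (phi ε i)) k l := by
  refine ⟨(generic_phi hε i).2 h.1, ⟨?_, ?_⟩, ?_⟩
  · rw [hasCup_phi hε]; exact h.2.1.1
  · rw [hasCap_phi hε]; exact h.2.1.2
  · intro q hq hg
    obtain ⟨r, rfl⟩ : ∃ r, q = phi ε i r := ⟨_, (phi_psi hε i q).symm⟩
    rw [← Finset.image_insert] at hg ⊢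
    rw [hasCup_phi hε, hasCap_phi hε]
    rw [generic_phi hε] at hg
    refine h.2.2 r (fun hr => hq (Finset.mem_image_of_mem _ hr)) hg

/-- A box. -/
def InBox (K : ℝ) (p : ℝ × ℝ) : Prop := |p.1| ≤ K ∧ |p.2| ≤ K

lemma prod_err {A B x y N δ : ℝ} (hA : |A| ≤ N) (hB : |B| ≤ N) (hx : |x| ≤ δ) (hy : |y| ≤ δ) :
    |(A + x) * (B + y) - A * B| ≤ 2 * N * δ + δ * δ := by
  have e : (A + x) * (B + y) - A * B = A * y + x * B + x * y := by ring
  rw [e]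
  have h1 := abs_mul_le' hA hy
  have h2 := abs_mul_le' hx hB
  have h3 := abs_mul_le' hx hy
  have h4 := abs_add_le (A * y + x * B) (x * y)
  have h5 := abs_add_le (A * y) (x * B)
  linarith

lemma box_err1 {ε K : ℝ} (hε : 0 < ε) {x y : ℝ} (hx : |x| ≤ K) (hy : |y| ≤ K) :
    |ε * (x - y)| ≤ 2 * K * ε := by
  have h := abs_sub x y
  rw [abs_mul, abs_of_pos hε]
  have := mul_le_mul_of_nonneg_left (show |x - y| ≤ 2 * K by linarith) hε.le
  linarith

lemma box_err2 {ε K : ℝ} (hε : 0 < ε) (hε1 : ε ≤ 1) {x y : ℝ} (hx : |x| ≤ K) (hy : |y| ≤ K) :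
    |ε ^ 2 * (x - y)| ≤ 2 * K * ε := by
  have h := box_err1 hε hx hy
  have : ε ^ 2 * (x - y) = ε * (ε * (x - y)) := by ring
  rw [this, abs_mul, abs_of_pos hε]
  calc ε * |ε * (x - y)| ≤ 1 * |ε * (x - y)| := mul_le_mul_of_nonneg_right hε1 (abs_nonneg _)
    _ ≤ _ := by rw [one_mul]; exact h

lemma nat_bounds {n i k : ℕ} (hi : i < n) (hk : k < n) :
    |(k : ℝ) ^ 2 - (i : ℝ) ^ 2| ≤ (n : ℝ) ^ 2 ∧ |(k : ℝ) - i| ≤ (n : ℝ) ^ 2 := by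
  have h1 : (i : ℝ) + 1 ≤ n := by exact_mod_cast hi
  have h2 : (k : ℝ) + 1 ≤ n := by exact_mod_cast hk
  have h3 : (0 : ℝ) ≤ i := Nat.cast_nonneg _
  have h4 : (0 : ℝ) ≤ k := Nat.cast_nonneg _
  constructor
  · rw [abs_le]; constructor <;> nlinarith
  · rw [abs_le]; constructor <;> nlinarith

/-- `E1` -/
lemma est1 {n : ℕ} {K ε : ℝ} (hε : 0 < ε) (hε1 : ε ≤ 1)
    (hd : 2 * K * ε ≤ 1) (hd2 : 2 * (2 * (n : ℝ) ^ 2 + 1) * (2 * K * ε) < 1) {i j k : ℕ}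
    (hij : i < j) (hjk : j < k) (hk : k < n) {u v w : ℝ × ℝ} (hu : InBox K u) (hv : InBox K v)
    (hw : InBox K w) : ori (phi ε i u) (phi ε j v) (phi ε k w) < 0 := by
  have b1 := prod_err (nat_bounds (by omega : i < n) (by omega : j < n)).1
    (nat_bounds (by omega : i < n) hk).2 (box_err1 hε hv.1 hu.1) (box_err2 hε hε1 hw.2 hu.2)
  have b2 := prod_err (nat_bounds (by omega : i < n) (by omega : j < n)).2
    (nat_bounds (by omega : i < n) hk).1 (box_err2 hε hε1 hv.2 hu.2) (box_err1 hε hw.1 hu.1)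
  have hδ : 0 ≤ 2 * K * ε := by
    have := (abs_nonneg _).trans hu.1
    positivity
  have e : ori (phi ε i u) (phi ε j v) (phi ε k w) =
      (((j : ℝ) ^ 2 - (i : ℝ) ^ 2 + ε * (v.1 - u.1)) * ((k : ℝ) - i + ε ^ 2 * (w.2 - u.2)) -
        ((j : ℝ) ^ 2 - (i : ℝ) ^ 2) * ((k : ℝ) - i)) -
      (((j : ℝ) - i + ε ^ 2 * (v.2 - u.2)) * ((k : ℝ) ^ 2 - (i : ℝ) ^ 2 + ε * (w.1 - u.1)) -
        ((j : ℝ) - i) * ((k : ℝ) ^ 2 - (i : ℝ) ^ 2)) -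
      ((j : ℝ) - i) * ((k : ℝ) - i) * ((k : ℝ) - j) := by
    simp only [ori, phi]; ring
  have h1 : (i : ℝ) + 1 ≤ j := by exact_mod_cast hij
  have h2 : (j : ℝ) + 1 ≤ k := by exact_mod_cast hjk
  have h3 : 1 ≤ ((j : ℝ) - i) * ((k : ℝ) - i) * ((k : ℝ) - j) := by
    have := one_le_mul_of_one_le_of_one_le (by linarith : 1 ≤ (j : ℝ) - i)
      (by linarith : 1 ≤ (k : ℝ) - i)
    exact one_le_mul_of_one_le_of_one_le this (by linarith)
  have h4 : (2 * K * ε) * (2 * K * ε) ≤ 2 * K * ε := by nlinarith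
  rw [abs_le] at b1 b2
  rw [e]
  linarith [b1.2, b2.1]

/-- `E4` -/
lemma est4 {n : ℕ} {K ε : ℝ} (hε : 0 < ε) (hε1 : ε ≤ 1)
    (hd : 2 * K * ε ≤ 1 / 2) {i j : ℕ} (hij : i ≠ j) (hi : i < n) (hj : j < n) {p w : ℝ × ℝ}
    (hp : InBox K p) (hw : InBox K w) (q : ℝ × ℝ)
    (h : ((j : ℝ) - i) * (q.1 - p.1) * ori (phi ε i p) (phi ε i q) (phi ε j w) ≤ 0) :
    |q.1 - p.1| ≤ 2 * ((n : ℝ) ^ 2 + 1) * ε * |q.2 - p.2| := by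
  obtain ⟨X, hX⟩ : ∃ X, X = q.1 - p.1 := ⟨_, rfl⟩
  obtain ⟨Y, hY⟩ : ∃ Y, Y = q.2 - p.2 := ⟨_, rfl⟩
  obtain ⟨D, hD⟩ : ∃ D, D = (j : ℝ) - i := ⟨_, rfl⟩
  obtain ⟨E, hE⟩ : ∃ E, E = (j : ℝ) ^ 2 - (i : ℝ) ^ 2 := ⟨_, rfl⟩
  obtain ⟨x, hx⟩ : ∃ x, x = ε ^ 2 * (w.2 - p.2) := ⟨_, rfl⟩
  obtain ⟨y, hy⟩ : ∃ y, y = ε * (w.1 - p.1) := ⟨_, rfl⟩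
  have e : ori (phi ε i p) (phi ε i q) (phi ε j w) = ε * (X * (D + x) - ε * (Y * (E + y))) := by
    rw [hX, hY, hD, hE, hx, hy]; simp only [ori, phi]; ring
  rw [e, ← hX, ← hD] at h
  rw [← hX, ← hY]
  have hD1 : 1 ≤ |D| := by
    rw [hD]
    rcases lt_or_gt_of_ne hij with h | h
    · have h1 : (i : ℝ) + 1 ≤ j := by exact_mod_cast h
      rw [abs_of_pos] <;> linarith
    · have h1 : (j : ℝ) + 1 ≤ i := by exact_mod_cast h
      rw [abs_of_neg] <;> linarith
  have hx1 : |x| ≤ 1 / 2 := by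
    rw [hx]; exact (box_err2 hε hε1 hw.2 hp.2).trans hd
  have hy1 : |E + y| ≤ (n : ℝ) ^ 2 + 1 := by
    have h1 := (box_err1 hε hw.1 hp.1).trans hd
    have h2 := (nat_bounds hi hj).1
    rw [← hy] at h1
    rw [← hE] at h2
    have := abs_add_le E y
    linarith
  have hDx : |D| / 2 ≤ D * (D + x) := by
    have h1 : D * D = |D| * |D| := (abs_mul_abs_self D).symm
    have h2 : -(|D| * (1 / 2)) ≤ D * x := by
      have := neg_abs_le (D * x)
      have h3 := abs_mul_le' (le_refl |D|) hx1
      linarith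
    have h3 : D * (D + x) = |D| * |D| + D * x := by rw [← h1]; ring
    nlinarith
  by_cases hX0 : X = 0
  · rw [hX0, abs_zero]
    positivity
  have hXp : 0 < |X| := abs_pos.2 hX0
  have h1 : X * X * (D * (D + x)) ≤ ε * (D * X * (Y * (E + y))) := by
    have : ε * (X * X * (D * (D + x)) - ε * (D * X * (Y * (E + y)))) ≤ 0 := by
      calc _ = D * X * (ε * (X * (D + x) - ε * (Y * (E + y)))) := by ring
        _ ≤ 0 := h
    by_contra hn
    have := mul_pos hε (sub_pos.2 (not_le.1 hn))
    linarith
  have h2 : |X| * |X| * (|D| / 2) ≤ X * X * (D * (D + x)) := by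
    rw [abs_mul_abs_self]
    exact mul_le_mul_of_nonneg_left hDx (mul_self_nonneg _)
  have h3 : ε * (D * X * (Y * (E + y))) ≤ ε * (|D| * |X| * (|Y| * ((n : ℝ) ^ 2 + 1))) := by
    refine mul_le_mul_of_nonneg_left ?_ hε.le
    refine (le_abs_self _).trans ?_
    exact abs_mul_le' (abs_mul _ _).le (abs_mul_le' le_rfl hy1)
  have h4 : (|D| * |X|) * |X| ≤ (|D| * |X|) * (2 * ((n : ℝ) ^ 2 + 1) * ε * |Y|) := by
    linarith
  exact le_of_mul_le_mul_left h4 (mul_pos (by linarith) hXp)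

/-- Points neither above all nor below all lines of `P` lie in a double wedge. -/
lemma rbound (P : Finset (ℝ × ℝ)) : ∃ M : ℝ, 0 < M ∧ ∀ q : ℝ × ℝ, ¬ AboveAll P q →
    ¬ BelowAll P q → |q.2| ≤ M * (|q.1| + 1) := by
  have h : ∀ᶠ M : ℝ in atTop, ∀ a ∈ P, ∀ b ∈ P, a.1 < b.1 →
      |a.2| + |(b.2 - a.2) / (b.1 - a.1)| * (1 + |a.1|) ≤ M := by
    rw [eventually_all_finset]; intro a _
    rw [eventually_all_finset]; intro b _
    filter_upwards [eventually_ge_atTop (|a.2| + |(b.2 - a.2) / (b.1 - a.1)| * (1 + |a.1|))]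
      with M hM _ using hM
  obtain ⟨M, hM, hM0⟩ := (h.and (eventually_gt_atTop 0)).exists
  refine ⟨M, hM0, ?_⟩
  have key : ∀ a ∈ P, ∀ b ∈ P, a.1 < b.1 → ∀ x : ℝ,
      |a.2 + (b.2 - a.2) / (b.1 - a.1) * (x - a.1)| ≤ M * (|x| + 1) := by
    intro a ha b hb hab x
    have h1 := hM a ha b hb hab
    set m := (b.2 - a.2) / (b.1 - a.1)
    have h2 := abs_add_le a.2 (m * (x - a.1))
    have h3 : |m * (x - a.1)| ≤ |m| * (|x| + |a.1|) := by
      rw [abs_mul]; exact mul_le_mul_of_nonneg_left (abs_sub _ _) (abs_nonneg _)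
    have h4 := mul_le_mul_of_nonneg_right h1 (by positivity : 0 ≤ |x| + 1)
    have h5 : 0 ≤ |a.2| * |x| := by positivity
    have h6 : 0 ≤ |m| * |a.1| * |x| := by positivity
    have h7 := abs_nonneg m
    nlinarith
  have eqn : ∀ a b q : ℝ × ℝ, a.1 < b.1 → ori a b q =
      (b.1 - a.1) * (q.2 - (a.2 + (b.2 - a.2) / (b.1 - a.1) * (q.1 - a.1))) := by
    intro a b q hab
    have : b.1 - a.1 ≠ 0 := by linarith
    unfold ori; field_simp; ring
  intro q hA hB
  unfold AboveAll at hA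
  unfold BelowAll at hB
  push Not at hA hB
  obtain ⟨a, ha, b, hb, hab, h1⟩ := hA
  obtain ⟨c, hc, d, hd, hcd, h2⟩ := hB
  rw [eqn _ _ _ hab] at h1
  rw [eqn _ _ _ hcd] at h2
  have k1 := key a ha b hb hab q.1
  have k2 := key c hc d hd hcd q.1
  rw [abs_le] at k1 k2 ⊢
  have j1 := nonpos_of_mul_nonpos_right h1 (sub_pos.2 hab)
  have j2 := nonneg_of_mul_nonneg_right h2 (sub_pos.2 hcd)
  constructor
  · linarith [k2.1]
  · linarith [k1.2]


/-- size of the big box -/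
noncomputable def bigK (K M : ℝ) : ℝ := K + 1 + M * (K + 2)

/-- the steepness constant -/
noncomputable def stp (n : ℕ) (ε : ℝ) : ℝ := 2 * ((n : ℝ) ^ 2 + 1) * ε

/-- All smallness requirements for the construction. -/
structure Setup (n : ℕ) (P : ℕ → Finset (ℝ × ℝ)) (ε K M : ℝ) : Prop where
  hn : 3 ≤ n
  hε : 0 < ε
  hε1 : ε ≤ 1
  hK : 0 < K
  hM : 0 < M
  box : ∀ i, i < n - 1 → ∀ p ∈ P i, InBox K p
  rb : ∀ i, i < n - 1 → ∀ q, ¬ AboveAll (P i) q → ¬ BelowAll (P i) q → |q.2| ≤ M * (|q.1| + 1)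
  d1 : 2 * bigK K M * ε ≤ 1 / 2
  d2 : 2 * (2 * (n : ℝ) ^ 2 + 1) * (2 * bigK K M * ε) < 1
  gap : ∀ i, i < n - 1 → ∀ p ∈ P i, ∀ a ∈ P i, p ≠ a → stp n ε * (2 * bigK K M) < |p.1 - a.1|
  far : stp n ε * (M * (K + 2) + K) < 1
  sat : ∀ i, i < n - 1 → CupCapSat (P i) (i + 2) (n - i)
  lv : ∀ i, i < n - 1 → ∀ q : ℝ × ℝ, InBox (bigK K M) q → q ∉ P i →
      (∀ a ∈ P i, ∀ b ∈ P i, a.1 < b.1 → ori a b q ≠ 0) → ∀ p0 ∈ P i,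
      |q.1 - p0.1| ≤ stp n ε * |q.2 - p0.2| →
      (∀ p ∈ P i, p ≠ p0 → ¬ |q.1 - p.1| ≤ stp n ε * |q.2 - p.2|) ∧
      ∀ s : ℝ, |s| = 1 → ∃ q' : ℝ × ℝ, 0 < s * (q'.1 - p0.1) ∧
        (∀ p ∈ P i, p ≠ p0 → 0 < (q.1 - p.1) * (q'.1 - p.1)) ∧
        ∀ a ∈ P i, ∀ b ∈ P i, a.1 < b.1 → 0 < ori a b q * ori a b q'

/-- the clusters -/
noncomputable def GG (P : ℕ → Finset (ℝ × ℝ)) (ε : ℝ) (i : ℕ) : Finset (ℝ × ℝ) :=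
  (P i).image (phi ε i)

section
variable {n : ℕ} {P : ℕ → Finset (ℝ × ℝ)} {ε K M : ℝ}

lemma mem_GG {i : ℕ} {p : ℝ × ℝ} (hp : p ∈ P i) : phi ε i p ∈ GG P ε i :=
  Finset.mem_image_of_mem _ hp

lemma Setup.stp_pos (S : Setup n P ε K M) : 0 < stp n ε := by
  have := S.hε
  unfold stp; positivity

lemma Setup.K_le (S : Setup n P ε K M) : K ≤ bigK K M := by
  have := mul_pos S.hM (by linarith [S.hK] : 0 < K + 2)
  unfold bigK; linarith

lemma Setup.bbox (S : Setup n P ε K M) {i : ℕ} (hi : i < n - 1) {p : ℝ × ℝ} (hp : p ∈ P i) :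
    InBox (bigK K M) p :=
  ⟨(S.box i hi p hp).1.trans S.K_le, (S.box i hi p hp).2.trans S.K_le⟩

lemma Setup.est1 (S : Setup n P ε K M) {i j k : ℕ} (hij : i < j) (hjk : j < k) (hk : k < n - 1)
    {u v w : ℝ × ℝ} (hu : InBox (bigK K M) u) (hv : InBox (bigK K M) v)
    (hw : InBox (bigK K M) w) : ori (phi ε i u) (phi ε j v) (phi ε k w) < 0 :=
  _root_.est1 S.hε S.hε1 (by linarith [S.d1]) S.d2 hij hjk (by omega) hu hv hw

lemma Setup.steep (S : Setup n P ε K M) {i j : ℕ} (hij : i ≠ j) (hi : i < n - 1) (hj : j < n - 1)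
    {p w : ℝ × ℝ} (hp : p ∈ P i) (hw : InBox (bigK K M) w) (q : ℝ × ℝ)
    (h : ((j : ℝ) - i) * (q.1 - p.1) * ori (phi ε i p) (phi ε i q) (phi ε j w) ≤ 0) :
    |q.1 - p.1| ≤ stp n ε * |q.2 - p.2| :=
  est4 S.hε S.hε1 S.d1 hij (by omega) (by omega) (S.bbox hi hp) hw q h

lemma Setup.steep_up (S : Setup n P ε K M) {i j : ℕ} (hij : i < j) (hj : j < n - 1)
    {p w : ℝ × ℝ} (hp : p ∈ P i) (hw : InBox (bigK K M) w) (q : ℝ × ℝ)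
    (h : (q.1 - p.1) * ori (phi ε i p) (phi ε i q) (phi ε j w) ≤ 0) :
    |q.1 - p.1| ≤ stp n ε * |q.2 - p.2| := by
  apply S.steep hij.ne (by omega) hj hp hw
  have : (0 : ℝ) < (j : ℝ) - i := by
    have : (i : ℝ) < j := by exact_mod_cast hij
    linarith
  rw [mul_assoc]
  exact mul_nonpos_of_nonneg_of_nonpos this.le h

lemma Setup.steep_dn (S : Setup n P ε K M) {i j : ℕ} (hij : j < i) (hi : i < n - 1)
    {p w : ℝ × ℝ} (hp : p ∈ P i) (hw : InBox (bigK K M) w) (q : ℝ × ℝ)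
    (h : 0 ≤ (q.1 - p.1) * ori (phi ε i p) (phi ε i q) (phi ε j w)) :
    |q.1 - p.1| ≤ stp n ε * |q.2 - p.2| := by
  apply S.steep hij.ne' hi (by omega) hp hw
  have : (j : ℝ) - i < 0 := by
    have : (j : ℝ) < i := by exact_mod_cast hij
    linarith
  rw [mul_assoc]
  exact mul_nonpos_of_nonpos_of_nonneg this.le h

lemma Setup.not_steep (S : Setup n P ε K M) {i : ℕ} (hi : i < n - 1) {a b : ℝ × ℝ}
    (ha : a ∈ P i) (hb : b ∈ P i) (hab : a.1 < b.1) :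
    ¬ |b.1 - a.1| ≤ stp n ε * |b.2 - a.2| := by
  intro h
  have h1 := S.gap i hi b hb a ha (fun h => by rw [h] at hab; exact lt_irrefl _ hab)
  have h2 : |b.2 - a.2| ≤ 2 * bigK K M := by
    have := abs_sub b.2 a.2
    linarith [(S.bbox hi ha).2, (S.bbox hi hb).2]
  have := mul_le_mul_of_nonneg_left h2 S.stp_pos.le
  linarith

lemma Setup.pair_up (S : Setup n P ε K M) {i j : ℕ} (hij : i < j) (hj : j < n - 1)
    {a b w : ℝ × ℝ} (ha : a ∈ P i) (hb : b ∈ P i) (hab : a.1 < b.1) (hw : InBox (bigK K M) w) :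
    0 < ori (phi ε i a) (phi ε i b) (phi ε j w) := by
  by_contra h
  refine S.not_steep (by omega) ha hb hab (S.steep_up hij hj ha hw b ?_)
  exact mul_nonpos_of_nonneg_of_nonpos (by linarith) (not_lt.1 h)

lemma Setup.pair_dn (S : Setup n P ε K M) {i j : ℕ} (hij : j < i) (hi : i < n - 1)
    {a b w : ℝ × ℝ} (ha : a ∈ P i) (hb : b ∈ P i) (hab : a.1 < b.1) (hw : InBox (bigK K M) w) :
    ori (phi ε i a) (phi ε i b) (phi ε j w) < 0 := by
  by_contra h
  refine S.not_steep hi ha hb hab (S.steep_dn hij hi ha hw b ?_)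
  exact mul_nonneg (by linarith) (not_lt.1 h)

lemma Setup.mono (S : Setup n P ε K M) : MonoG n (GG P ε) := by
  refine ⟨0, 1, ?_⟩
  intro i k hik hk a ha b hb
  obtain ⟨p, hp, rfl⟩ := Finset.mem_image.1 ha
  obtain ⟨w, hw, rfl⟩ := Finset.mem_image.1 hb
  have h1 := box_err2 S.hε S.hε1 (S.bbox (by omega) hp).2 (S.bbox hk hw).2
  have h2 := (abs_le.1 h1).2
  have h3 := S.d1
  have h4 : (i : ℝ) + 1 ≤ k := by exact_mod_cast hik
  simp only [phi]
  linarith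

lemma Setup.clusters (S : Setup n P ε K M) : Clusters n (GG P ε) where
  xinj i hi := (xInj_phi S.hε i).2 (S.sat i hi).1.2
  disj i j hij hj := by
    obtain ⟨f1, f2, h⟩ := S.mono
    rw [Finset.disjoint_left]
    intro a ha hb
    exact lt_irrefl _ (h i j hij hj a ha a hb)
  up i j hij hj a ha b hb hab c hc := by
    obtain ⟨a, ma, rfl⟩ := Finset.mem_image.1 ha
    obtain ⟨b, mb, rfl⟩ := Finset.mem_image.1 hb
    obtain ⟨c, mc, rfl⟩ := Finset.mem_image.1 hc
    exact S.pair_up hij hj ma mb ((phi_lt S.hε i).1 hab) (S.bbox hj mc)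
  down i j hij hj a ha b hb hab c hc := by
    obtain ⟨a, ma, rfl⟩ := Finset.mem_image.1 ha
    obtain ⟨b, mb, rfl⟩ := Finset.mem_image.1 hb
    obtain ⟨c, mc, rfl⟩ := Finset.mem_image.1 hc
    exact S.pair_dn hij hj ma mb ((phi_lt S.hε j).1 hab) (S.bbox (by omega) mc)
  bulge i j k hij hjk hk a ha b hb c hc := by
    obtain ⟨a, ma, rfl⟩ := Finset.mem_image.1 ha
    obtain ⟨b, mb, rfl⟩ := Finset.mem_image.1 hb
    obtain ⟨c, mc, rfl⟩ := Finset.mem_image.1 hc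
    exact S.est1 hij hjk hk (S.bbox (by omega) ma) (S.bbox (by omega) mb) (S.bbox hk mc)

/-- A companion point with matching signs gives an `n`-gon. -/
lemma Setup.win_match (S : Setup n P ε K M) {m : ℕ} (hm1 : 1 ≤ m) (hm : m + 3 ≤ n)
    {r r' : ℝ × ℝ} (hq : phi ε m r ∉ allPts n (GG P ε)) (hr : InBox (bigK K M) r)
    (hx : ∀ p ∈ P m, p.1 ≠ r'.1)
    (hup : ∀ p ∈ P m, ∀ w ∈ P (m + 1),
      0 < (r'.1 - p.1) * ori (phi ε m p) (phi ε m r) (phi ε (m + 1) w))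
    (hdn : ∀ p ∈ P m, ∀ w ∈ P (m - 1),
      (r'.1 - p.1) * ori (phi ε m p) (phi ε m r) (phi ε (m - 1) w) < 0)
    (ho : ∀ a ∈ P m, ∀ b ∈ P m, a.1 < b.1 → 0 < ori a b r * ori a b r') :
    Win n (GG P ε) (phi ε m r) := by
  have hε := S.hε
  have hsm := S.sat m (by omega)
  have hg : Generic (insert r' (P m)) := generic_insert_s19 hsm.1 hx (by
    intro a ha b hb hab h0
    have := ho a ha b hb hab
    rw [h0] at this; simp at this)
  have hr' : r' ∉ P m := fun h => hx r' h rfl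
  have tpos : ∀ a ∈ P m, ∀ b ∈ P m, a.1 < b.1 → 0 < ori a b r' →
      0 < ori (phi ε m a) (phi ε m b) (phi ε m r) := by
    intro a ha b hb hab h
    rw [ori_phi_pos hε]
    exact pos_of_mul_pos_left (ho a ha b hb hab) h.le
  have tneg : ∀ a ∈ P m, ∀ b ∈ P m, a.1 < b.1 → ori a b r' < 0 →
      ori (phi ε m a) (phi ε m b) (phi ε m r) < 0 := by
    intro a ha b hb hab h
    rw [ori_phi_neg hε]
    by_contra hc
    have := mul_nonpos_of_nonneg_of_nonpos (not_lt.1 hc) h.le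
    linarith [ho a ha b hb hab]
  rcases sat_cases hsm hr' hg with ⟨C, hC, cC, hcup⟩ | ⟨C, hC, cC, hcap⟩
  · obtain ⟨V, hV, cV, hVc⟩ := sat_cap_pred (S.sat (m + 1) (by omega)) (by omega)
    have hmi := Finset.mem_insert_self r' C
    refine win_cup S.clusters (i := m) (by omega) hq (U := C.image (phi ε m))
      (V := V.image (phi ε (m + 1))) (Finset.image_subset_image hC) (Finset.image_subset_image hV)
      ((cupSet_phi hε m).2 (hcup.mono (Finset.subset_insert _ _))) ((capSet_phi hε _).2 hVc)
      (by rw [Finset.card_image_of_injective _ (phi_inj hε m)]; omega)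
      (by rw [Finset.card_image_of_injective _ (phi_inj hε _)]; omega) (phi ε m r').1 ?_ ?_ ?_ ?_
    · simp only [Finset.forall_mem_image, ne_eq, phi_eq hε]
      exact fun a ha => hx a (hC ha)
    · simp only [Finset.forall_mem_image, phi_lt hε]
      intro a ha b hb hab
      have ha' := Finset.mem_insert_of_mem (b := r') ha
      have hb' := Finset.mem_insert_of_mem (b := r') hb
      refine ⟨fun h => ?_, fun h1 h2 => ?_, fun h => ?_⟩
      · have := hcup _ hmi _ ha' _ hb' h hab
        have := tpos a (hC ha) b (hC hb) hab (by unfold ori at *; linarith)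
        unfold ori at *; linarith
      · have := hcup _ ha' _ hmi _ hb' h1 h2
        have := tneg a (hC ha) b (hC hb) hab (by unfold ori at *; linarith)
        unfold ori at *; linarith
      · exact tpos a (hC ha) b (hC hb) hab (hcup _ ha' _ hb' _ hmi hab h)
    · simp only [Finset.forall_mem_image, phi_lt hε]
      intro u hu v hv
      have h0 := hup u (hC hu) v (hV hv)
      refine ⟨fun h => pos_of_mul_pos_right h0 (by linarith), fun h => ?_⟩
      rw [ori_swap']
      by_contra hc
      have := mul_nonpos_of_nonpos_of_nonneg (a := r'.1 - u.1) (by linarith)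
        (show 0 ≤ ori (phi ε m u) (phi ε m r) (phi ε (m + 1) v) by linarith)
      linarith
    · simp only [Finset.forall_mem_image, phi_lt hε]
      intro a ha b hb hab
      exact S.pair_dn (by omega) (by omega) (hV ha) (hV hb) hab hr
  · obtain ⟨U, hU, cU, hUc⟩ := sat_cup_pred (S.sat (m - 1) (by omega)) (by omega)
    have hmi := Finset.mem_insert_self r' C
    obtain ⟨i, rfl⟩ : ∃ i, m = i + 1 := ⟨m - 1, by omega⟩
    simp only [Nat.add_sub_cancel] at *
    refine win_cap S.hn S.clusters (i := i) (by omega) hq (V := C.image (phi ε (i + 1)))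
      (U := U.image (phi ε i)) (Finset.image_subset_image hU) (Finset.image_subset_image hC)
      ((cupSet_phi hε _).2 hUc) ((capSet_phi hε _).2 (hcap.mono (Finset.subset_insert _ _)))
      (by rw [Finset.card_image_of_injective _ (phi_inj hε _)]; omega)
      (by rw [Finset.card_image_of_injective _ (phi_inj hε _)]; omega) (phi ε (i + 1) r').1 ?_ ?_ ?_ ?_
    · simp only [Finset.forall_mem_image, ne_eq, phi_eq hε]
      exact fun a ha => hx a (hC ha)
    · simp only [Finset.forall_mem_image, phi_lt hε]
      intro a ha b hb hab
      have ha' := Finset.mem_insert_of_mem (b := r') ha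
      have hb' := Finset.mem_insert_of_mem (b := r') hb
      refine ⟨fun h => ?_, fun h1 h2 => ?_, fun h => ?_⟩
      · have := hcap _ hmi _ ha' _ hb' h hab
        have := tneg a (hC ha) b (hC hb) hab (by unfold ori at *; linarith)
        unfold ori at *; linarith
      · have := hcap _ ha' _ hmi _ hb' h1 h2
        have := tpos a (hC ha) b (hC hb) hab (by unfold ori at *; linarith)
        unfold ori at *; linarith
      · exact tneg a (hC ha) b (hC hb) hab (hcap _ ha' _ hb' _ hmi hab h)
    · simp only [Finset.forall_mem_image, phi_lt hε]
      intro v hv u hu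
      have h0 := hdn v (hC hv) u (hU hu)
      refine ⟨fun h => ?_, fun h => ?_⟩
      · by_contra hc
        have := mul_nonneg (a := r'.1 - v.1) (by linarith) (not_lt.1 hc)
        linarith
      · rw [ori_swap']
        by_contra hc
        have := mul_nonneg_of_nonpos_of_nonpos (a := r'.1 - v.1) (by linarith)
          (show ori (phi ε (i + 1) v) (phi ε (i + 1) r) (phi ε i u) ≤ 0 by linarith)
        linarith
    · simp only [Finset.forall_mem_image, phi_lt hε]
      intro a ha b hb hab
      exact S.pair_up (by omega) (by omega) (hU ha) (hU hb) hab hr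

lemma gp_neg {b c w z q : ℝ × ℝ} (h1 : 0 < ori b c w) (h2 : ori b z q < 0) (h3 : 0 < ori b c z)
    (h4 : ori b c q < 0) (h5 : 0 < ori b w z) : ori b w q < 0 := by
  have e : ∀ x, ori b x (2 * b.1 - q.1, 2 * b.2 - q.2) = - ori b x q := by
    intro x; unfold ori; ring
  have := gp_pos (q := (2 * b.1 - q.1, 2 * b.2 - q.2)) h1 (by rw [e]; linarith) h3
    (by rw [e]; linarith) h5
  rw [e] at this; linarith

/-- Non-unanimous signs give a chain of length `n`. -/
lemma Setup.win_nonunan (S : Setup n P ε K M) {m : ℕ} (hm1 : 1 ≤ m) (hm : m + 3 ≤ n)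
    {r : ℝ × ℝ} (hq : phi ε m r ∉ allPts n (GG P ε)) (hr : InBox (bigK K M) r)
    {p w w' : ℝ × ℝ} (hp : p ∈ P m) (hw : w ∈ P (m - 1)) (hw' : w' ∈ P (m + 1))
    (h : 0 < ori (phi ε m p) (phi ε m r) (phi ε (m - 1) w) *
      ori (phi ε m p) (phi ε m r) (phi ε (m + 1) w')) :
    Win n (GG P ε) (phi ε m r) := by
  classical
  have hne : ∀ j, j < n - 1 → (P j).Nonempty := fun j hj =>
    sat_nonempty (S.sat j hj) (by omega) (by omega)
  obtain ⟨σ, hσ, e0, e1, e2⟩ : ∃ σ : ℕ → ℝ × ℝ, (∀ j, j < n - 1 → σ j ∈ P j) ∧ σ (m - 1) = w ∧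
      σ m = p ∧ σ (m + 1) = w' := by
    refine ⟨fun j => if j = m - 1 then w else if j = m then p else if j = m + 1 then w' else
      if hj : j < n - 1 then (hne j hj).choose else 0, ?_, ?_, ?_, ?_⟩
    · intro j hj
      dsimp only
      split_ifs with h1 h2 h3
      · rw [h1]; exact hw
      · rw [h2]; exact hp
      · rw [h3]; exact hw'
      · exact (hne j hj).choose_spec
    · simp
    · simp [show m ≠ m - 1 by omega]
    · simp [show m + 1 ≠ m - 1 by omega]
  subst e0 e1 e2
  have hb : ∀ j, j < n - 1 → InBox (bigK K M) (σ j) := fun j hj => S.bbox hj (hσ j hj)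
  have hch : ∀ i j k, i < j → j < k → k < n - 1 →
      ori (phi ε i (σ i)) (phi ε j (σ j)) (phi ε k (σ k)) < 0 := fun i j k h1 h2 h3 =>
    S.est1 h1 h2 h3 (hb i (by omega)) (hb j (by omega)) (hb k h3)
  have hzz := hch (m - 1) m (m + 1) (by omega) (by omega) (by omega)
  have key : ∀ j, j < n - 1 → j ≠ m → j ≠ m - 1 → j ≠ m + 1 →
      0 < ori (phi ε m (σ m)) (phi ε (m - 1) (σ (m - 1))) (phi ε j (σ j)) ∧
      0 < ori (phi ε m (σ m)) (phi ε j (σ j)) (phi ε (m + 1) (σ (m + 1))) := by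
    intro j hj h1 h2 h3
    rcases lt_or_gt_of_ne h1 with h4 | h4
    · have a1 := hch j (m - 1) m (by omega) (by omega) (by omega)
      have a2 := hch j m (m + 1) (by omega) (by omega) (by omega)
      constructor <;> unfold ori at * <;> linarith
    · have a1 := hch (m - 1) m j (by omega) (by omega) (by omega)
      have a2 := hch m (m + 1) j (by omega) (by omega) (by omega)
      constructor <;> unfold ori at * <;> linarith
  have hzz' : 0 < ori (phi ε m (σ m)) (phi ε (m - 1) (σ (m - 1))) (phi ε (m + 1) (σ (m + 1))) := by
    unfold ori at *; linarith
  rcases pos_and_pos_or_neg_and_neg_of_mul_pos h with ⟨ha, hb'⟩ | ⟨ha, hb'⟩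
  · have hall : ∀ j, j < n - 1 → j ≠ m → ori (phi ε m (σ m)) (phi ε j (σ j)) (phi ε m r) < 0 := by
      intro j hj hjm
      rw [ori_swap] at ha hb'
      by_cases h1 : j = m - 1
      · subst h1; linarith
      by_cases h2 : j = m + 1
      · subst h2; linarith
      obtain ⟨k1, k2⟩ := key j hj hjm h1 h2
      exact gp_neg k1 (by linarith) hzz' (by linarith) k2
    refine win_chain S.hn S.clusters hq (fun j => phi ε j (σ j)) (fun j hj => mem_GG (hσ j hj)) m
      ?_ ?_ ?_
    · intro j k h1 h2 h3
      exact S.est1 h1 h3 (by omega) (hb j (by omega)) (hb k (by omega)) hr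
    · intro j k h1 h2 h3
      rcases h2.lt_or_eq with h2 | rfl
      · exact S.est1 h1 h2 h3 (hb j (by omega)) hr (hb k h3)
      · have := hall j (by omega) (by omega)
        unfold ori at *; linarith
    · intro j k h1 h2 h3
      rcases h1.lt_or_eq with h1 | rfl
      · exact S.est1 h1 h2 h3 hr (hb j (by omega)) (hb k h3)
      · have := hall k (by omega) (by omega)
        unfold ori at *; linarith
  · have hall : ∀ j, j < n - 1 → j ≠ m → 0 < ori (phi ε m (σ m)) (phi ε j (σ j)) (phi ε m r) := by
      intro j hj hjm
      rw [ori_swap] at ha hb'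
      by_cases h1 : j = m - 1
      · subst h1; linarith
      by_cases h2 : j = m + 1
      · subst h2; linarith
      obtain ⟨k1, k2⟩ := key j hj hjm h1 h2
      exact gp_pos k1 (by linarith) hzz' (by linarith) k2
    refine win_chain S.hn S.clusters hq (fun j => phi ε j (σ j)) (fun j hj => mem_GG (hσ j hj))
      (m + 1) ?_ ?_ ?_
    · intro j k h1 h2 h3
      rcases (Nat.lt_succ_iff.1 h3).lt_or_eq with h3 | rfl
      · exact S.est1 h1 h3 (by omega) (hb j (by omega)) (hb k (by omega)) hr
      · have := hall j (by omega) (by omega)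
        unfold ori at *; linarith
    · intro j k h1 h2 h3
      rcases (Nat.lt_succ_iff.1 h1).lt_or_eq with h1 | rfl
      · exact S.est1 h1 h2 h3 (hb j (by omega)) hr (hb k h3)
      · have := hall k (by omega) (by omega)
        unfold ori at *; linarith
    · intro j k h1 h2 h3
      exact S.est1 h1 h2 h3 hr (hb j (by omega)) (hb k h3)

end


section
variable {n : ℕ} {P : ℕ → Finset (ℝ × ℝ)} {ε K M : ℝ}

lemma Setup.iface_near (S : Setup n P ε K M) {m : ℕ} (hm1 : 1 ≤ m) (hm : m + 3 ≤ n)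
    {r : ℝ × ℝ} (hq : phi ε m r ∉ allPts n (GG P ε)) (hr : InBox (bigK K M) r)
    (hgen : ∀ a ∈ allPts n (GG P ε), ∀ b ∈ allPts n (GG P ε), a ≠ b → ori a b (phi ε m r) ≠ 0) :
    Win n (GG P ε) (phi ε m r) := by
  have hε := S.hε
  have hmem : ∀ j, j < n - 1 → ∀ p ∈ P j, phi ε j p ∈ allPts n (GG P ε) := fun j hj p hp =>
    sub_allPts hj (mem_GG hp)
  have hrP : r ∉ P m := fun h => hq (hmem m (by omega) r h)
  have hgo : ∀ a ∈ P m, ∀ b ∈ P m, a.1 < b.1 → ori a b r ≠ 0 := by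
    intro a ha b hb hab h0
    refine hgen _ (hmem m (by omega) a ha) _ (hmem m (by omega) b hb) ?_ (by rw [ori_phi, h0, mul_zero])
    intro h
    rw [phi_inj hε m h] at hab
    exact lt_irrefl _ hab
  have hnz : ∀ j, j < n - 1 → j ≠ m → ∀ p ∈ P m, ∀ w ∈ P j,
      ori (phi ε m p) (phi ε m r) (phi ε j w) ≠ 0 := by
    intro j hj hjm p hp w hw h0
    have hpm := mem_GG (ε := ε) hp
    have hwm := mem_GG (ε := ε) hw
    refine hgen _ (hmem m (by omega) p hp) _ (hmem j hj w hw) ?_ (by rw [ori_swap, h0, neg_zero])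
    intro h
    rcases lt_or_gt_of_ne hjm with h1 | h1
    · exact S.clusters.not_mem h1 (by omega) hwm (h ▸ hpm)
    · exact S.clusters.not_mem h1 (by omega) hpm (h ▸ hwm)
  by_contra hW
  have hopp : ∀ p ∈ P m, ∀ w ∈ P (m - 1), ∀ w' ∈ P (m + 1),
      ori (phi ε m p) (phi ε m r) (phi ε (m - 1) w) *
      ori (phi ε m p) (phi ε m r) (phi ε (m + 1) w') < 0 := by
    intro p hp w hw w' hw'
    rcases lt_trichotomy (ori (phi ε m p) (phi ε m r) (phi ε (m - 1) w) *
      ori (phi ε m p) (phi ε m r) (phi ε (m + 1) w')) 0 with h | h | h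
    · exact h
    · rcases mul_eq_zero.1 h with h | h
      · exact absurd h (hnz _ (by omega) (by omega) p hp w hw)
      · exact absurd h (hnz _ (by omega) (by omega) p hp w' hw')
    · exact absurd (S.win_nonunan hm1 hm hq hr hp hw hw' h) hW
  obtain ⟨w0, hw0⟩ := sat_nonempty (S.sat (m - 1) (by omega)) (by omega) (by omega)
  obtain ⟨w1, hw1⟩ := sat_nonempty (S.sat (m + 1) (by omega)) (by omega) (by omega)
  -- the common sign
  have hsign : ∀ p ∈ P m, ∃ s : ℝ, |s| = 1 ∧
      (∀ w ∈ P (m + 1), 0 < s * ori (phi ε m p) (phi ε m r) (phi ε (m + 1) w)) ∧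
      (∀ w ∈ P (m - 1), s * ori (phi ε m p) (phi ε m r) (phi ε (m - 1) w) < 0) := by
    intro p hp
    have h00 := hopp p hp w0 hw0 w1 hw1
    rcases mul_neg_iff.1 h00 with ⟨h1, h2⟩ | ⟨h1, h2⟩
    · refine ⟨-1, by simp, fun w hw => ?_, fun w hw => ?_⟩
      · have := hopp p hp w0 hw0 w hw
        by_contra hc
        nlinarith
      · have := hopp p hp w hw w1 hw1
        by_contra hc
        nlinarith
    · refine ⟨1, by simp, fun w hw => ?_, fun w hw => ?_⟩
      · have := hopp p hp w0 hw0 w hw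
        by_contra hc
        nlinarith
      · have := hopp p hp w hw w1 hw1
        by_contra hc
        nlinarith
  -- combine factors
  have hcomb : ∀ s x o : ℝ, |s| = 1 → 0 < s * x → 0 < s * o → 0 < x * o := by
    intro s x o hs h1 h2
    have h3 := mul_pos h1 h2
    have : s * s = 1 := by rw [← abs_mul_abs_self, hs, one_mul]
    have e : s * x * (s * o) = (s * s) * (x * o) := by ring
    rw [e, this, one_mul] at h3; exact h3
  have hcomb' : ∀ s x o : ℝ, |s| = 1 → 0 < s * x → s * o < 0 → x * o < 0 := by
    intro s x o hs h1 h2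
    have := hcomb s x (-o) hs h1 (by linarith)
    linarith
  by_cases hmis : ∃ p0 ∈ P m, ∃ s : ℝ, |s| = 1 ∧ s * (r.1 - p0.1) ≤ 0 ∧
      (∀ w ∈ P (m + 1), 0 < s * ori (phi ε m p0) (phi ε m r) (phi ε (m + 1) w)) ∧
      (∀ w ∈ P (m - 1), s * ori (phi ε m p0) (phi ε m r) (phi ε (m - 1) w) < 0)
  · obtain ⟨p0, hp0, s, hs, hle, hsu, hsd⟩ := hmis
    have hst : |r.1 - p0.1| ≤ stp n ε * |r.2 - p0.2| := by
      apply S.steep_up (j := m + 1) (by omega) (by omega) hp0 (S.bbox (by omega) hw1)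
      have h1 := hsu w1 hw1
      have h3 := mul_nonpos_of_nonpos_of_nonneg hle h1.le
      have : s * s = 1 := by rw [← abs_mul_abs_self, hs, one_mul]
      have e : s * (r.1 - p0.1) * (s * ori (phi ε m p0) (phi ε m r) (phi ε (m + 1) w1)) =
        (s * s) * ((r.1 - p0.1) * ori (phi ε m p0) (phi ε m r) (phi ε (m + 1) w1)) := by ring
      rw [e, this, one_mul] at h3; exact h3
    obtain ⟨hns, hex⟩ := S.lv m (by omega) r hr hrP hgo p0 hp0 hst
    obtain ⟨r', h1, h2, h3⟩ := hex s hs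
    refine hW (S.win_match hm1 hm (r' := r') hq hr ?_ ?_ ?_ h3)
    · intro p hp h
      by_cases hpp : p = p0
      · subst hpp; rw [h, sub_self, mul_zero] at h1; exact lt_irrefl _ h1
      · have := h2 p hp hpp
        rw [h, sub_self, mul_zero] at this; exact lt_irrefl _ this
    · intro p hp w hw
      by_cases hpp : p = p0
      · subst hpp; exact hcomb s _ _ hs h1 (hsu w hw)
      · have h4 := h2 p hp hpp
        have h5 : 0 < (r.1 - p.1) * ori (phi ε m p) (phi ε m r) (phi ε (m + 1) w) := by
          by_contra hc
          exact hns p hp hpp (S.steep_up (by omega) (by omega) hp (S.bbox (by omega) hw) r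
            (not_lt.1 hc))
        by_contra hc
        have h6 := mul_pos h4 h5
        have h7 := mul_nonpos_of_nonneg_of_nonpos (mul_self_nonneg (r.1 - p.1)) (not_lt.1 hc)
        nlinarith
    · intro p hp w hw
      by_cases hpp : p = p0
      · subst hpp; exact hcomb' s _ _ hs h1 (hsd w hw)
      · have h4 := h2 p hp hpp
        have h5 : (r.1 - p.1) * ori (phi ε m p) (phi ε m r) (phi ε (m - 1) w) < 0 := by
          by_contra hc
          exact hns p hp hpp (S.steep_dn (by omega) (by omega) hp (S.bbox (by omega) hw) r
            (not_lt.1 hc))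
        by_contra hc
        have h6 := mul_neg_of_pos_of_neg h4 h5
        have h7 := mul_nonneg (mul_self_nonneg (r.1 - p.1)) (not_lt.1 hc)
        nlinarith
  · have hall : ∀ p ∈ P m, ∃ s : ℝ, |s| = 1 ∧ 0 < s * (r.1 - p.1) ∧
      (∀ w ∈ P (m + 1), 0 < s * ori (phi ε m p) (phi ε m r) (phi ε (m + 1) w)) ∧
      (∀ w ∈ P (m - 1), s * ori (phi ε m p) (phi ε m r) (phi ε (m - 1) w) < 0) := by
      intro p hp
      obtain ⟨s, h1, h2, h3⟩ := hsign p hp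
      refine ⟨s, h1, ?_, h2, h3⟩
      by_contra hc
      exact hmis ⟨p, hp, s, h1, not_lt.1 hc, h2, h3⟩
    refine hW (S.win_match hm1 hm (r' := r) hq hr ?_ ?_ ?_ ?_)
    · intro p hp h
      obtain ⟨s, -, h1, -⟩ := hall p hp
      rw [h, sub_self, mul_zero] at h1; exact lt_irrefl _ h1
    · intro p hp w hw
      obtain ⟨s, hs, h1, h2, -⟩ := hall p hp
      exact hcomb s _ _ hs h1 (h2 w hw)
    · intro p hp w hw
      obtain ⟨s, hs, h1, -, h2⟩ := hall p hp
      exact hcomb' s _ _ hs h1 (h2 w hw)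
    · intro a ha b hb hab
      exact mul_self_pos.2 (hgo a ha b hb hab)

lemma Setup.far_sign (S : Setup n P ε K M) {m : ℕ} (hm : m < n - 1) {r p : ℝ × ℝ}
    (hfar : K + 1 < |r.1|) (hrb : |r.2| ≤ M * (|r.1| + 1)) (hp : p ∈ P m) :
    ¬ |r.1 - p.1| ≤ stp n ε * |r.2 - p.2| := by
  intro h
  obtain ⟨b1, b2⟩ := S.box m hm p hp
  have h1 : |r.1| - K ≤ |r.1 - p.1| := by linarith [abs_sub_abs_le_abs_sub r.1 p.1]
  have h2 : |r.2 - p.2| ≤ M * (|r.1| + 1) + K := by linarith [abs_sub r.2 p.2]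
  have h3 : M * (|r.1| + 1) + K ≤ (M * (K + 2) + K) * (|r.1| - K) := by
    have := S.hM
    have := S.hK
    have e : (M * (K + 2) + K) * (|r.1| - K) - (M * (|r.1| + 1) + K) =
      (|r.1| - K - 1) * (M * (K + 1) + K) := by ring
    have : 0 ≤ (|r.1| - K - 1) * (M * (K + 1) + K) := by
      apply mul_nonneg (by linarith); positivity
    linarith
  have h4 := mul_le_mul_of_nonneg_left (h2.trans h3) S.stp_pos.le
  have h5 := mul_lt_mul_of_pos_right S.far (by linarith : 0 < |r.1| - K)
  nlinarith

lemma Setup.iface (S : Setup n P ε K M) {m : ℕ} (hm1 : 1 ≤ m) (hm : m + 3 ≤ n)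
    {q : ℝ × ℝ} (hq : q ∉ allPts n (GG P ε))
    (hgen : ∀ a ∈ allPts n (GG P ε), ∀ b ∈ allPts n (GG P ε), a ≠ b → ori a b q ≠ 0) :
    AboveAll (GG P ε m) q ∨ BelowAll (GG P ε m) q ∨
      ((CupT (GG P ε) q m ∨ CapT n (GG P ε) q m) ∧ SideUp (GG P ε) q m ∧
        SideUp (GG P ε) q (m - 1)) ∨ Win n (GG P ε) q := by
  have hε := S.hε
  obtain ⟨r, rfl⟩ : ∃ r, q = phi ε m r := ⟨_, (phi_psi hε m q).symm⟩
  by_cases hA : AboveAll (P m) r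
  · left
    simp only [AboveAll, GG, Finset.forall_mem_image, phi_lt hε, ori_phi_pos hε]
    exact hA
  by_cases hB : BelowAll (P m) r
  · right; left
    simp only [BelowAll, GG, Finset.forall_mem_image, phi_lt hε, ori_phi_neg hε]
    exact hB
  right; right
  have hrb := S.rb m (by omega) r hA hB
  by_cases hfar : K + 1 < |r.1|
  swap
  · right
    rw [not_lt] at hfar
    refine S.iface_near hm1 hm hq ⟨?_, ?_⟩ hgen
    · have := mul_pos S.hM (by linarith [S.hK] : 0 < K + 2)
      unfold bigK; linarith
    · have := mul_le_mul_of_nonneg_left (by linarith : |r.1| + 1 ≤ K + 2) S.hM.le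
      have := S.hK
      unfold bigK; linarith
  left
  have hns := fun p (hp : p ∈ P m) => S.far_sign (by omega) hfar hrb hp
  have hup : ∀ p ∈ P m, ∀ w ∈ P (m + 1),
      0 < (r.1 - p.1) * ori (phi ε m p) (phi ε m r) (phi ε (m + 1) w) := by
    intro p hp w hw
    by_contra hc
    exact hns p hp (S.steep_up (by omega) (by omega) hp (S.bbox (by omega) hw) r (not_lt.1 hc))
  have hdn : ∀ p ∈ P m, ∀ w ∈ P (m - 1),
      (r.1 - p.1) * ori (phi ε m p) (phi ε m r) (phi ε (m - 1) w) < 0 := by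
    intro p hp w hw
    by_contra hc
    exact hns p hp (S.steep_dn (by omega) (by omega) hp (S.bbox (by omega) hw) r (not_lt.1 hc))
  have hx : ∀ p ∈ P m, p.1 ≠ r.1 := by
    intro p hp h
    apply hns p hp
    rw [h, sub_self, abs_zero]
    exact mul_nonneg S.stp_pos.le (abs_nonneg _)
  have hgo : ∀ a ∈ P m, ∀ b ∈ P m, a.1 < b.1 → ori a b r ≠ 0 := by
    intro a ha b hb hab h0
    refine hgen _ (sub_allPts (by omega) (mem_GG ha)) _ (sub_allPts (by omega) (mem_GG hb)) ?_
      (by rw [ori_phi, h0, mul_zero])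
    intro h
    rw [phi_inj hε m h] at hab
    exact lt_irrefl _ hab
  have hside : (∀ p ∈ P m, p.1 < r.1) ∨ (∀ p ∈ P m, r.1 < p.1) := by
    rcases le_total 0 r.1 with h | h
    · left; intro p hp
      rw [abs_of_nonneg h] at hfar
      linarith [(abs_le.1 (S.box m (by omega) p hp).1).2]
    · right; intro p hp
      rw [abs_of_nonpos h] at hfar
      linarith [(abs_le.1 (S.box m (by omega) p hp).1).1]
  have hc1 : CupT (GG P ε) (phi ε m r) m ∨ CapT n (GG P ε) (phi ε m r) m := by
    rcases sat_cases (S.sat m (by omega)) (fun h => hx r h rfl)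
      (generic_insert_s19 (S.sat m (by omega)).1 hx hgo) with ⟨C, hC, cC, hcup⟩ | ⟨C, hC, cC, hcap⟩
    · left
      refine ⟨C.image (phi ε m), Finset.image_subset_image hC,
        by rw [Finset.card_image_of_injective _ (phi_inj hε _)]; omega,
        (cupSet_phi hε m).2 (hcup.mono (Finset.subset_insert _ _)), ?_⟩
      simp only [AboveAll, Finset.forall_mem_image, phi_lt hε, ori_phi_pos hε]
      intro a ha b hb hab
      have ha' := Finset.mem_insert_of_mem (b := r) ha
      have hb' := Finset.mem_insert_of_mem (b := r) hb
      rcases hside with h | h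
      · exact hcup a ha' b hb' r (Finset.mem_insert_self _ _) hab (h b (hC hb))
      · have := hcup r (Finset.mem_insert_self _ _) a ha' b hb' (h a (hC ha)) hab
        unfold ori at *; linarith
    · right
      refine ⟨C.image (phi ε m), Finset.image_subset_image hC,
        by rw [Finset.card_image_of_injective _ (phi_inj hε _)]; omega,
        (capSet_phi hε m).2 (hcap.mono (Finset.subset_insert _ _)), ?_⟩
      simp only [BelowAll, Finset.forall_mem_image, phi_lt hε, ori_phi_neg hε]
      intro a ha b hb hab
      have ha' := Finset.mem_insert_of_mem (b := r) ha
      have hb' := Finset.mem_insert_of_mem (b := r) hb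
      rcases hside with h | h
      · exact hcap a ha' b hb' r (Finset.mem_insert_self _ _) hab (h b (hC hb))
      · have := hcap r (Finset.mem_insert_self _ _) a ha' b hb' (h a (hC ha)) hab
        unfold ori at *; linarith
  refine ⟨hc1, ?_, ?_⟩
  · unfold SideUp
    simp only [GG, Finset.forall_mem_image]
    rcases hside with h | h
    · right; intro c hc d hd
      have h1 := pos_of_mul_pos_right (hup c hc d hd) (by linarith [h c hc])
      rw [ori_swap]; linarith
    · left; intro c hc d hd
      have h0 := hup c hc d hd
      have h1 := h c hc
      rw [ori_swap]
      by_contra hh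
      nlinarith
  · unfold SideUp
    rw [Nat.sub_add_cancel hm1]
    simp only [GG, Finset.forall_mem_image]
    rcases hside with h | h
    · right; intro c hc d hd
      have h0 := hdn d hd c hc
      have h1 := h d hd
      rw [← ori_rot]
      by_contra hh
      nlinarith
    · left; intro c hc d hd
      have h0 := hdn d hd c hc
      have h1 := h d hd
      rw [← ori_rot]
      by_contra hh
      nlinarith

lemma Clusters.genPos {G : ℕ → Finset (ℝ × ℝ)} (hG : Clusters n G)
    (hg : ∀ i, i < n - 1 → GenPos (G i)) : GenPos (allPts n G) := by
  have two : ∀ i j, i < n - 1 → j < n - 1 → i ≠ j → ∀ a ∈ G i, ∀ b ∈ G i, a ≠ b → ∀ c ∈ G j,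
      ori a b c ≠ 0 := by
    intro i j hi hj hij a ha b hb hab c hc
    rcases lt_trichotomy a.1 b.1 with h | h | h
    · rcases lt_or_gt_of_ne hij with h1 | h1
      · exact (hG.up i j h1 hj a ha b hb h c hc).ne'
      · exact (hG.down j i h1 hi a ha b hb h c hc).ne
    · exact absurd (hG.xinj i hi ha hb h) hab
    · rw [ori_swap', neg_ne_zero]
      rcases lt_or_gt_of_ne hij with h1 | h1
      · exact (hG.up i j h1 hj b hb a ha h c hc).ne'
      · exact (hG.down j i h1 hi b hb a ha h c hc).ne
  have three : ∀ i j k, i < j → j < k → k < n - 1 → ∀ a ∈ G i, ∀ b ∈ G j, ∀ c ∈ G k,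
      ori a b c < 0 := hG.bulge
  rw [genPos_iff]
  intro p hp q hq r hr hpq hpr hqr
  obtain ⟨i, hi, hp⟩ := mem_allPts.1 hp
  obtain ⟨j, hj, hq⟩ := mem_allPts.1 hq
  obtain ⟨k, hk, hr⟩ := mem_allPts.1 hr
  by_cases h1 : i = j
  · subst h1
    by_cases h2 : i = k
    · subst h2
      exact (genPos_iff _).1 (hg i hi) p hp q hq r hr hpq hpr hqr
    · exact two i k hi hk h2 p hp q hq hpq r hr
  by_cases h2 : i = k
  · subst h2
    rw [ori_swap, neg_ne_zero]
    exact two i j hi hj h1 p hp r hr hpr q hq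
  by_cases h3 : j = k
  · subst h3
    rw [← ori_rot]
    exact two j i hj hi (Ne.symm h1) q hq r hr hqr p hp
  intro h0
  have e1 := ori_swap p q r
  have e2 := ori_swap' p q r
  have e3 := ori_rot p q r
  have e4 := ori_rot q r p
  have e5 := ori_swap r p q
  have e6 := ori_swap q r p
  rcases lt_or_gt_of_ne h1 with a1 | a1 <;> rcases lt_or_gt_of_ne h2 with a2 | a2 <;>
    rcases lt_or_gt_of_ne h3 with a3 | a3
  · have := three i j k a1 a3 hk p hp q hq r hr; linarith
  · have := three i k j a2 a3 hj p hp r hr q hq; unfold ori at *; linarith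
  · omega
  · have := three k i j a2 a1 hj r hr p hp q hq; unfold ori at *; linarith
  · have := three j i k a1 a2 hk q hq p hp r hr; unfold ori at *; linarith
  · omega
  · have := three j k i a3 a2 hi q hq r hr p hp; unfold ori at *; linarith
  · have := three k j i a3 a1 hi r hr q hq p hp; unfold ori at *; linarith

lemma Setup.final (S : Setup n P ε K M) :
    ∃ Q : Finset (ℝ × ℝ), GenPos Q ∧ Q.card = ∑ i ∈ Finset.range (n - 1), (P i).card ∧
      (¬ ∃ S : Finset (ℝ × ℝ), S ⊆ Q ∧ S.card = n ∧ ConvexPos ↑S) ∧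
      ∀ q : ℝ × ℝ, q ∉ Q → GenPos (insert q Q) →
        ∃ S : Finset (ℝ × ℝ), S ⊆ insert q Q ∧ q ∈ S ∧ S.card = n ∧ ConvexPos ↑S := by
  have hε := S.hε
  have hsat : ∀ i, i < n - 1 → CupCapSat (GG P ε i) (i + 2) (n - i) := fun i hi =>
    sat_phi hε i (S.sat i hi)
  refine ⟨allPts n (GG P ε), S.clusters.genPos (fun i hi => (hsat i hi).1.1), ?_, ?_, ?_⟩
  · unfold allPts
    rw [Finset.card_biUnion]
    · exact Finset.sum_congr rfl fun i _ => Finset.card_image_of_injective _ (phi_inj hε i)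
    · intro i hi j hj hij
      rw [Finset.mem_coe, Finset.mem_range] at hi hj
      rcases lt_or_gt_of_ne hij with h | h
      · exact S.clusters.disj i j h hj
      · exact (S.clusters.disj j i h hi).symm
  · rintro ⟨T, h1, h2, h3⟩
    refine no_gon S.hn S.clusters (fun i hi C hC hcup => ?_) (fun i hi C hC hcap => ?_) T h1 h2 h3
    · exact sat_cup_le (k := i + 1) (hsat i hi) hC hcup
    · have := hsat i hi
      rw [show n - i = (n - i - 1) + 1 by omega] at this
      exact sat_cap_le this hC hcap
  · intro q hq hg
    rw [genPos_iff] at hg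
    have hgen : ∀ a ∈ allPts n (GG P ε), ∀ b ∈ allPts n (GG P ε), a ≠ b → ori a b q ≠ 0 := by
      intro a ha b hb hab
      exact hg a (Finset.mem_insert_of_mem ha) b (Finset.mem_insert_of_mem hb) q
        (Finset.mem_insert_self _ _) hab (fun h => hq (h ▸ ha)) (fun h => hq (h ▸ hb))
    exact combine S.hn S.clusters S.mono hsat hq hgen fun i h1 h2 => S.iface h1 h2 hq hgen

end

open Filter Topology

lemma exists_setup {n : ℕ} (hn : 3 ≤ n) {P : ℕ → Finset (ℝ × ℝ)}
    (hvg : ∀ i, i < n - 1 → VeryGeneric (P i))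
    (hsat : ∀ i, i < n - 1 → CupCapSat (P i) (i + 2) (n - i)) :
    ∃ ε K M : ℝ, Setup n P ε K M := by
  obtain ⟨K, hK, hbox⟩ : ∃ K : ℝ, 0 < K ∧ ∀ i, i < n - 1 → ∀ p ∈ P i, InBox K p := by
    have h : ∀ᶠ K : ℝ in atTop, 0 < K ∧ ∀ i ∈ Finset.range (n - 1), ∀ p ∈ P i, InBox K p := by
      refine (eventually_gt_atTop 0).and ?_
      rw [eventually_all_finset]; intro i _
      rw [eventually_all_finset]; intro p _
      exact (eventually_ge_atTop |p.1|).and (eventually_ge_atTop |p.2|)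
    obtain ⟨K, h1, h2⟩ := h.exists
    exact ⟨K, h1, fun i hi => h2 i (Finset.mem_range.2 hi)⟩
  obtain ⟨M, hM, hrb⟩ : ∃ M : ℝ, 0 < M ∧ ∀ i, i < n - 1 → ∀ q, ¬ AboveAll (P i) q →
      ¬ BelowAll (P i) q → |q.2| ≤ M * (|q.1| + 1) := by
    choose m hm0 hm using fun i => rbound (P i)
    have h : ∀ᶠ M : ℝ in atTop, 0 < M ∧ ∀ i ∈ Finset.range (n - 1), m i ≤ M := by
      refine (eventually_gt_atTop 0).and ?_
      rw [eventually_all_finset]; intro i _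
      exact eventually_ge_atTop _
    obtain ⟨M, h1, h2⟩ := h.exists
    refine ⟨M, h1, fun i hi q ha hb => (hm i q ha hb).trans ?_⟩
    exact mul_le_mul_of_nonneg_right (h2 i (Finset.mem_range.2 hi)) (by positivity)
  have hKle : K ≤ bigK K M := by
    have := mul_pos hM (by linarith : 0 < K + 2)
    unfold bigK; linarith
  have hlv : ∀ i, ∃ η > 0, i < n - 1 → ∀ q : ℝ × ℝ, |q.1| ≤ bigK K M → |q.2| ≤ bigK K M →
      q ∉ P i → (∀ a ∈ P i, ∀ b ∈ P i, a.1 < b.1 → ori a b q ≠ 0) → ∀ p0 ∈ P i,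
      |q.1 - p0.1| ≤ η * |q.2 - p0.2| →
      (∀ p ∈ P i, p ≠ p0 → ¬ |q.1 - p.1| ≤ η * |q.2 - p.2|) ∧
      ∀ s : ℝ, |s| = 1 → ∃ q' : ℝ × ℝ, 0 < s * (q'.1 - p0.1) ∧
        (∀ p ∈ P i, p ≠ p0 → 0 < (q.1 - p.1) * (q'.1 - p.1)) ∧
        ∀ a ∈ P i, ∀ b ∈ P i, a.1 < b.1 → 0 < ori a b q * ori a b q' := by
    intro i
    by_cases hi : i < n - 1
    · obtain ⟨η, h1, h2⟩ := lemV (hvg i hi) (bigK K M) (by linarith)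
        (fun p hp => ⟨(hbox i hi p hp).1.trans hKle, (hbox i hi p hp).2.trans hKle⟩)
      exact ⟨η, h1, fun _ => h2⟩
    · exact ⟨1, one_pos, fun h => absurd h hi⟩
  choose η hη0 hη using hlv
  have hgap : ∀ i, ∃ γ > 0, i < n - 1 → ∀ p ∈ P i, ∀ a ∈ P i, p ≠ a → γ < |p.1 - a.1| := by
    intro i
    by_cases hi : i < n - 1
    · obtain ⟨γ, h1, h2⟩ := exists_gap (hsat i hi).1.2
      exact ⟨γ, h1, fun _ => h2⟩
    · exact ⟨1, one_pos, fun h => absurd h hi⟩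
  choose γ hγ0 hγ using hgap
  have hev : ∀ᶠ ε : ℝ in 𝓝[>] 0, 0 < ε ∧ 1 * ε < 1 ∧ (2 * bigK K M) * ε < 1 / 2 ∧
      (2 * (2 * (n : ℝ) ^ 2 + 1) * (2 * bigK K M)) * ε < 1 ∧
      (2 * ((n : ℝ) ^ 2 + 1) * (M * (K + 2) + K)) * ε < 1 ∧
      ∀ i ∈ Finset.range (n - 1), (2 * ((n : ℝ) ^ 2 + 1) * (2 * bigK K M)) * ε < γ i ∧
        (2 * ((n : ℝ) ^ 2 + 1)) * ε < η i := by
    refine (eventually_mem_nhdsWithin).and ((ev_small _ _ one_pos).and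
      ((ev_small _ _ (by norm_num)).and ((ev_small _ _ one_pos).and ((ev_small _ _ one_pos).and ?_))))
    rw [eventually_all_finset]; intro i _
    exact (ev_small _ _ (hγ0 i)).and (ev_small _ _ (hη0 i))
  obtain ⟨ε, h0, h1, h2, h3, h4, h5⟩ := hev.exists
  refine ⟨ε, K, M, ?_⟩
  exact {
    hn := hn
    hε := h0
    hε1 := by linarith
    hK := hK
    hM := hM
    box := hbox
    rb := hrb
    d1 := h2.le
    d2 := by linarith
    gap := by
      intro i hi p hp a ha hpa
      have e1 := hγ i hi p hp a ha hpa
      have e2 := (h5 i (Finset.mem_range.2 hi)).1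
      unfold stp
      linarith
    far := by unfold stp; linarith
    sat := hsat
    lv := by
      intro i hi q hq hqP ho p0 hp0 hst
      have e2 : stp n ε ≤ η i := (h5 i (Finset.mem_range.2 hi)).2.le
      have e3 : ∀ x : ℝ, stp n ε * |x| ≤ η i * |x| := fun x =>
        mul_le_mul_of_nonneg_right e2 (abs_nonneg _)
      obtain ⟨k1, k2⟩ := hη i hi q hq.1 hq.2 hqP ho p0 hp0 (hst.trans (e3 _))
      exact ⟨fun p hp hpp h => k1 p hp hpp (h.trans (e3 _)), k2⟩ }

theorem gon_saturated_construction (n : ℕ) (hn : 3 ≤ n)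
    (P : Fin (n - 1) → Finset (ℝ × ℝ))
    (hP : ∀ i : Fin (n - 1), VeryGeneric (P i) ∧ CupCapSat (P i) ((i : ℕ) + 2) (n - (i : ℕ))) :
    ∃ Q : Finset (ℝ × ℝ), GenPos Q ∧ Q.card = ∑ i, (P i).card ∧
      (¬ ∃ S : Finset (ℝ × ℝ), S ⊆ Q ∧ S.card = n ∧ ConvexPos ↑S) ∧
      ∀ q : ℝ × ℝ, q ∉ Q → GenPos (insert q Q) →
        ∃ S : Finset (ℝ × ℝ), S ⊆ insert q Q ∧ q ∈ S ∧ S.card = n ∧ ConvexPos ↑S := by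
  obtain ⟨P', hP'⟩ : ∃ P' : ℕ → Finset (ℝ × ℝ), ∀ i : Fin (n - 1), P' i = P i :=
    ⟨fun i => if h : i < n - 1 then P ⟨i, h⟩ else ∅, fun i => by simp⟩
  have e : ∀ i (hi : i < n - 1), P' i = P ⟨i, hi⟩ := fun i hi => hP' ⟨i, hi⟩
  obtain ⟨ε, K, M, S⟩ := exists_setup hn (P := P') (fun i hi => by rw [e i hi]; exact (hP _).1)
    (fun i hi => by rw [e i hi]; exact (hP ⟨i, hi⟩).2)
  obtain ⟨Q, h1, h2, h3⟩ := S.final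
  refine ⟨Q, h1, ?_, h3⟩
  rw [h2, Finset.sum_range]
  exact Finset.sum_congr rfl fun i _ => by rw [hP' i]
end
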